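/- arXiv:2507.11927 — 2 statements merged into one kernel-verified Lean document; each statement's English description precedes it below -/
import Mathlib

section
/- Every graph with edge weight at most 6 (i.e., d(u)+d(v) ≤ 6 for every edge uv) has strong list-chromatic index at most 10. -/
/-- Two distinct edges of `G` conflict (are at distance at most 2) if they share an
endpoint or are joined by a common edge. -/
def edgeConflict {V : Type*} (G : SimpleGraph V) (e f : Sym2 V) : Prop :=
  e ≠ f ∧ ((∃ v, v ∈ e ∧ v ∈ f) ∨
    ∃ g ∈ G.edgeSet, (∃ v, v ∈ e ∧ v ∈ g) ∧ (∃ v, v ∈ g ∧ v ∈ f))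

/-- `φ` is a strong edge coloring of `G`: edges at distance at most 2 get distinct colors. -/
def IsStrongEdgeColoring {V : Type*} (G : SimpleGraph V) (φ : Sym2 V → ℕ) : Prop :=
  ∀ e ∈ G.edgeSet, ∀ f ∈ G.edgeSet, edgeConflict G e f → φ e ≠ φ f

/-- `φ` is a strong edge coloring of `G` from the lists `L`. -/
def IsStrongListColoring {V : Type*} (G : SimpleGraph V) (L : Sym2 V → Finset ℕ)
    (φ : Sym2 V → ℕ) : Prop :=
  IsStrongEdgeColoring G φ ∧ ∀ e ∈ G.edgeSet, φ e ∈ L e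

/-- `G` is strongly `k`-edge choosable. -/
def StronglyEdgeChoosable {V : Type*} (G : SimpleGraph V) (k : ℕ) : Prop :=
  ∀ L : Sym2 V → Finset ℕ, (∀ e ∈ G.edgeSet, k ≤ (L e).card) →
    ∃ φ, IsStrongListColoring G L φ

open MvPolynomial in
/-- The coefficient of the monomial with exponents `D` in the graph polynomial of `E`. -/
noncomputable def atCoef (E : List (ℕ × ℕ)) (D : ℕ →₀ ℕ) : ℤ :=
  ((E.map fun e => (X e.1 - X e.2 : MvPolynomial ℕ ℤ)).prod).coeff D

theorem atCoef_nil_zero : atCoef [] 0 = 1 := by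
  simp [atCoef]

theorem atCoef_cons (a b : ℕ) (E : List (ℕ × ℕ)) (D : ℕ →₀ ℕ) :
    atCoef ((a, b) :: E) D =
      (if D a = 0 then 0 else atCoef E (D - Finsupp.single a 1)) -
      (if D b = 0 then 0 else atCoef E (D - Finsupp.single b 1)) := by
  simp only [atCoef, List.map_cons, List.prod_cons, sub_mul, MvPolynomial.coeff_sub,
    MvPolynomial.coeff_X_mul', Finsupp.mem_support_iff, ne_eq, ite_not]

/-- The number of times `a` occurs as an endpoint in `E`. -/
def occCount (a : ℕ) : List (ℕ × ℕ) → ℕ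
  | [] => 0
  | e :: E => (bif e.1.beq a then 1 else 0) + (bif e.2.beq a then 1 else 0) + occCount a E

theorem atCoef_eq_zero {a : ℕ} (E : List (ℕ × ℕ)) (D : ℕ →₀ ℕ) (ha : occCount a E < D a) :
    atCoef E D = 0 := by
  classical
  induction E generalizing D with
  | nil =>
    have : (0 : ℕ →₀ ℕ) ≠ D := by
      rintro rfl
      simp at ha
    simp [atCoef, MvPolynomial.coeff_one, this]
  | cons e E ih =>
    obtain ⟨x, y⟩ := e
    simp only [occCount, Bool.cond_eq_ite, Nat.beq_eq] at ha
    rw [atCoef_cons, ih, ih]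
    · simp
    · simp only [Finsupp.coe_tsub, Pi.sub_apply, Finsupp.single_apply]
      split_ifs at ha ⊢ <;> omega
    · simp only [Finsupp.coe_tsub, Pi.sub_apply, Finsupp.single_apply]
      split_ifs at ha ⊢ <;> omega

open MvPolynomial in
/-- The Alon–Tarsi theorem in list form. -/
theorem exists_listColoring_of_atCoef_ne_zero {N : ℕ} {E : List (ℕ × ℕ)} {D : ℕ →₀ ℕ}
    (hE : ∀ e ∈ E, e.1 < N ∧ e.2 < N) (hD : ∀ i, N ≤ i → D i = 0)
    (h : atCoef E D ≠ 0) (S : ℕ → Finset ℕ) (hS : ∀ i < N, D i < (S i).card) :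
    ∃ c : ℕ → ℕ, (∀ i < N, c i ∈ S i) ∧ ∀ e ∈ E, c e.1 ≠ c e.2 := by
  classical
  obtain ⟨E', rfl⟩ : ∃ E' : List (Fin N × Fin N), E'.map (fun e => (e.1.1, e.2.1)) = E := by
    refine ⟨E.attach.map fun e => (⟨e.1.1, (hE _ e.2).1⟩, ⟨e.1.2, (hE _ e.2).2⟩), ?_⟩
    rw [List.map_map]
    exact List.attach_map_subtype_val E
  let D' : Fin N →₀ ℕ := Finsupp.equivFunOnFinite.symm fun i => D i
  have hDD : D = D'.mapDomain Fin.val := by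
    ext i
    by_cases hi : i < N
    · have := Finsupp.mapDomain_apply (Fin.val_injective (n := N)) D' ⟨i, hi⟩
      simp only at this
      rw [this]
      simp [D']
    · rw [hD i (by omega), Finsupp.mapDomain_of_notMem_range]
      simpa using hi
  let f : MvPolynomial (Fin N) ℤ := (E'.map fun e => (X e.1 - X e.2)).prod
  have hf : f.coeff D' ≠ 0 := by
    rw [← coeff_rename_mapDomain Fin.val Fin.val_injective, ← hDD]
    convert h using 1
    simp only [f, atCoef, List.map_map]
    congr 1
    rw [map_list_prod, List.map_map]
    congr 1
    refine List.map_congr_left fun e _ => ?_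
    simp
  have hhom : f.IsHomogeneous E'.length := by
    simp only [f]
    clear hf f h hE
    induction E' with
    | nil => simpa using isHomogeneous_one (Fin N) ℤ
    | cons e E' ih =>
      simp only [List.map_cons, List.prod_cons, List.length_cons]
      rw [add_comm]
      exact ((isHomogeneous_X ℤ e.1).sub (isHomogeneous_X ℤ e.2)).mul ih
  have hdeg : f.totalDegree = D'.degree := by
    rw [hhom.totalDegree (by rintro h0; simp [h0] at hf)]
    have := hhom hf
    rw [Finsupp.degree_eq_weight_one]
    exact this.symm
  obtain ⟨s, hs, hs'⟩ := combinatorial_nullstellensatz_exists_eval_nonzero f D' hf hdeg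
    (fun i => (S i).map ⟨Nat.cast, Nat.cast_injective⟩) (fun i => by
      simpa [D'] using hS i i.2)
  simp only [Finset.mem_map, Function.Embedding.coeFn_mk] at hs
  choose c hc hcs using hs
  refine ⟨fun i => if hi : i < N then c ⟨i, hi⟩ else 0, fun i hi => by simpa [hi] using hc ⟨i, hi⟩, ?_⟩
  intro e he
  obtain ⟨e', he', rfl⟩ := List.mem_map.1 he
  simp only [Fin.is_lt, dite_true, Fin.eta]
  intro hce
  apply hs'
  simp only [f, map_list_prod, List.map_map]
  apply List.prod_eq_zero
  refine List.mem_map.2 ⟨e', he', ?_⟩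
  simp [← hcs, hce]

/-- The `i`-th hexadecimal digit of `n`. -/
def hexDigit (n i : ℕ) : ℕ := n / 16 ^ i % 16

theorem hexDigit_zero_right (n : ℕ) : hexDigit n 0 = n % 16 := by simp [hexDigit]

theorem hexDigit_succ (n i : ℕ) : hexDigit n (i + 1) = hexDigit (n / 16) i := by
  simp [hexDigit, Nat.div_div_eq_div_mul, pow_succ']

theorem pow_le_of_hexDigit_ne_zero {n a : ℕ} (h : hexDigit n a ≠ 0) : 16 ^ a ≤ n := by
  by_contra hn
  simp [hexDigit, Nat.div_eq_of_lt (not_le.1 hn)] at h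

theorem hexDigit_sub_pow {n a : ℕ} (h : hexDigit n a ≠ 0) (i : ℕ) :
    hexDigit (n - 16 ^ a) i = hexDigit n i - if i = a then 1 else 0 := by
  induction a generalizing n i with
  | zero =>
    rw [hexDigit_zero_right] at h
    cases i with
    | zero => simp only [hexDigit_zero_right]; simp; omega
    | succ i =>
      simp only [hexDigit_succ]
      have : (n - 1) / 16 = n / 16 := by omega
      simp [this]
  | succ a ih =>
    have hle := pow_le_of_hexDigit_ne_zero h
    rw [hexDigit_succ] at h
    rw [pow_succ'] at hle ⊢
    cases i with
    | zero => simp only [hexDigit_zero_right]; simp; omega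
    | succ i =>
      have : (n - 16 * 16 ^ a) / 16 = n / 16 - 16 ^ a := by omega
      simp only [hexDigit_succ, this, ih h]
      simp

/-- The linear combination `∑ c * f n` over the entries `(n, c)` of `v`. -/
def linComb (f : ℕ → ℤ) (v : List (ℕ × ℤ)) : ℤ := (v.map fun x => x.2 * f x.1).sum

@[simp] theorem linComb_nil (f : ℕ → ℤ) : linComb f [] = 0 := rfl

@[simp] theorem linComb_cons (f : ℕ → ℤ) (x : ℕ × ℤ) (v : List (ℕ × ℤ)) :
    linComb f (x :: v) = x.2 * f x.1 + linComb f v := by simp [linComb]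

/-- Merge the term `x` into the second list, continuing with `k`. -/
def mergeTerm (x : ℕ × ℤ) (k : List (ℕ × ℤ) → List (ℕ × ℤ)) : List (ℕ × ℤ) → List (ℕ × ℤ)
  | [] => x :: k []
  | y :: w =>
    bif x.1.blt y.1 then x :: k (y :: w)
    else bif y.1.blt x.1 then y :: mergeTerm x k w
    else bif decide (x.2 + y.2 = 0) then k w else (x.1, x.2 + y.2) :: k w

/-- Sum of two formal linear combinations sorted by code. -/
def mergeTerms : List (ℕ × ℤ) → List (ℕ × ℤ) → List (ℕ × ℤ)
  | [] => id
  | x :: v => mergeTerm x (mergeTerms v)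

theorem linComb_mergeTerm (f : ℕ → ℤ) (x : ℕ × ℤ) (k : List (ℕ × ℤ) → List (ℕ × ℤ)) (r : ℤ)
    (hk : ∀ w, linComb f (k w) = r + linComb f w) (w : List (ℕ × ℤ)) :
    linComb f (mergeTerm x k w) = x.2 * f x.1 + r + linComb f w := by
  induction w with
  | nil => simp [mergeTerm, hk]
  | cons y w ih =>
    rw [mergeTerm]
    cases h1 : x.1.blt y.1 with
    | true => simp [hk]; ring
    | false =>
      cases h2 : y.1.blt x.1 with
      | true => simp [ih]; ring
      | false =>
        have hxy : x.1 = y.1 := by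
          rw [← Bool.not_eq_true, Nat.blt_eq] at h1 h2
          omega
        by_cases h3 : x.2 + y.2 = 0
        · simp only [h3, decide_true, cond_true, cond_false, hk, linComb_cons, hxy]
          linear_combination (-f y.1) * h3
        · simp only [h3, decide_false, cond_false, hk, linComb_cons, hxy]
          ring

theorem linComb_mergeTerms (f : ℕ → ℤ) (v w : List (ℕ × ℤ)) :
    linComb f (mergeTerms v w) = linComb f v + linComb f w := by
  induction v generalizing w with
  | nil => simp [mergeTerms]
  | cons x v ih => rw [mergeTerms, linComb_mergeTerm f x _ _ ih, linComb_cons]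

/-- Lower digit `a` of every code, multiplying coefficients by `s`. -/
def lowerDigit (a : ℕ) (s : ℤ) : List (ℕ × ℤ) → List (ℕ × ℤ)
  | [] => []
  | x :: v =>
    bif (hexDigit x.1 a).beq 0 then lowerDigit a s v
    else (x.1 - 16 ^ a, s * x.2) :: lowerDigit a s v

/-- Keep the terms whose digit `a` is at most `m`. -/
def pruneDigit (a m : ℕ) : List (ℕ × ℤ) → List (ℕ × ℤ)
  | [] => []
  | x :: v => bif (hexDigit x.1 a).ble m then x :: pruneDigit a m v else pruneDigit a m v

theorem linComb_pruneDigit (f : ℕ → ℤ) (a m : ℕ) (hf : ∀ n, m < hexDigit n a → f n = 0)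
    (v : List (ℕ × ℤ)) : linComb f (pruneDigit a m v) = linComb f v := by
  induction v with
  | nil => rfl
  | cons x v ih =>
    rw [pruneDigit]
    cases h : (hexDigit x.1 a).ble m with
    | true => simp [ih]
    | false =>
      have : m < hexDigit x.1 a := by
        rw [← Bool.not_eq_true, Nat.ble_eq] at h
        omega
      simp [ih, hf _ this]

theorem linComb_lowerDigit (f g : ℕ → ℤ) (a : ℕ) (s : ℤ)
    (hf : ∀ n, g n = if hexDigit n a = 0 then 0 else f (n - 16 ^ a)) (v : List (ℕ × ℤ)) :
    linComb f (lowerDigit a s v) = s * linComb g v := by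
  induction v with
  | nil => simp [lowerDigit]
  | cons x v ih =>
    rw [lowerDigit]
    cases h : (hexDigit x.1 a).beq 0 with
    | true =>
      have : hexDigit x.1 a = 0 := by simpa using h
      simp [ih, hf, this]
    | false =>
      have : hexDigit x.1 a ≠ 0 := by
        intro h0
        simp [h0] at h
      simp [ih, hf, this]
      ring

/-- Prune at variable `a`, unless it is kept, when the edges `E` remain to be expanded. -/
def pruneVar (keep : List ℕ) (a : ℕ) (E : List (ℕ × ℕ)) (v : List (ℕ × ℤ)) : List (ℕ × ℤ) :=
  bif keep.contains a then v else pruneDigit a (occCount a E) v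

/-- Expand the factors of the edges `E`, discarding terms which cannot contribute. -/
def expand (keep : List ℕ) : List (ℕ × ℕ) → List (ℕ × ℤ) → List (ℕ × ℤ)
  | [], v => v
  | e :: E, v =>
    expand keep E (pruneVar keep e.2 E (pruneVar keep e.1 E
      (mergeTerms (lowerDigit e.1 1 v) (lowerDigit e.2 (-1) v))))

/-- The exponents coded by `n`, with digit `i < m` at the variable `pos i`. -/
noncomputable def exponents (pos : ℕ → ℕ) (m n : ℕ) : ℕ →₀ ℕ :=
  ∑ i ∈ Finset.range m, Finsupp.single (pos i) (hexDigit n i)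

theorem exponents_apply {pos : ℕ → ℕ} {m : ℕ} (hpos : Set.InjOn pos (Set.Iio m)) (n : ℕ) {a : ℕ}
    (ha : a < m) : exponents pos m n (pos a) = hexDigit n a := by
  rw [exponents, Finsupp.finsetSum_apply, Finset.sum_eq_single a]
  · simp
  · intro b hb hba
    rw [Finsupp.single_apply, if_neg]
    exact fun h => hba (hpos (Finset.mem_range.1 hb) ha h)
  · simp [ha]

theorem exponents_apply_of_ne {pos : ℕ → ℕ} {m : ℕ} (n : ℕ) {b : ℕ} (hb : ∀ i < m, pos i ≠ b) :
    exponents pos m n b = 0 := by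
  rw [exponents, Finsupp.finsetSum_apply, Finset.sum_eq_zero]
  intro i hi
  rw [Finsupp.single_apply, if_neg (hb i (Finset.mem_range.1 hi))]

theorem exponents_sub_pow {pos : ℕ → ℕ} {m : ℕ} (hpos : Set.InjOn pos (Set.Iio m)) {n a : ℕ}
    (ha : a < m) (h : hexDigit n a ≠ 0) :
    exponents pos m (n - 16 ^ a) = exponents pos m n - Finsupp.single (pos a) 1 := by
  ext b
  by_cases hb : ∃ i < m, pos i = b
  · obtain ⟨i, hi, rfl⟩ := hb
    rw [Finsupp.coe_tsub, Pi.sub_apply, exponents_apply hpos _ hi, exponents_apply hpos _ hi,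
      hexDigit_sub_pow h, Finsupp.single_apply]
    congr 2
    exact propext ⟨fun h => h ▸ rfl, fun h => (hpos ha hi h).symm⟩
  · push Not at hb
    rw [Finsupp.coe_tsub, Pi.sub_apply, exponents_apply_of_ne _ hb, exponents_apply_of_ne _ hb]
    simp

theorem occCount_map_append {pos : ℕ → ℕ} {m : ℕ} (hpos : Set.InjOn pos (Set.Iio m)) {a : ℕ}
    (ha : a < m) {E : List (ℕ × ℕ)} (hE : ∀ e ∈ E, e.1 < m ∧ e.2 < m) (E₀ : List (ℕ × ℕ)) :
    occCount (pos a) (E.map (Prod.map pos pos) ++ E₀) = occCount a E + occCount (pos a) E₀ := by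
  induction E with
  | nil => simp [occCount]
  | cons e E ih =>
    have h := hE e (by simp)
    have h1 : pos e.1 = pos a ↔ e.1 = a := hpos.eq_iff h.1 ha
    have h2 : pos e.2 = pos a ↔ e.2 = a := hpos.eq_iff h.2 ha
    simp only [List.map_cons, List.cons_append, occCount, Prod.map, Bool.cond_eq_ite, Nat.beq_eq,
      h1, h2]
    rw [ih fun e he => hE e (by simp [he])]
    ring

theorem linComb_expand {pos : ℕ → ℕ} {m : ℕ} (hpos : Set.InjOn pos (Set.Iio m))
    (keep : List ℕ) (R : ℕ →₀ ℕ) (hR : ∀ i < m, R (pos i) = 0) (E₀ : List (ℕ × ℕ))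
    (hkeep : ∀ i < m, i ∉ keep → occCount (pos i) E₀ = 0)
    (E : List (ℕ × ℕ)) (hE : ∀ e ∈ E, e.1 < m ∧ e.2 < m) (v : List (ℕ × ℤ)) :
    linComb (fun n => atCoef E₀ (exponents pos m n + R)) (expand keep E v) =
      linComb (fun n => atCoef (E.map (Prod.map pos pos) ++ E₀) (exponents pos m n + R)) v := by
  induction E generalizing v with
  | nil => simp [expand]
  | cons e E ih =>
    have h := hE e (by simp)
    have hE' : ∀ e ∈ E, e.1 < m ∧ e.2 < m := fun e he => hE e (by simp [he])
    have hprune : ∀ a < m, ∀ v, linComb (fun n => atCoef (E.map (Prod.map pos pos) ++ E₀)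
        (exponents pos m n + R)) (pruneVar keep a E v) =
        linComb (fun n => atCoef (E.map (Prod.map pos pos) ++ E₀) (exponents pos m n + R)) v := by
      intro a ha v
      rw [pruneVar]
      cases hk : keep.contains a with
      | true => rfl
      | false =>
        rw [cond_false, linComb_pruneDigit]
        intro n hn
        refine atCoef_eq_zero (a := pos a) _ _ ?_
        rw [occCount_map_append hpos ha hE', hkeep a ha (by simpa using hk), Finsupp.add_apply,
          exponents_apply hpos n ha]
        omega
    have hlow : ∀ a < m, ∀ n, (if (exponents pos m n + R) (pos a) = 0 then 0 else
        atCoef (E.map (Prod.map pos pos) ++ E₀)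
          (exponents pos m n + R - Finsupp.single (pos a) 1)) = if hexDigit n a = 0 then 0 else
        atCoef (E.map (Prod.map pos pos) ++ E₀) (exponents pos m (n - 16 ^ a) + R) := by
      intro a ha n
      rw [Finsupp.add_apply, exponents_apply hpos n ha, hR a ha, add_zero]
      split_ifs with h0
      · rfl
      · rw [exponents_sub_pow hpos ha h0]
        congr 1
        ext b
        simp only [Finsupp.coe_tsub, Finsupp.coe_add, Pi.sub_apply, Pi.add_apply,
          Finsupp.single_apply]
        split_ifs with hb
        · have := exponents_apply hpos n ha
          rw [hb] at this
          omega
        · simp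
    rw [expand, ih hE', hprune _ h.2, hprune _ h.1, linComb_mergeTerms,
      linComb_lowerDigit _ _ _ _ (fun n => rfl), linComb_lowerDigit _ _ _ _ (fun n => rfl)]
    simp only [← hlow _ h.1, ← hlow _ h.2]
    clear ih hprune hlow
    induction v with
    | nil => simp
    | cons x v ih =>
      simp only [linComb_cons, List.map_cons, List.cons_append] at ih ⊢
      rw [← ih, Prod.map_def, atCoef_cons]
      ring

/-- The code with the given digits. -/
def encode : List ℕ → ℕ
  | [] => 0
  | d :: D => d + 16 * encode D

theorem hexDigit_encode (D : List ℕ) (hD : ∀ d ∈ D, d < 16) (i : ℕ) :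
    hexDigit (encode D) i = D.getD i 0 := by
  induction D generalizing i with
  | nil => simp [encode, hexDigit]
  | cons d D ih =>
    have hd : d < 16 := hD d (by simp)
    cases i with
    | zero => rw [hexDigit_zero_right, encode]; simp; omega
    | succ i =>
      rw [hexDigit_succ, encode]
      have : (d + 16 * encode D) / 16 = encode D := by omega
      rw [this, ih fun d hd => hD d (by simp [hd])]
      simp

theorem exists_listColoring_of_expand {N : ℕ} {E : List (ℕ × ℕ)} {D : List ℕ} {c : ℤ}
    (hE : E.all (fun e => e.1.blt N && e.2.blt N) = true)
    (hD : D.all (fun d => d.blt 16) = true) (hc : c ≠ 0)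
    (h : expand [] E [(encode D, 1)] = [(0, c)])
    (S : ℕ → Finset ℕ) (hS : ∀ i < N, D.getD i 0 < (S i).card) :
    ∃ c : ℕ → ℕ, (∀ i < N, c i ∈ S i) ∧ ∀ e ∈ E, c e.1 ≠ c e.2 := by
  have hE' : ∀ e ∈ E, e.1 < N ∧ e.2 < N := by simpa [Nat.blt_eq] using hE
  have hD' : ∀ d ∈ D, d < 16 := by simpa [Nat.blt_eq] using hD
  have hinj : Set.InjOn (fun i : ℕ => i) (Set.Iio N) := Function.injective_id.injOn
  have key := linComb_expand hinj [] 0 (by simp) [] (by simp [occCount]) E hE' [(encode D, 1)]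
  rw [h] at key
  have h0 : exponents (fun i : ℕ => i) N 0 = 0 := by simp [exponents, hexDigit]
  have hmap : E.map (Prod.map (fun i : ℕ => i) (fun i : ℕ => i)) = E := by
    conv_rhs => rw [← List.map_id E]
    rfl
  simp only [linComb_cons, linComb_nil, h0, add_zero, atCoef_nil_zero, hmap, List.append_nil,
    mul_one, one_mul] at key
  refine exists_listColoring_of_atCoef_ne_zero hE' (D := exponents (fun i => i) N (encode D))
    ?_ (by rwa [← key]) S ?_
  · intro i hi
    exact exponents_apply_of_ne _ fun j hj => by omega
  · intro i hi
    have := exponents_apply hinj (encode D) hi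
    rw [this, hexDigit_encode D hD']
    exact hS i hi

/-- The factors involving block `j` and earlier blocks in the graph polynomial of a long cycle with
pendant edges; block `j` consists of the variables `2 * j` (a cycle edge) and `2 * j + 1` (the
pendant edge at its end). -/
def cycleBlock (k j : ℕ) : List (ℕ × ℕ) :=
  let a := (j + k - 1) % k
  let b := (j + k - 2) % k
  [(2 * j, 2 * a), (2 * j, 2 * a + 1), (2 * j + 1, 2 * a), (2 * j + 1, 2 * a + 1),
    (2 * j, 2 * j + 1), (2 * j, 2 * b), (2 * j, 2 * b + 1)]

/-- The factors of the blocks `j, …, k - 1`. -/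
def cycleTail (k j : ℕ) : List (ℕ × ℕ) := (List.range' j (k - j)).flatMap (cycleBlock k)

theorem cycleTail_eq {k j : ℕ} (h : j < k) :
    cycleTail k j = cycleBlock k j ++ cycleTail k (j + 1) := by
  rw [cycleTail, cycleTail, show k - j = (k - (j + 1)) + 1 by omega, List.range'_succ,
    List.flatMap_cons]

/-- Exponent of the cycle edge in block `j`. -/
def cycleExp (j : ℕ) : ℕ := [5, 4, 5, 5].getD j 4

/-- Exponent of the pendant edge in block `j`. -/
def pendantExp (j : ℕ) : ℕ := [3, 3, 3, 0].getD j 3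

/-- Attach the exponents of a new block to eight-digit codes. -/
def attachBlock (a b : ℕ) : List (ℕ × ℤ) → List (ℕ × ℤ)
  | [] => []
  | x :: v => (x.1 % 16 ^ 8 + a * 16 ^ 8 + b * 16 ^ 9, x.2) :: attachBlock a b v

/-- Discard the finished block stored at digits 4 and 5. -/
def dropBlock : List (ℕ × ℤ) → List (ℕ × ℤ)
  | [] => []
  | x :: v =>
    bif (hexDigit x.1 4).beq 0 && (hexDigit x.1 5).beq 0 then
      (x.1 % 16 ^ 4 + x.1 / 16 ^ 6 * 16 ^ 4, x.2) :: dropBlock v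
    else dropBlock v

/-- One transfer step: the blocks `j - 2`, `j - 1` and `j` are at digits 4 to 9. -/
def cycleStage (a b : ℕ) (v : List (ℕ × ℤ)) : List (ℕ × ℤ) :=
  dropBlock (expand [0, 1, 2, 3, 6, 7, 8, 9]
    [(8, 6), (8, 7), (9, 6), (9, 7), (8, 9), (8, 4), (8, 5)] (attachBlock a b v))

/-- The state once the blocks `0`, …, `j + 1` have been expanded. -/
def cycleState : ℕ → List (ℕ × ℤ)
  | 0 => expand [0, 1, 2, 3, 4, 5, 6, 7]
      [(4, 2), (4, 3), (5, 2), (5, 3), (4, 5), (4, 0), (4, 1),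
        (6, 4), (6, 5), (7, 4), (7, 5), (6, 7), (6, 2), (6, 3)]
      [(encode [4, 3, 4, 3, 5, 3, 4, 3], 1)]
  | j + 1 => cycleStage (cycleExp (j + 2)) (pendantExp (j + 2)) (cycleState j)

/-- Expand the last two blocks. -/
def cycleFinish (v : List (ℕ × ℤ)) : List (ℕ × ℤ) :=
  expand [] [(0, 6), (0, 7), (1, 6), (1, 7), (0, 1), (0, 4), (0, 5),
    (2, 0), (2, 1), (3, 0), (3, 1), (2, 3), (2, 6), (2, 7)] v

/-- The states from `v` on finish with coefficient 1, and are stable after `n` steps. -/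
def cycleCheck : ℕ → List (ℕ × ℤ) → Bool
  | 0, v => decide (cycleFinish v = [(0, 1)]) && decide (cycleStage 4 3 v = v)
  | n + 1, v => decide (cycleFinish v = [(0, 1)]) && cycleCheck n (cycleStage 4 3 v)

set_option maxRecDepth 100000 in
theorem cycleCheck_three : cycleCheck 3 (cycleState 3) = true := by decide +kernel

theorem cycleFinish_eq {j : ℕ} (hj : 3 ≤ j) : cycleFinish (cycleState j) = [(0, 1)] := by
  have hs : ∀ i, cycleState (i + 3) = cycleStage 4 3 (cycleState (i + 2)) := fun i => rfl
  have h := cycleCheck_three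
  simp only [cycleCheck, Bool.and_eq_true, decide_eq_true_eq, ← hs 1, ← hs 2, ← hs 3] at h
  have h6 : ∀ i, cycleState (i + 6) = cycleState 6 := by
    intro i
    induction i with
    | zero => rfl
    | succ i ih => rw [show i + 1 + 6 = (i + 4) + 3 by ring, hs, ih, h.2.2.2.2]
  obtain rfl | rfl | rfl | hj : j = 3 ∨ j = 4 ∨ j = 5 ∨ 6 ≤ j := by omega
  · exact h.1
  · exact h.2.1
  · exact h.2.2.1
  · obtain ⟨i, rfl⟩ := Nat.exists_eq_add_of_le' hj
    rw [h6]
    exact h.2.2.2.1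

/-- The variable stored at digit `i` in stage `j`. -/
def cyclePos (k j i : ℕ) : ℕ := if i < 4 then 2 * (k - 2) + i else 2 * j + i - 8

theorem injOn_cyclePos_ten {k j : ℕ} (hj : 2 ≤ j) (hk : j + 3 ≤ k) :
    Set.InjOn (cyclePos k j) (Set.Iio 10) := by
  intro a ha b hb h
  simp only [cyclePos, Set.mem_Iio] at *
  split_ifs at h <;> omega

theorem injOn_cyclePos_eight {k j : ℕ} (hj : 2 ≤ j) (hk : j + 2 ≤ k) :
    Set.InjOn (cyclePos k j) (Set.Iio 8) := by
  intro a ha b hb h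
  simp only [cyclePos, Set.mem_Iio] at *
  split_ifs at h <;> omega

/-- The exponents of the blocks `j, …, k - 3`. -/
noncomputable def cycleRest (k j : ℕ) : ℕ →₀ ℕ :=
  ∑ i ∈ Finset.Ico j (k - 2),
    (Finsupp.single (2 * i) (cycleExp i) + Finsupp.single (2 * i + 1) (pendantExp i))

theorem cycleRest_apply_of_ne {k j b : ℕ} (h : b < 2 * j ∨ 2 * (k - 2) ≤ b) :
    cycleRest k j b = 0 := by
  rw [cycleRest, Finsupp.finsetSum_apply, Finset.sum_eq_zero]
  intro i hi
  rw [Finset.mem_Ico] at hi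
  rw [Finsupp.add_apply, Finsupp.single_apply, Finsupp.single_apply, if_neg (by omega),
    if_neg (by omega), add_zero]

theorem cycleRest_eq {k j : ℕ} (h : j + 3 ≤ k) : cycleRest k j =
    Finsupp.single (2 * j) (cycleExp j) + Finsupp.single (2 * j + 1) (pendantExp j) +
      cycleRest k (j + 1) := by
  rw [cycleRest, cycleRest, Finset.sum_eq_sum_Ico_succ_bot (by omega)]

theorem occCount_eq_zero {a : ℕ} {E : List (ℕ × ℕ)} (h : ∀ e ∈ E, e.1 ≠ a ∧ e.2 ≠ a) :
    occCount a E = 0 := by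
  induction E with
  | nil => rfl
  | cons e E ih =>
    have he := h e (by simp)
    have h1 : e.1.beq a = false := by rw [← Bool.not_eq_true, Nat.beq_eq]; exact he.1
    have h2 : e.2.beq a = false := by rw [← Bool.not_eq_true, Nat.beq_eq]; exact he.2
    simp [occCount, h1, h2, ih fun e he => h e (by simp [he])]

theorem cycleBlock_eq {k j : ℕ} (hj : 2 ≤ j) (hk : j < k) : cycleBlock k j =
    [(2 * j, 2 * (j - 1)), (2 * j, 2 * (j - 1) + 1), (2 * j + 1, 2 * (j - 1)),
      (2 * j + 1, 2 * (j - 1) + 1), (2 * j, 2 * j + 1), (2 * j, 2 * (j - 2)),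
      (2 * j, 2 * (j - 2) + 1)] := by
  have h1 : (j + k - 1) % k = j - 1 := by
    rw [show j + k - 1 = j - 1 + k by omega, Nat.add_mod_right, Nat.mod_eq_of_lt (by omega)]
  have h2 : (j + k - 2) % k = j - 2 := by
    rw [show j + k - 2 = j - 2 + k by omega, Nat.add_mod_right, Nat.mod_eq_of_lt (by omega)]
  simp only [cycleBlock, h1, h2]

theorem occCount_cycleTail {k j a : ℕ} (hj : 2 ≤ j) (ha : a < 2 * (j - 2)) :
    occCount a (cycleTail k j) = 0 := by
  refine occCount_eq_zero fun e he => ?_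
  rw [cycleTail, List.mem_flatMap] at he
  obtain ⟨i, hi, he⟩ := he
  rw [List.mem_range'_1] at hi
  rw [cycleBlock_eq (by omega) (by omega)] at he
  simp only [List.mem_cons, List.not_mem_nil, or_false] at he
  rcases he with rfl | rfl | rfl | rfl | rfl | rfl | rfl <;> simp only <;> omega

theorem linComb_attachBlock (f g : ℕ → ℤ) (a b : ℕ)
    (h : ∀ n, f (n % 16 ^ 8 + a * 16 ^ 8 + b * 16 ^ 9) = g n) (v : List (ℕ × ℤ)) :
    linComb f (attachBlock a b v) = linComb g v := by
  induction v with
  | nil => rfl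
  | cons x v ih => rw [attachBlock, linComb_cons, linComb_cons, ih, h]

theorem linComb_dropBlock (f g : ℕ → ℤ)
    (h : ∀ n, hexDigit n 4 = 0 → hexDigit n 5 = 0 → f (n % 16 ^ 4 + n / 16 ^ 6 * 16 ^ 4) = g n)
    (h' : ∀ n, hexDigit n 4 ≠ 0 ∨ hexDigit n 5 ≠ 0 → g n = 0) (v : List (ℕ × ℤ)) :
    linComb f (dropBlock v) = linComb g v := by
  induction v with
  | nil => rfl
  | cons x v ih =>
    rw [dropBlock]
    by_cases h4 : hexDigit x.1 4 = 0
    · by_cases h5 : hexDigit x.1 5 = 0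
      · simp [h4, h5, ih, ← h x.1 h4 h5]
      · have hb : (hexDigit x.1 5).beq 0 = false := by rw [← Bool.not_eq_true, Nat.beq_eq]; exact h5
        simp [hb, ih, h' x.1 (Or.inr h5)]
    · have hb : (hexDigit x.1 4).beq 0 = false := by rw [← Bool.not_eq_true, Nat.beq_eq]; exact h4
      simp [hb, ih, h' x.1 (Or.inl h4)]

theorem exponents_attachBlock {k j a b : ℕ} (ha : a < 16) (hb : b < 16) (n : ℕ) :
    exponents (cyclePos k j) 10 (n % 16 ^ 8 + a * 16 ^ 8 + b * 16 ^ 9) =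
      exponents (cyclePos k j) 8 n +
        (Finsupp.single (2 * j) a + Finsupp.single (2 * j + 1) b) := by
  have h8 : hexDigit (n % 16 ^ 8 + a * 16 ^ 8 + b * 16 ^ 9) 8 = a := by
    simp only [hexDigit]; omega
  have h9 : hexDigit (n % 16 ^ 8 + a * 16 ^ 8 + b * 16 ^ 9) 9 = b := by
    simp only [hexDigit]; omega
  rw [exponents, Finset.sum_range_succ, Finset.sum_range_succ, h8, h9, add_assoc]
  congr 1
  rw [exponents]
  refine Finset.sum_congr rfl fun i hi => ?_
  rw [Finset.mem_range] at hi
  congr 1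
  simp only [hexDigit]
  interval_cases i <;> omega

theorem exponents_dropBlock {k j n : ℕ} (h4 : hexDigit n 4 = 0)
    (h5 : hexDigit n 5 = 0) :
    exponents (cyclePos k (j + 1)) 8 (n % 16 ^ 4 + n / 16 ^ 6 * 16 ^ 4) =
      exponents (cyclePos k j) 10 n := by
  have hlo : ∀ i < 4, hexDigit (n % 16 ^ 4 + n / 16 ^ 6 * 16 ^ 4) i = hexDigit n i := by
    intro i hi
    simp only [hexDigit]
    interval_cases i <;> omega
  have hhi : ∀ i < 4, hexDigit (n % 16 ^ 4 + n / 16 ^ 6 * 16 ^ 4) (i + 4) = hexDigit n (i + 6) := by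
    intro i _
    rw [hexDigit, hexDigit, pow_add, pow_add, mul_comm (16 ^ i), mul_comm (16 ^ i),
      ← Nat.div_div_eq_div_mul, ← Nat.div_div_eq_div_mul]
    congr 2
    omega
  have hpos : ∀ i < 4, cyclePos k (j + 1) (i + 4) = cyclePos k j (i + 6) := by
    intro i hi
    simp only [cyclePos]
    split_ifs <;> omega
  have hpos' : ∀ i < 4, cyclePos k (j + 1) i = cyclePos k j i := by
    intro i hi
    simp only [cyclePos, if_pos hi]
  have e0 := hhi 0 (by simp)
  have e1 := hhi 1 (by simp)
  have e2 := hhi 2 (by simp)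
  have e3 := hhi 3 (by simp)
  have p0 := hpos 0 (by simp)
  have p1 := hpos 1 (by simp)
  have p2 := hpos 2 (by simp)
  have p3 := hpos 3 (by simp)
  norm_num only at e0 e1 e2 e3 p0 p1 p2 p3
  simp only [exponents, Finset.sum_range_succ, Finset.sum_range_zero]
  norm_num only
  have q0 := hlo 0 (by simp)
  have q1 := hlo 1 (by simp)
  have q2 := hlo 2 (by simp)
  have q3 := hlo 3 (by simp)
  norm_num only at q0 q1 q2 q3
  rw [q0, q1, q2, q3, e0, e1, e2, e3, p0, p1, p2, p3, h4, h5, hpos' 0 (by simp),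
    hpos' 1 (by simp), hpos' 2 (by simp), hpos' 3 (by simp)]
  simp

/-- The coefficient represented by the code `n` before stage `j`. -/
noncomputable def cycleVal (k j n : ℕ) : ℤ :=
  atCoef (cycleTail k j) (exponents (cyclePos k j) 8 n + cycleRest k j)

theorem linComb_cycleStage {k j : ℕ} (hj : 2 ≤ j) (hk : j + 3 ≤ k) (v : List (ℕ × ℤ)) :
    linComb (cycleVal k (j + 1)) (cycleStage (cycleExp j) (pendantExp j) v) =
      linComb (cycleVal k j) v := by
  have hinj := injOn_cyclePos_ten hj hk
  have hR : ∀ i < 10, cycleRest k (j + 1) (cyclePos k j i) = 0 := by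
    intro i hi
    apply cycleRest_apply_of_ne
    simp only [cyclePos]
    split_ifs <;> omega
  have h4 : occCount (cyclePos k j 4) (cycleTail k (j + 1)) = 0 :=
    occCount_cycleTail (by omega) (by simp only [cyclePos]; norm_num; omega)
  have h5 : occCount (cyclePos k j 5) (cycleTail k (j + 1)) = 0 :=
    occCount_cycleTail (by omega) (by simp only [cyclePos]; norm_num; omega)
  have hcE : ∀ i, cycleExp i < 16 := by
    intro i
    match i with
    | 0 | 1 | 2 | 3 => simp [cycleExp]
    | i + 4 => simp [cycleExp]
  have hpE : ∀ i, pendantExp i < 16 := by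
    intro i
    match i with
    | 0 | 1 | 2 | 3 => simp [pendantExp]
    | i + 4 => simp [pendantExp]
  rw [cycleStage, linComb_dropBlock _
    (fun n => atCoef (cycleTail k (j + 1)) (exponents (cyclePos k j) 10 n + cycleRest k (j + 1))),
    linComb_expand hinj _ _ hR, linComb_attachBlock]
  · intro n
    rw [exponents_attachBlock (hcE j) (hpE j), cycleVal, cycleRest_eq hk, add_assoc,
      cycleTail_eq (j := j) (by omega), cycleBlock_eq hj (by omega)]
    congr 2
    obtain ⟨j, rfl⟩ := Nat.exists_eq_add_of_le' hj
    simp only [List.map_cons, List.map_nil, Prod.map, cyclePos]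
    norm_num
    omega
  · intro i hi hik
    interval_cases i <;> simp at hik
    · exact h4
    · exact h5
  · decide
  · intro n h4 h5
    rw [cycleVal, exponents_dropBlock h4 h5]
  · rintro n (h | h)
    · refine atCoef_eq_zero (a := cyclePos k j 4) _ _ ?_
      rw [h4, Finsupp.add_apply, exponents_apply hinj _ (by simp)]
      omega
    · refine atCoef_eq_zero (a := cyclePos k j 5) _ _ ?_
      rw [h5, Finsupp.add_apply, exponents_apply hinj _ (by simp)]
      omega

theorem linComb_cycleState {k : ℕ} (j : ℕ) (hk : j + 4 ≤ k) :
    linComb (cycleVal k (j + 2)) (cycleState j) =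
      linComb (cycleVal k 2) (cycleState 0) := by
  induction j with
  | zero => rfl
  | succ j ih => 
    rw [← ih (by omega), ← linComb_cycleStage (j := j + 2) (by omega) (by omega)]
    rfl

theorem linComb_cycleFinish {k : ℕ} (hk : 4 ≤ k) (v : List (ℕ × ℤ)) :
    linComb (fun n => atCoef [] (exponents (cyclePos k (k - 2)) 8 n)) (cycleFinish v) =
      linComb (cycleVal k (k - 2)) v := by
  have h0 : cycleRest k (k - 2) = 0 := by simp [cycleRest]
  have h := linComb_expand (injOn_cyclePos_eight (k := k) (j := k - 2) (by omega) (by omega)) []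
    0 (by simp) [] (by simp [occCount])
    [(0, 6), (0, 7), (1, 6), (1, 7), (0, 1), (0, 4), (0, 5),
    (2, 0), (2, 1), (3, 0), (3, 1), (2, 3), (2, 6), (2, 7)] (by decide) v
  simp only [add_zero] at h
  rw [cycleFinish, h]
  have hn : ∀ f g : ℕ → ℤ, (∀ n, f n = g n) → linComb f v = linComb g v :=
    fun f g hfg => by rw [funext hfg]
  refine hn _ _ fun n => ?_
  rw [cycleVal, h0, add_zero, cycleTail_eq (by omega), cycleTail_eq (by omega),
    cycleBlock_eq (by omega) (by omega), cycleBlock_eq (by omega) (by omega), cycleTail,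
    show k - (k - 2 + 1 + 1) = 0 by omega]
  obtain ⟨k, rfl⟩ := Nat.exists_eq_add_of_le' hk
  congr 1

theorem linComb_cycleState_zero {k : ℕ} (hk : 6 ≤ k) :
    linComb (cycleVal k 2) (cycleState 0) =
      atCoef (cycleTail k 0) (exponents (cyclePos k 2) 8 (encode [4, 3, 4, 3, 5, 3, 4, 3]) +
        cycleRest k 2) := by
  refine (linComb_expand (injOn_cyclePos_eight (k := k) (j := 2) (by omega) (by omega)) _
    (cycleRest k 2) ?_ (cycleTail k 2) ?_ _ ?_ _).trans ?_
  rotate_right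
  · rw [linComb_cons, linComb_nil, one_mul, add_zero, cycleTail_eq (k := k) (j := 0) (by omega),
      cycleTail_eq (k := k) (j := 0 + 1) (by omega), ← List.append_assoc]
    congr 2
    have h1 : (0 + k - 1) % k = k - 1 := by rw [zero_add, Nat.mod_eq_of_lt (by omega)]
    have h2 : (0 + k - 2) % k = k - 2 := by rw [zero_add, Nat.mod_eq_of_lt (by omega)]
    have h3 : (0 + 1 + k - 1) % k = 0 := by
      rw [show 0 + 1 + k - 1 = k by omega, Nat.mod_self]
    have h4 : (0 + 1 + k - 2) % k = k - 1 := by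
      rw [show 0 + 1 + k - 2 = k - 1 by omega, Nat.mod_eq_of_lt (by omega)]
    simp only [cycleBlock, h1, h2, h3, h4]
    obtain ⟨k, rfl⟩ := Nat.exists_eq_add_of_le' hk
    simp only [List.map_cons, List.map_nil, Prod.map, cyclePos, List.cons_append, List.nil_append]
    norm_num
    omega
  · intro i hi
    apply cycleRest_apply_of_ne
    simp only [cyclePos]
    split_ifs <;> omega
  · intro i hi h
    interval_cases i <;> simp at h
  · decide

theorem atCoef_cycleTail {k : ℕ} (hk : 7 ≤ k) :
    atCoef (cycleTail k 0) (exponents (cyclePos k 2) 8 (encode [4, 3, 4, 3, 5, 3, 4, 3]) +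
        cycleRest k 2) = 1 := by
  rw [← linComb_cycleState_zero (by omega), ← linComb_cycleState (k - 4) (by omega),
    show k - 4 + 2 = k - 2 by omega, ← linComb_cycleFinish (by omega), cycleFinish_eq (by omega)]
  simp [exponents, hexDigit, atCoef_nil_zero]

theorem exists_cycleColoring {k : ℕ} (hk : 7 ≤ k) (S : ℕ → Finset ℕ)
    (hc : ∀ j < k, 6 ≤ (S (2 * j)).card) (hp : ∀ j < k, 4 ≤ (S (2 * j + 1)).card) :
    ∃ c : ℕ → ℕ, (∀ i < 2 * k, c i ∈ S i) ∧ ∀ j < k, ∀ e ∈ cycleBlock k j, c e.1 ≠ c e.2 := by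
  have hinj := injOn_cyclePos_eight (k := k) (j := 2) le_rfl (by omega)
  set n := encode [4, 3, 4, 3, 5, 3, 4, 3] with hn
  have key := exists_listColoring_of_atCoef_ne_zero (N := 2 * k) (E := cycleTail k 0)
    (D := exponents (cyclePos k 2) 8 n + cycleRest k 2) ?_ ?_
    (by rw [atCoef_cycleTail hk]; exact one_ne_zero) S ?_
  · obtain ⟨c, hcS, hcE⟩ := key
    refine ⟨c, hcS, fun j hj e he => hcE e ?_⟩
    rw [cycleTail, List.mem_flatMap]
    exact ⟨j, by rw [List.mem_range'_1]; omega, he⟩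
  · intro e he
    rw [cycleTail, List.mem_flatMap] at he
    obtain ⟨i, hi, he⟩ := he
    rw [List.mem_range'_1] at hi
    have h1 := Nat.mod_lt (i + k - 1) (show k > 0 by omega)
    have h2 := Nat.mod_lt (i + k - 2) (show k > 0 by omega)
    simp only [cycleBlock, List.mem_cons, List.not_mem_nil, or_false] at he
    rcases he with rfl | rfl | rfl | rfl | rfl | rfl | rfl <;> simp only <;> omega
  · intro i hi
    rw [Finsupp.add_apply, exponents_apply_of_ne, cycleRest_apply_of_ne (by omega)]
    intro a ha
    simp only [cyclePos]
    split_ifs <;> omega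
  · intro i hi
    have hbound : (exponents (cyclePos k 2) 8 n + cycleRest k 2) i ≤ if i % 2 = 0 then 5 else 3 := by
      rw [Finsupp.add_apply]
      by_cases hi' : ∃ a < 8, cyclePos k 2 a = i
      · obtain ⟨a, ha, rfl⟩ := hi'
        rw [exponents_apply hinj _ ha, cycleRest_apply_of_ne
          (by simp only [cyclePos]; split_ifs <;> omega), hn, hexDigit_encode _ (by simp)]
        simp only [cyclePos]
        interval_cases a <;> simp
      · push Not at hi'
        rw [exponents_apply_of_ne _ hi', zero_add, cycleRest, Finsupp.finsetSum_apply]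
        by_cases hm : i / 2 ∈ Finset.Ico 2 (k - 2)
        · rw [Finset.sum_eq_single_of_mem _ hm]
          · have hcE : cycleExp (i / 2) ≤ 5 := by
              generalize i / 2 = i
              match i with
              | 0 | 1 | 2 | 3 => simp [cycleExp]
              | i + 4 => simp [cycleExp]
            have hpE : pendantExp (i / 2) ≤ 3 := by
              generalize i / 2 = i
              match i with
              | 0 | 1 | 2 | 3 => simp [pendantExp]
              | i + 4 => simp [pendantExp]
            simp only [Finsupp.add_apply, Finsupp.single_apply]
            split_ifs <;> omega
          · intro b _ hb
            rw [Finsupp.add_apply, Finsupp.single_apply, Finsupp.single_apply, if_neg (by omega),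
              if_neg (by omega), add_zero]
        · rw [Finset.sum_eq_zero]
          · simp
          · intro b hb
            have hbi : b ≠ i / 2 := by
              rintro rfl
              exact hm hb
            rw [Finsupp.add_apply, Finsupp.single_apply, Finsupp.single_apply, if_neg (by omega),
              if_neg (by omega), add_zero]
    refine hbound.trans_lt ?_
    split_ifs with h
    · have := hc (i / 2) (by omega)
      rw [show 2 * (i / 2) = i by omega] at this
      omega
    · have := hp (i / 2) (by omega)
      rw [show 2 * (i / 2) + 1 = i by omega] at this
      omega

theorem edgeConflict.symm {V : Type*} {G : SimpleGraph V} {e f : Sym2 V}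
    (h : edgeConflict G e f) : edgeConflict G f e := by
  obtain ⟨hne, h⟩ := h
  refine ⟨hne.symm, h.imp ?_ ?_⟩
  · rintro ⟨v, h1, h2⟩
    exact ⟨v, h2, h1⟩
  · rintro ⟨g, hg, ⟨v, h1, h2⟩, w, h3, h4⟩
    exact ⟨g, hg, ⟨w, h4, h3⟩, v, h2, h1⟩

/-- An edge conflicting with `ab` contains a neighbour of `a` other than `b`, or conversely. -/
theorem edgeConflict.exists_adj {V : Type*} {G : SimpleGraph V} {a b : V} {f : Sym2 V}
    (h : edgeConflict G s(a, b) f) (hf : f ∈ G.edgeSet) :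
    (∃ y, G.Adj a y ∧ y ≠ b ∧ y ∈ f) ∨ ∃ y, G.Adj b y ∧ y ≠ a ∧ y ∈ f := by
  obtain ⟨hne, h⟩ := h
  have shared : ∀ {a b : V}, s(a, b) ≠ f → a ∈ f → ∃ y, G.Adj a y ∧ y ≠ b ∧ y ∈ f := by
    intro a b hne ha
    obtain ⟨y, rfl⟩ := Sym2.mem_iff_exists.1 ha
    exact ⟨y, hf, fun h => hne (by rw [h]), by simp⟩
  by_cases ha : a ∈ f
  · exact Or.inl (shared hne ha)
  by_cases hb : b ∈ f
  · exact Or.inr (shared (by rwa [Sym2.eq_swap]) hb)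
  obtain ⟨v, hv, hvf⟩ | ⟨g, hg, ⟨v, hv, hvg⟩, w, hwg, hwf⟩ := h
  · rw [Sym2.mem_iff] at hv
    rcases hv with rfl | rfl
    · exact absurd hvf ha
    · exact absurd hvf hb
  · have hvw : v ≠ w := by
      rintro rfl
      rw [Sym2.mem_iff] at hv
      rcases hv with rfl | rfl
      · exact ha hwf
      · exact hb hwf
    have hg' : g = s(v, w) := ((Sym2.mem_and_mem_iff hvw).1 ⟨hvg, hwg⟩)
    rw [hg', SimpleGraph.mem_edgeSet] at hg
    rw [Sym2.mem_iff] at hv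
    rcases hv with rfl | rfl
    · exact Or.inl ⟨w, hg, fun h => hb (h ▸ hwf), hwf⟩
    · exact Or.inr ⟨w, hg, fun h => ha (h ▸ hwf), hwf⟩

theorem exists_greedyColoring {α : Type*} [DecidableEq α] (s : Finset α) (conf : α → α → Prop)
    [DecidableRel conf] (hsymm : ∀ e f, conf e f → conf f e) (hirr : ∀ e, ¬ conf e e)
    (rank : α → ℕ) (L : α → Finset ℕ)
    (h : ∀ e ∈ s, (s.filter fun f => conf e f ∧ rank e ≤ rank f).card < (L e).card) :
    ∃ φ : α → ℕ, (∀ e ∈ s, φ e ∈ L e) ∧ ∀ e ∈ s, ∀ f ∈ s, conf e f → φ e ≠ φ f := by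
  induction hn : s.card generalizing s with
  | zero =>
    rw [Finset.card_eq_zero] at hn
    subst hn
    exact ⟨fun _ => 0, by simp, by simp⟩
  | succ n ih =>
    obtain ⟨e, he, hmin⟩ := s.exists_min_image rank (Finset.card_pos.1 (by omega))
    obtain ⟨φ, h1, h2⟩ := ih (s.erase e) (fun f hf =>
      (Finset.card_le_card (Finset.filter_subset_filter _ (Finset.erase_subset _ _))).trans_lt
        (h f (Finset.mem_of_mem_erase hf))) (by rw [Finset.card_erase_of_mem he]; omega)
    obtain ⟨c, hc, hc'⟩ : ∃ c ∈ L e, c ∉ (s.filter fun f => conf e f ∧ rank e ≤ rank f).image φ :=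
      Finset.exists_mem_notMem_of_card_lt_card (Finset.card_image_le.trans_lt (h e he))
    have hce : ∀ f ∈ s, conf e f → φ f ≠ c := fun f hf hef hfc => hc'
      (Finset.mem_image.2 ⟨f, Finset.mem_filter.2 ⟨hf, hef, hmin f hf⟩, hfc⟩)
    refine ⟨Function.update φ e c, fun f hf => ?_, fun f hf g hg hfg => ?_⟩
    · by_cases hfe : f = e
      · subst hfe
        simpa using hc
      · rw [Function.update_of_ne hfe]
        exact h1 f (Finset.mem_erase.2 ⟨hfe, hf⟩)
    · by_cases hfe : f = e
      · subst hfe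
        have hgf : g ≠ f := fun h => hirr f (h ▸ hfg)
        rw [Function.update_self, Function.update_of_ne hgf]
        exact (hce g hg hfg).symm
      · rw [Function.update_of_ne hfe]
        by_cases hge : g = e
        · subst hge
          rw [Function.update_self]
          exact hce f hf (hsymm _ _ hfg)
        · rw [Function.update_of_ne hge]
          exact h2 f (Finset.mem_erase.2 ⟨hfe, hf⟩) g (Finset.mem_erase.2 ⟨hge, hg⟩) hfg

section Root

variable {V : Type*}

/-- The component of `r` in `G` has a strong edge colouring from the lists `L`. -/
def ComponentColorable (G : SimpleGraph V) (L : Sym2 V → Finset ℕ) (r : V) : Prop :=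
  ∃ φ : Sym2 V → ℕ, (∀ e ∈ G.edgeSet, (∀ v ∈ e, G.Reachable r v) → φ e ∈ L e) ∧
    ∀ e ∈ G.edgeSet, ∀ f ∈ G.edgeSet, (∀ v ∈ e, G.Reachable r v) → (∀ v ∈ f, G.Reachable r v) →
      edgeConflict G e f → φ e ≠ φ f

theorem reachable_of_mem_edge {G : SimpleGraph V} {e : Sym2 V} (he : e ∈ G.edgeSet) {v w : V}
    (hv : v ∈ e) (hw : w ∈ e) : G.Reachable v w := by
  by_cases hvw : v = w
  · rw [hvw]
  · rw [(Sym2.mem_and_mem_iff hvw).1 ⟨hv, hw⟩, SimpleGraph.mem_edgeSet] at he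
    exact he.reachable

theorem stronglyEdgeChoosable_of_component {G : SimpleGraph V} {k : ℕ}
    (h : ∀ L : Sym2 V → Finset ℕ, (∀ e ∈ G.edgeSet, k ≤ (L e).card) →
      ∀ c : G.ConnectedComponent, ∃ r, G.connectedComponentMk r = c ∧ ComponentColorable G L r) :
    StronglyEdgeChoosable G k := by
  intro L hL
  choose r hr φ hφ hφ' using h L hL
  let comp : Sym2 V → G.ConnectedComponent := fun e => G.connectedComponentMk e.out.1
  have hcomp : ∀ e ∈ G.edgeSet, ∀ v ∈ e, G.connectedComponentMk v = comp e := fun e he v hv =>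
    SimpleGraph.ConnectedComponent.sound (reachable_of_mem_edge he hv (Sym2.out_fst_mem e))
  have hreach : ∀ e ∈ G.edgeSet, ∀ v ∈ e, G.Reachable (r (comp e)) v := fun e he v hv =>
    SimpleGraph.ConnectedComponent.exact ((hr _).trans (hcomp e he v hv).symm)
  refine ⟨fun e => φ (comp e) e, fun e he f hf hef => ?_, fun e he =>
    hφ _ e he (hreach e he)⟩
  have hcef : comp e = comp f := by
    obtain ⟨v, hve, hvf⟩ | ⟨g, hg, ⟨v, hv, hvg⟩, w, hwg, hwf⟩ := hef.2
    · rw [← hcomp e he v hve, hcomp f hf v hvf]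
    · rw [← hcomp e he v hv, hcomp g hg v hvg, ← hcomp g hg w hwg, hcomp f hf w hwf]
  have := hφ' (comp e) e he f hf (hreach e he) (hcef ▸ hreach f hf) hef
  change φ (comp e) e ≠ φ (comp f) f
  rwa [hcef] at this ⊢

/-- Distance from `r` to the nearer endpoint of an edge. -/
noncomputable def edgeDist (G : SimpleGraph V) (r : V) (e : Sym2 V) : ℕ :=
  min (G.dist r e.out.1) (G.dist r e.out.2)

theorem edgeDist_le (G : SimpleGraph V) (r : V) {e : Sym2 V} {x : V} (hx : x ∈ e) :
    edgeDist G r e ≤ G.dist r x := by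
  have h := Quot.out_eq e
  rw [edgeDist]
  rw [← h] at hx
  rcases Sym2.mem_iff.1 (show x ∈ s(e.out.1, e.out.2) from hx) with rfl | rfl
  · exact min_le_left _ _
  · exact min_le_right _ _

theorem exists_edgeDist_eq (G : SimpleGraph V) (r : V) (e : Sym2 V) :
    ∃ a b, e = s(a, b) ∧ edgeDist G r e = G.dist r a := by
  have h : e = s(e.out.1, e.out.2) := (Quot.out_eq e).symm
  rw [edgeDist]
  rcases le_total (G.dist r e.out.1) (G.dist r e.out.2) with h' | h'
  · exact ⟨_, _, h, min_eq_left h'⟩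
  · exact ⟨_, _, by rw [Sym2.eq_swap]; exact h, min_eq_right h'⟩

theorem exists_adj_dist_lt {G : SimpleGraph V} {r a : V} (h : G.Reachable r a) (hne : a ≠ r) :
    ∃ x, G.Adj a x ∧ G.dist r x < G.dist r a := by
  obtain ⟨p, hp⟩ := h.symm.exists_walk_length_eq_dist
  cases p with
  | nil => exact absurd rfl hne
  | cons hadj q =>
    rename_i x
    refine ⟨x, hadj, ?_⟩
    have := G.dist_le q
    rw [SimpleGraph.Walk.length_cons] at hp
    rw [SimpleGraph.dist_comm, SimpleGraph.dist_comm (u := r)]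
    omega

variable [Fintype V] [DecidableEq V] (G : SimpleGraph V) [DecidableRel G.Adj]

/-- The number of edges outside `R` reached from `a` through neighbours other than `b`. -/
def outerCount (R : Finset V) (a b : V) : ℕ :=
  ∑ y ∈ (G.neighborFinset a).erase b, if y ∈ R then 0 else (G.neighborFinset y \ R).card

theorem card_le_outerCount (R : Finset V) (a b : V) (s : Finset (Sym2 V))
    (hs : ∀ f ∈ s, f ∈ G.edgeSet ∧ (∀ v ∈ f, v ∉ R) ∧ edgeConflict G s(a, b) f) :
    s.card ≤ outerCount G R a b + outerCount G R b a := by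
  let T : V → Finset (Sym2 V) := fun y =>
    if y ∈ R then ∅ else (G.neighborFinset y \ R).image fun z => s(y, z)
  have hT : ∀ y, (T y).card ≤ if y ∈ R then 0 else (G.neighborFinset y \ R).card := by
    intro y
    simp only [T]
    split_ifs
    · simp
    · exact Finset.card_image_le
  have hmem : ∀ f ∈ s, ∀ y ∈ f, f ∈ T y := by
    intro f hf y hy
    obtain ⟨h1, h2, -⟩ := hs f hf
    obtain ⟨z, rfl⟩ := Sym2.mem_iff_exists.1 hy
    simp only [T, if_neg (h2 y hy)]
    exact Finset.mem_image.2 ⟨z, Finset.mem_sdiff.2 ⟨by simpa using h1, h2 z (by simp)⟩, rfl⟩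
  have hsub : s ⊆ ((G.neighborFinset a).erase b).biUnion T ∪
      ((G.neighborFinset b).erase a).biUnion T := by
    intro f hf
    rw [Finset.mem_union, Finset.mem_biUnion, Finset.mem_biUnion]
    refine ((hs f hf).2.2.exists_adj (hs f hf).1).imp ?_ ?_
    · rintro ⟨y, h1, h2, h3⟩
      exact ⟨y, by simp [h1, h2], hmem f hf y h3⟩
    · rintro ⟨y, h1, h2, h3⟩
      exact ⟨y, by simp [h1, h2], hmem f hf y h3⟩
  refine (Finset.card_le_card hsub).trans ((Finset.card_union_le _ _).trans (add_le_add ?_ ?_))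
  · exact Finset.card_biUnion_le.trans (Finset.sum_le_sum fun y _ => hT y)
  · exact Finset.card_biUnion_le.trans (Finset.sum_le_sum fun y _ => hT y)

variable {G}

theorem card_conflict_le_nine (hG : ∀ u v, G.Adj u v → G.degree u + G.degree v ≤ 6) {x a b : V}
    (hax : G.Adj a x) (hab : G.Adj a b) (hxb : x ≠ b) (s : Finset (Sym2 V))
    (hs : ∀ f ∈ s, f ∈ G.edgeSet ∧ x ∉ f ∧ edgeConflict G s(a, b) f) : s.card ≤ 9 := by
  have hsub : s ⊆ (((G.neighborFinset a).erase b).erase x).biUnion (fun y => G.incidenceFinset y) ∪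
      ((G.neighborFinset b).erase a).biUnion (fun y => G.incidenceFinset y) := by
    intro f hf
    obtain ⟨h1, h2, h3⟩ := hs f hf
    rw [Finset.mem_union, Finset.mem_biUnion, Finset.mem_biUnion]
    refine (h3.exists_adj h1).imp ?_ ?_
    · rintro ⟨y, hay, hyb, hyf⟩
      have hyx : y ≠ x := fun h => h2 (h ▸ hyf)
      exact ⟨y, by simp [hay, hyb, hyx], by simpa [SimpleGraph.incidenceSet] using ⟨h1, hyf⟩⟩
    · rintro ⟨y, hay, hyb, hyf⟩
      exact ⟨y, by simp [hay, hyb], by simpa [SimpleGraph.incidenceSet] using ⟨h1, hyf⟩⟩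
  have hA : (((G.neighborFinset a).erase b).erase x).card = G.degree a - 2 := by
    rw [Finset.card_erase_of_mem (by simp [hax, hxb]), Finset.card_erase_of_mem (by simpa using hab),
      SimpleGraph.card_neighborFinset_eq_degree]
    omega
  have hB : ((G.neighborFinset b).erase a).card = G.degree b - 1 := by
    rw [Finset.card_erase_of_mem (by simpa using hab.symm),
      SimpleGraph.card_neighborFinset_eq_degree]
  have h1 : ((((G.neighborFinset a).erase b).erase x).biUnion
      (fun y => G.incidenceFinset y)).card ≤ (G.degree a - 2) * (6 - G.degree a) := by
    rw [← hA]
    refine Finset.card_biUnion_le_card_mul _ _ _ fun y hy => ?_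
    have hy' : G.Adj a y := by simpa using (Finset.mem_of_mem_erase (Finset.mem_of_mem_erase hy))
    have := hG a y hy'
    rw [SimpleGraph.card_incidenceFinset_eq_degree]
    omega
  have h2 : (((G.neighborFinset b).erase a).biUnion
      (fun y => G.incidenceFinset y)).card ≤ (G.degree b - 1) * (6 - G.degree b) := by
    rw [← hB]
    refine Finset.card_biUnion_le_card_mul _ _ _ fun y hy => ?_
    have hy' : G.Adj b y := by simpa using (Finset.mem_of_mem_erase hy)
    have := hG b y hy'
    rw [SimpleGraph.card_incidenceFinset_eq_degree]
    omega
  have h3 := (Finset.card_le_card hsub).trans (Finset.card_union_le _ _)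
  have h4 := hG a b hab
  have h5 : 2 ≤ G.degree a := by
    rw [← SimpleGraph.card_neighborFinset_eq_degree]
    exact Finset.one_lt_card.2 ⟨x, by simpa using hax, b, by simpa using hab, hxb⟩
  have h6 : 1 ≤ G.degree b := by
    rw [← SimpleGraph.card_neighborFinset_eq_degree]
    exact Finset.card_pos.2 ⟨a, by simpa using hab.symm⟩
  generalize G.degree a = i at *
  generalize G.degree b = j at *
  have hi : i ≤ 5 := by omega
  have hj : j ≤ 4 := by omega
  interval_cases i <;> interval_cases j <;> omega

/-- Colour the edges avoiding `R` greedily towards `r`, then extend to the edges meeting `R`. -/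
theorem componentColorable_of_root (hG : ∀ u v, G.Adj u v → G.degree u + G.degree v ≤ 6)
    {L : Sym2 V → Finset ℕ} (hL : ∀ e ∈ G.edgeSet, 10 ≤ (L e).card) {R : Finset V} {r : V}
    (hr : r ∈ R) (N : ℕ) (es : ℕ → V × V) (hes : ∀ i < N, G.Adj (es i).1 (es i).2)
    (hcov : ∀ a b, G.Adj a b → a ∈ R → ∃ i < N, s((es i).1, (es i).2) = s(a, b))
    (hcol : ∀ S : ℕ → Finset ℕ, (∀ i < N, 10 ≤ (S i).card +
        (outerCount G R (es i).1 (es i).2 + outerCount G R (es i).2 (es i).1)) →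
      ∃ c : ℕ → ℕ, (∀ i < N, c i ∈ S i) ∧ ∀ i < N, ∀ j < N,
        edgeConflict G s((es i).1, (es i).2) s((es j).1, (es j).2) → c i ≠ c j) :
    ComponentColorable G L r := by
  classical
  let K : Finset (Sym2 V) := G.edgeFinset.filter fun e =>
    (∀ v ∈ e, G.Reachable r v) ∧ ∀ v ∈ e, v ∉ R
  obtain ⟨φ, hφL, hφ⟩ := exists_greedyColoring K (edgeConflict G) (fun _ _ h => h.symm)
    (fun _ h => h.1 rfl) (edgeDist G r) L (by
      intro e he
      simp only [K, Finset.mem_filter, SimpleGraph.mem_edgeFinset] at he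
      obtain ⟨a, b, rfl, hd⟩ := exists_edgeDist_eq G r e
      have hab : G.Adj a b := he.1
      obtain ⟨x, hax, hxd⟩ := exists_adj_dist_lt (he.2.1 a (by simp))
        (fun h => he.2.2 a (by simp) (h ▸ hr))
      have hxb : x ≠ b := by
        rintro rfl
        have := edgeDist_le G r (show x ∈ s(a, x) by simp)
        omega
      refine lt_of_le_of_lt (card_conflict_le_nine hG hax hab hxb _ ?_) (hL _ he.1)
      intro f hf
      simp only [K, Finset.mem_filter, SimpleGraph.mem_edgeFinset] at hf
      refine ⟨hf.1.1, fun hxf => ?_, hf.2.1⟩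
      have := edgeDist_le G r hxf
      omega)
  let out : ℕ → Finset (Sym2 V) := fun i =>
    K.filter fun f => edgeConflict G s((es i).1, (es i).2) f
  obtain ⟨c, hcS, hc⟩ := hcol (fun i => L s((es i).1, (es i).2) \ (out i).image φ) (by
    intro i hi
    have h1 := card_le_outerCount G R (es i).1 (es i).2 (out i) (by
      intro f hf
      simp only [out, K, Finset.mem_filter, SimpleGraph.mem_edgeFinset] at hf
      exact ⟨hf.1.1, hf.1.2.2, hf.2⟩)
    have h2 := hL s((es i).1, (es i).2) (hes i hi)
    have h3 := Finset.le_card_sdiff ((out i).image φ) (L s((es i).1, (es i).2))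
    have h4 : ((out i).image φ).card ≤ (out i).card := Finset.card_image_le
    omega)
  have hidx : ∀ e ∈ G.edgeSet, (∃ v ∈ e, v ∈ R) → ∃ i < N, s((es i).1, (es i).2) = e := by
    rintro e he ⟨v, hve, hvR⟩
    obtain ⟨w, rfl⟩ := Sym2.mem_iff_exists.1 hve
    exact hcov v w he hvR
  choose! idx hidxN hidxe using hidx
  have hK : ∀ e ∈ G.edgeSet, (∀ v ∈ e, G.Reachable r v) → (¬ ∃ v ∈ e, v ∈ R) → e ∈ K := by
    intro e he hr hR
    simp only [K, Finset.mem_filter, SimpleGraph.mem_edgeFinset]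
    push Not at hR
    exact ⟨he, hr, hR⟩
  have hmixed : ∀ e ∈ G.edgeSet, ∀ f ∈ K, (∃ v ∈ e, v ∈ R) → edgeConflict G e f →
      c (idx e) ≠ φ f := by
    intro e he f hf heR hef h
    have h1 := hcS _ (hidxN e he heR)
    rw [Finset.mem_sdiff] at h1
    refine h1.2 (Finset.mem_image.2 ⟨f, Finset.mem_filter.2 ⟨hf, ?_⟩, h.symm⟩)
    rwa [hidxe e he heR]
  refine ⟨fun e => if ∃ v ∈ e, v ∈ R then c (idx e) else φ e, fun e he her => ?_,
    fun e he f hf her hfr hef => ?_⟩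
  · simp only
    split_ifs with h
    · have h1 := hcS _ (hidxN e he h)
      rw [hidxe e he h, Finset.mem_sdiff] at h1
      exact h1.1
    · exact hφL e (hK e he her h)
  · simp only
    split_ifs with h h' h'
    · refine hc _ (hidxN e he h) _ (hidxN f hf h') ?_
      rwa [hidxe e he h, hidxe f hf h']
    · exact hmixed e he f (hK f hf hfr h') h hef
    · exact (hmixed f hf e (hK e he her h) h' hef.symm).symm
    · exact hφ e (hK e he her h) f (hK f hf hfr h') hef

end Root

section Certificate

/-- A local description of a graph: vertices are labelled by `ℕ`, `nbrs` lists the neighbours of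
the labels below its length, and `deg` the degrees of all labels. -/
structure LocalModel where
  nbrs : List (List ℕ)
  deg : ℕ → ℕ
  /-- the root labels -/
  root : List ℕ
  /-- the edges meeting the root -/
  edges : List (ℕ × ℕ)
  /-- labels of pairs of distinct vertices -/
  ne : List (ℕ × ℕ)
  /-- labels of pairs of distinct nonadjacent vertices -/
  far : List (ℕ × ℕ)

namespace LocalModel

variable (M : LocalModel)

def nb (x : ℕ) : List ℕ := M.nbrs.getD x []

def edge (i : ℕ) : ℕ × ℕ := M.edges.getD i (0, 0)

def isNe (x y : ℕ) : Bool := M.ne.elem (x, y) || M.ne.elem (y, x)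

def isFar (x y : ℕ) : Bool :=
  M.far.elem (x, y) || M.far.elem (y, x) || (M.isNe x y &&
    ((x.blt M.nbrs.length && (M.nb x).all fun z => M.isNe z y) ||
      (y.blt M.nbrs.length && (M.nb y).all fun z => M.isNe z x)))

def separated (e f : ℕ × ℕ) : Bool :=
  M.isFar e.1 f.1 && M.isFar e.1 f.2 && M.isFar e.2 f.1 && M.isFar e.2 f.2

/-- The pairs of edges that may conflict. -/
def pairs : List (ℕ × ℕ) :=
  (List.range M.edges.length).flatMap fun j =>
    ((List.range j).filter fun i => !M.separated (M.edge i) (M.edge j)).map fun i => (i, j)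

/-- A bound for the number of edges outside the root reached from `a` not through `b`. -/
def sideBound (a b : ℕ) : ℕ :=
  if a.blt M.nbrs.length then
    (((M.nb a).filter fun y => !y.beq b).map fun y => if M.root.elem y then 0 else
      M.deg y - (M.root.filter fun r => (M.nb r).elem y).length).sum
  else (M.deg a - 1) * (6 - M.deg a)

def check (D : List ℕ) : Bool :=
  (M.root.all fun r => r.blt M.nbrs.length && (M.nb r).all fun y =>
    M.edges.elem (r, y) || M.edges.elem (y, r)) &&
  (M.edges.all fun e => (e.1.blt M.nbrs.length && (M.nb e.1).elem e.2) ||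
    (e.2.blt M.nbrs.length && (M.nb e.2).elem e.1)) &&
  ((List.range M.edges.length).all fun i =>
    (D.getD i 0 + (M.sideBound (M.edge i).1 (M.edge i).2 +
      M.sideBound (M.edge i).2 (M.edge i).1)).blt 10) &&
  (D.all fun d => d.blt 16)

variable {M} {V : Type*} [Fintype V] [DecidableEq V] {G : SimpleGraph V} [DecidableRel G.Adj]

/-- `lam` is a realisation of the local model `M` in `G`. -/
structure Realizes (M : LocalModel) (G : SimpleGraph V) [DecidableRel G.Adj] (lam : ℕ → V) :
    Prop where
  adj_iff : ∀ x < M.nbrs.length, ∀ v, G.Adj (lam x) v ↔ ∃ y ∈ M.nb x, v = lam y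
  degree_eq : ∀ x, G.degree (lam x) = M.deg x
  ne : ∀ p ∈ M.ne, lam p.1 ≠ lam p.2
  far : ∀ p ∈ M.far, lam p.1 ≠ lam p.2 ∧ ¬ G.Adj (lam p.1) (lam p.2)
  nodup : (M.root.map lam).Nodup

variable {lam : ℕ → V} (h : M.Realizes G lam)

include h

omit [DecidableEq V] in
theorem Realizes.ne_of_isNe {x y : ℕ} (hxy : M.isNe x y = true) : lam x ≠ lam y := by
  simp only [isNe, Bool.or_eq_true, List.elem_eq_mem, decide_eq_true_eq] at hxy
  rcases hxy with hxy | hxy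
  · exact h.ne _ hxy
  · exact (h.ne _ hxy).symm

omit [DecidableEq V] in
theorem Realizes.of_isFar {x y : ℕ} (hxy : M.isFar x y = true) :
    lam x ≠ lam y ∧ ¬ G.Adj (lam x) (lam y) := by
  simp only [isFar, Bool.or_eq_true, Bool.and_eq_true, List.elem_eq_mem, decide_eq_true_eq,
    Nat.blt_eq, List.all_eq_true] at hxy
  rcases hxy with (hxy | hxy) | ⟨hne, ⟨hx, hxy⟩ | ⟨hy, hxy⟩⟩
  · exact h.far _ hxy
  · exact ⟨(h.far _ hxy).1.symm, fun hadj => (h.far _ hxy).2 hadj.symm⟩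
  · refine ⟨h.ne_of_isNe hne, fun hadj => ?_⟩
    obtain ⟨z, hz, hzy⟩ := (h.adj_iff x hx _).1 hadj
    exact h.ne_of_isNe (hxy z hz) hzy.symm
  · refine ⟨h.ne_of_isNe hne, fun hadj => ?_⟩
    obtain ⟨z, hz, hzy⟩ := (h.adj_iff y hy _).1 hadj.symm
    exact h.ne_of_isNe (hxy z hz) hzy.symm

theorem Realizes.not_conflict {e f : ℕ × ℕ} (hef : M.separated e f = true) :
    ¬ edgeConflict G s(lam e.1, lam e.2) s(lam f.1, lam f.2) := by
  simp only [separated, Bool.and_eq_true] at hef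
  obtain ⟨⟨⟨h1, h2⟩, h3⟩, h4⟩ := hef
  have h1 := h.of_isFar h1
  have h2 := h.of_isFar h2
  have h3 := h.of_isFar h3
  have h4 := h.of_isFar h4
  rintro ⟨-, ⟨v, hv, hv'⟩ | ⟨g, hg, ⟨v, hv, hvg⟩, w, hwg, hw⟩⟩
  · rw [Sym2.mem_iff] at hv hv'
    rcases hv with rfl | rfl <;> rcases hv' with hv' | hv' <;> simp_all
  · have hvw : v = w ∨ G.Adj v w := by
      by_cases hvw : v = w
      · exact Or.inl hvw
      · rw [(Sym2.mem_and_mem_iff hvw).1 ⟨hvg, hwg⟩, SimpleGraph.mem_edgeSet] at hg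
        exact Or.inr hg
    rw [Sym2.mem_iff] at hv hw
    rcases hv with rfl | rfl <;> rcases hw with rfl | rfl <;> tauto

omit h [Fintype V] in
theorem sum_le_sum_list {s : Finset V} {l : List ℕ} (hs : ∀ v ∈ s, ∃ y ∈ l, v = lam y)
    (f : V → ℕ) : ∑ v ∈ s, f v ≤ (l.map fun y => f (lam y)).sum := by
  induction l generalizing s with
  | nil =>
    have : s = ∅ := Finset.eq_empty_of_forall_notMem fun v hv => by simpa using hs v hv
    simp [this]
  | cons a l ih =>
    have h1 := ih (s := s.erase (lam a)) fun v hv => by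
      obtain ⟨y, hy, rfl⟩ := hs v (Finset.mem_of_mem_erase hv)
      rcases List.mem_cons.1 hy with rfl | hy
      · exact absurd rfl (Finset.ne_of_mem_erase hv)
      · exact ⟨y, hy, rfl⟩
    rw [List.map_cons, List.sum_cons]
    by_cases ha : lam a ∈ s
    · rw [← Finset.add_sum_erase _ _ ha]
      omega
    · rw [Finset.erase_eq_of_notMem ha] at h1
      omega

theorem Realizes.outerCount_le (hG : ∀ u v, G.Adj u v → G.degree u + G.degree v ≤ 6)
    (hroot : ∀ r ∈ M.root, r < M.nbrs.length) {a b : ℕ} (hab : G.Adj (lam a) (lam b)) :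
    outerCount G (M.root.map lam).toFinset (lam a) (lam b) ≤ M.sideBound a b := by
  set R := (M.root.map lam).toFinset with hR
  unfold outerCount sideBound
  split_ifs with ha
  · rw [Nat.blt_eq] at ha
    refine (sum_le_sum_list (lam := lam) (l := (M.nb a).filter fun y => !y.beq b) ?_ _).trans ?_
    · intro v hv
      rw [Finset.mem_erase, SimpleGraph.mem_neighborFinset, h.adj_iff a ha] at hv
      obtain ⟨hvb, y, hy, rfl⟩ := hv
      refine ⟨y, List.mem_filter.2 ⟨hy, ?_⟩, rfl⟩
      rw [Bool.not_eq_true', Bool.eq_false_iff]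
      intro hyb
      exact hvb (by rw [Nat.eq_of_beq_eq_true hyb])
    · refine List.sum_le_sum fun y _ => ?_
      have hRy : M.root.elem y = true → lam y ∈ R := by
        intro hy
        rw [hR, List.mem_toFinset]
        exact List.mem_map_of_mem (by simpa using hy)
      by_cases h1 : M.root.elem y = true
      · rw [if_pos (hRy h1)]
        exact Nat.zero_le _
      · rw [if_neg h1]
        split_ifs
        · exact Nat.zero_le _
        · rw [Finset.card_sdiff, SimpleGraph.card_neighborFinset_eq_degree, h.degree_eq]
          refine Nat.sub_le_sub_left ?_ _
          have h2 : ((M.root.filter fun r => (M.nb r).elem y).map lam).Nodup :=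
            h.nodup.sublist (List.Sublist.map _ List.filter_sublist)
          rw [← List.length_map (f := lam), ← List.toFinset_card_of_nodup h2]
          refine Finset.card_le_card fun v hv => ?_
          rw [List.mem_toFinset, List.mem_map] at hv
          obtain ⟨r, hr, rfl⟩ := hv
          rw [List.mem_filter] at hr
          rw [Finset.mem_inter, SimpleGraph.mem_neighborFinset, hR, List.mem_toFinset]
          exact ⟨List.mem_map_of_mem hr.1, ((h.adj_iff r (hroot r hr.1) _).2
            ⟨y, by simpa using hr.2, rfl⟩).symm⟩
  · rw [← h.degree_eq, ← SimpleGraph.card_neighborFinset_eq_degree, ←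
      Finset.card_erase_of_mem ((SimpleGraph.mem_neighborFinset G _ _).2 hab), ← smul_eq_mul]
    refine Finset.sum_le_card_nsmul _ _ _ fun y hy => ?_
    have h1 := hG _ _ ((SimpleGraph.mem_neighborFinset G _ _).1 (Finset.mem_of_mem_erase hy))
    have h2 := Finset.card_le_card (Finset.sdiff_subset (s := G.neighborFinset y) (t := R))
    rw [SimpleGraph.card_neighborFinset_eq_degree] at h2 ⊢
    split_ifs <;> omega

theorem Realizes.componentColorable (hG : ∀ u v, G.Adj u v → G.degree u + G.degree v ≤ 6)
    {L : Sym2 V → Finset ℕ} (hL : ∀ e ∈ G.edgeSet, 10 ≤ (L e).card) {r : ℕ} (hr : r ∈ M.root)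
    {D : List ℕ} (hD : M.check D = true) {c : ℤ} (hc : c ≠ 0)
    (hexp : expand [] M.pairs [(encode D, 1)] = [(0, c)]) : ComponentColorable G L (lam r) := by
  simp only [check, Bool.and_eq_true, List.all_eq_true, Nat.blt_eq, Bool.or_eq_true,
    List.elem_eq_mem, decide_eq_true_eq, List.mem_range] at hD
  obtain ⟨⟨⟨hcov, hes⟩, hlist⟩, hD16⟩ := hD
  have hmem : ∀ i < M.edges.length, M.edge i ∈ M.edges := fun i hi => by
    rw [edge, List.getD_eq_getElem _ _ hi]
    exact List.getElem_mem hi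
  have hadj : ∀ i < M.edges.length, G.Adj (lam (M.edge i).1) (lam (M.edge i).2) := by
    intro i hi
    rcases hes _ (hmem i hi) with ⟨h1, h2⟩ | ⟨h1, h2⟩
    · exact (h.adj_iff _ h1 _).2 ⟨_, h2, rfl⟩
    · exact ((h.adj_iff _ h1 _).2 ⟨_, h2, rfl⟩).symm
  refine componentColorable_of_root hG hL (R := (M.root.map lam).toFinset)
    (List.mem_toFinset.2 (List.mem_map_of_mem hr)) M.edges.length
    (fun i => (lam (M.edge i).1, lam (M.edge i).2)) hadj ?_ ?_
  · intro a b hab ha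
    rw [List.mem_toFinset, List.mem_map] at ha
    obtain ⟨x, hx, rfl⟩ := ha
    obtain ⟨hx', hxe⟩ := hcov x hx
    obtain ⟨y, hy, rfl⟩ := (h.adj_iff x hx' _).1 hab
    rcases hxe y hy with he | he <;> obtain ⟨i, hi, hie⟩ := List.getElem_of_mem he <;>
      refine ⟨i, hi, ?_⟩ <;> simp only [edge, List.getD_eq_getElem _ _ hi, hie]
    exact Sym2.eq_swap
  · intro S hS
    obtain ⟨col, h1, h2⟩ := exists_listColoring_of_expand (N := M.edges.length) (E := M.pairs)
      (D := D) (by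
        simp only [pairs, List.all_eq_true, List.mem_flatMap, List.mem_map, List.mem_filter,
          List.mem_range, Bool.and_eq_true, Nat.blt_eq]
        rintro e ⟨j, hj, i, ⟨hi, -⟩, rfl⟩
        exact ⟨by simp only; omega, hj⟩) (by simpa using hD16) hc hexp S (by
        intro i hi
        have h3 := h.outerCount_le hG (fun r hr => (hcov r hr).1) (hadj i hi)
        have h4 := h.outerCount_le hG (fun r hr => (hcov r hr).1) (hadj i hi).symm
        have h5 := hlist i hi
        have h6 := hS i hi
        simp only at h6
        omega)
    refine ⟨col, h1, ?_⟩
    have key : ∀ i j, i < j → j < M.edges.length →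
        edgeConflict G s(lam (M.edge i).1, lam (M.edge i).2) s(lam (M.edge j).1, lam (M.edge j).2) →
        col i ≠ col j := by
      intro i j hij hj hcon
      refine h2 (i, j) ?_
      simp only [pairs, List.mem_flatMap, List.mem_map, List.mem_filter, List.mem_range]
      refine ⟨j, hj, i, ⟨hij, ?_⟩, rfl⟩
      rw [Bool.not_eq_true', Bool.eq_false_iff]
      exact fun hsep => h.not_conflict hsep hcon
    intro i hi j hj hcon
    rcases lt_trichotomy i j with hij | rfl | hij
    · exact key i j hij hj hcon
    · exact absurd rfl hcon.1
    · exact (key j i hij hi hcon.symm).symm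

end LocalModel

end Certificate

section Neighbors

variable {V : Type*} [Fintype V] [DecidableEq V] {G : SimpleGraph V} [DecidableRel G.Adj]

theorem forall_getD {α : Type*} {P : α → Prop} {l : List α} {d : α} (hl : ∀ a ∈ l, P a)
    (hd : P d) (i : ℕ) : P (l.getD i d) := by
  rw [List.getD_eq_getElem?_getD]
  rcases lt_or_ge i l.length with hi | hi
  · rw [List.getElem?_eq_getElem hi]
    exact hl _ (List.getElem_mem hi)
  · rwa [List.getElem?_eq_none hi]

/-- The neighbours of `v` are those in `l`, followed by further vertices. -/
theorem exists_neighbors_append {v : V} {l : List V} (hl : l.Nodup) (hadj : ∀ x ∈ l, G.Adj v x)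
    {k : ℕ} (hk : G.degree v = l.length + k) :
    ∃ m : List V, m.length = k ∧ (l ++ m).Nodup ∧ ∀ x, G.Adj v x ↔ x ∈ l ++ m := by
  refine ⟨(G.neighborFinset v \ l.toFinset).toList, ?_, ?_, fun x => ?_⟩
  · rw [Finset.length_toList, Finset.card_sdiff_of_subset, List.toFinset_card_of_nodup hl,
      SimpleGraph.card_neighborFinset_eq_degree, hk, Nat.add_sub_cancel_left]
    intro x hx
    simpa using hadj x (by simpa using hx)
  · refine hl.append (Finset.nodup_toList _) fun x hx hx' => ?_
    simp only [Finset.mem_toList, Finset.mem_sdiff, List.mem_toFinset] at hx'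
    exact hx'.2 hx
  · simp only [List.mem_append, Finset.mem_toList, Finset.mem_sdiff, List.mem_toFinset,
      SimpleGraph.mem_neighborFinset]
    have := hadj x
    tauto

theorem exists_third_neighbor {v a b : V} (hd : G.degree v = 3) (ha : G.Adj v a) (hb : G.Adj v b)
    (hab : a ≠ b) : ∃ c, c ≠ a ∧ c ≠ b ∧ ∀ x, G.Adj v x ↔ x = a ∨ x = b ∨ x = c := by
  obtain ⟨m, hm, hn, hx⟩ := exists_neighbors_append (G := G) (v := v) (l := [a, b]) (k := 1)
    (by simpa using hab) (by simp [ha, hb]) hd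
  obtain ⟨c, rfl⟩ := List.length_eq_one_iff.1 hm
  simp only [List.cons_append, List.nil_append, List.nodup_cons, List.mem_cons, List.not_mem_nil,
    or_false, not_or] at hn hx
  exact ⟨c, Ne.symm hn.1.2, Ne.symm hn.2.1, hx⟩

theorem exists_second_neighbor {v a : V} (hd : G.degree v = 2) (ha : G.Adj v a) :
    ∃ b, b ≠ a ∧ ∀ x, G.Adj v x ↔ x = a ∨ x = b := by
  obtain ⟨m, hm, hn, hx⟩ := exists_neighbors_append (G := G) (v := v) (l := [a]) (k := 1)
    (by simp) (by simp [ha]) hd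
  obtain ⟨b, rfl⟩ := List.length_eq_one_iff.1 hm
  simp only [List.cons_append, List.nil_append, List.nodup_cons, List.mem_cons, List.not_mem_nil,
    or_false] at hn hx
  exact ⟨b, Ne.symm hn.1, hx⟩

omit [DecidableEq V] in
theorem exists_neighbor_of_degree_pos {v : V} (hd : 0 < G.degree v) : ∃ a, G.Adj v a := by
  rwa [SimpleGraph.degree_pos_iff_exists_adj] at hd

end Neighbors

section NonCubic

variable {V : Type*} [Fintype V] [DecidableEq V] {G : SimpleGraph V} [DecidableRel G.Adj]
  {L : Sym2 V → Finset ℕ}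

theorem componentColorable_of_degree_zero {r : V} (hr : G.degree r = 0) :
    ComponentColorable G L r := by
  have hno : ∀ e ∈ G.edgeSet, ¬ ∀ v ∈ e, G.Reachable r v := by
    intro e he hre
    induction e with
    | _ a b =>
      have hra : ∀ v, G.Reachable r v → v = r := by
        intro v hv
        by_contra hne
        obtain ⟨p⟩ := hv
        cases p with
        | nil => exact hne rfl
        | cons h _ => exact (G.degree_pos_iff_exists_adj r).2 ⟨_, h⟩ |>.ne' hr
      rw [SimpleGraph.mem_edgeSet, hra a (hre a (by simp)), hra b (hre b (by simp))] at he
      exact he.ne rfl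
  exact ⟨fun _ => 0, fun e he h => absurd h (hno e he), fun e he _ _ h => absurd h (hno e he)⟩

def pendantModel (d : ℕ) : LocalModel where
  nbrs := [[1]]
  deg := fun i => [1].getD i d
  root := [0]
  edges := [(0, 1)]
  ne := []
  far := []

theorem componentColorable_of_degree_one (hG : ∀ u v, G.Adj u v → G.degree u + G.degree v ≤ 6)
    (hL : ∀ e ∈ G.edgeSet, 10 ≤ (L e).card) {r : V} (hr : G.degree r = 1) :
    ComponentColorable G L r := by
  obtain ⟨a, ha⟩ := exists_neighbor_of_degree_pos (G := G) (v := r) (by omega)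
  obtain ⟨m, hm, -, hx⟩ := exists_neighbors_append (G := G) (v := r) (l := [a]) (k := 0)
    (by simp) (by simp [ha]) hr
  obtain rfl := List.length_eq_zero_iff.1 hm
  have h : (pendantModel (G.degree a)).Realizes G (fun i => [r].getD i a) := by
    constructor
    · intro x hx'
      simp only [pendantModel, List.length_cons, List.length_nil] at hx'
      interval_cases x
      simpa [pendantModel, LocalModel.nb] using hx
    · rintro (_ | i)
      exacts [hr, rfl]
    · simp [pendantModel]
    · simp [pendantModel]
    · simp [pendantModel]
  have hd : G.degree a ≤ 5 := by have := hG r a ha; omega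
  refine h.componentColorable hG hL (r := 0) (D := [0]) (c := 1) (by simp [pendantModel]) ?_
    one_ne_zero ?_
  all_goals
    generalize G.degree a = d at hd
    clear * - hd
    revert d
    decide +kernel

def pathModel (d e : ℕ) : LocalModel where
  nbrs := [[1, 2]]
  deg := fun i => [2, d].getD i e
  root := [0]
  edges := [(0, 1), (0, 2)]
  ne := []
  far := []

theorem componentColorable_of_degree_two (hG : ∀ u v, G.Adj u v → G.degree u + G.degree v ≤ 6)
    (hL : ∀ e ∈ G.edgeSet, 10 ≤ (L e).card) {r b : V} (hr : G.degree r = 2) (hb : G.Adj r b)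
    (hb3 : G.degree b ≤ 3) : ComponentColorable G L r := by
  obtain ⟨a, hab, hx⟩ := exists_second_neighbor hr hb
  have h : (pathModel (G.degree a) (G.degree b)).Realizes G (fun i => [r, a].getD i b) := by
    constructor
    · intro x hx'
      simp only [pathModel, List.length_cons, List.length_nil] at hx'
      interval_cases x
      simpa [pathModel, LocalModel.nb, or_comm] using hx
    · rintro (_ | _ | i)
      exacts [hr, rfl, rfl]
    · simp [pathModel]
    · simp [pathModel]
    · simp [pathModel]
  have hd : G.degree a ≤ 4 := by have := hG r a ((hx a).2 (Or.inr rfl)); omega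
  refine h.componentColorable hG hL (r := 0) (D := [1, 0]) (c := 1) (by simp [pathModel]) ?_
    one_ne_zero ?_
  all_goals
    generalize G.degree a = d at hd
    generalize G.degree b = e at hb3
    clear * - hd hb3
    revert d e
    decide +kernel

def starModel : LocalModel where
  nbrs := [[1, 2, 3, 4], [0, 5], [0, 6]]
  deg := fun i => [4, 2, 2, 2, 2].getD i 4
  root := [0, 1, 2]
  edges := [(0, 1), (0, 2), (0, 3), (0, 4), (1, 5), (2, 6)]
  ne := [(0, 2), (0, 5), (0, 6), (1, 2), (1, 6), (2, 5), (5, 6)]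
  far := [(5, 6)]

def starModel' : LocalModel where
  nbrs := [[1, 2, 4, 5], [0, 3], [0, 3], [1, 2, 6, 7]]
  deg := fun i => [4, 2, 2, 4].getD i 2
  root := [0, 1, 2]
  edges := [(0, 1), (0, 2), (0, 4), (0, 5), (1, 3), (2, 3)]
  ne := []
  far := []

theorem componentColorable_of_star (hG : ∀ u v, G.Adj u v → G.degree u + G.degree v ≤ 6)
    (hL : ∀ e ∈ G.edgeSet, 10 ≤ (L e).card) {a : V} (ha : G.degree a = 4)
    (h2 : ∀ x, G.Adj a x → G.degree x = 2)
    (h4 : ∀ x y, G.Adj a x → G.Adj x y → G.degree y = 4)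
    (h2' : ∀ x y z, G.Adj a x → G.Adj x y → G.Adj y z → G.degree z = 2) :
    ComponentColorable G L a := by
  obtain ⟨m, hm, hn, hx⟩ := exists_neighbors_append (G := G) (v := a) (l := []) (k := 4)
    (by simp) (by simp) (by simpa using ha)
  obtain ⟨r0, r1, r2, r3, rfl⟩ := List.length_eq_four.1 hm
  simp only [List.nil_append, List.nodup_cons, List.mem_cons, List.not_mem_nil, or_false, not_or]
    at hn hx
  have ar0 := (hx r0).2 (by simp)
  have ar1 := (hx r1).2 (by simp)
  have ar2 := (hx r2).2 (by simp)
  have ar3 := (hx r3).2 (by simp)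
  obtain ⟨b0, hb0, hx0⟩ := exists_second_neighbor (h2 r0 ar0) ar0.symm
  obtain ⟨b1, hb1, hx1⟩ := exists_second_neighbor (h2 r1 ar1) ar1.symm
  have rb0 := (hx0 b0).2 (by simp)
  have rb1 := (hx1 b1).2 (by simp)
  have db0 := h4 _ _ ar0 rb0
  have db1 := h4 _ _ ar1 rb1
  by_cases hb : b0 = b1
  · subst hb
    obtain ⟨m', hm', hn', hy⟩ := exists_neighbors_append (G := G) (v := b0) (l := [r0, r1]) (k := 2)
      (by simp [hn.1.1]) (by simp [rb0.symm, rb1.symm]) db0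
    obtain ⟨s, t, rfl⟩ := List.length_eq_two.1 hm'
    simp only [List.cons_append, List.nil_append, List.mem_cons, List.not_mem_nil, or_false] at hy
    have bs := (hy s).2 (by simp)
    have bt := (hy t).2 (by simp)
    have h : starModel'.Realizes G (fun i => [a, r0, r1, b0, r2, r3, s].getD i t) := by
      constructor
      · intro x hx'
        simp only [starModel', List.length_cons, List.length_nil] at hx'
        interval_cases x
        · simpa [starModel', LocalModel.nb] using hx
        · simpa [starModel', LocalModel.nb] using hx0
        · simpa [starModel', LocalModel.nb] using hx1
        · simpa [starModel', LocalModel.nb] using hy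
      · rintro (_ | _ | _ | _ | _ | _ | _ | i)
        exacts [ha, h2 _ ar0, h2 _ ar1, db0, h2 _ ar2, h2 _ ar3, h2' _ _ _ ar0 rb0 bs,
          h2' _ _ _ ar0 rb0 bt]
      · simp [starModel']
      · simp [starModel']
      · simp [starModel', ar0.ne, ar1.ne, hn.1.1]
    exact h.componentColorable hG hL (r := 0) (D := [5, 4, 0, 1, 2, 3]) (c := 1)
      (by simp [starModel']) (by decide +kernel) (by decide) (by decide +kernel)
  · have h : starModel.Realizes G (fun i => [a, r0, r1, r2, r3, b0].getD i b1) := by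
      constructor
      · intro x hx'
        simp only [starModel, List.length_cons, List.length_nil] at hx'
        interval_cases x
        · simpa [starModel, LocalModel.nb] using hx
        · simpa [starModel, LocalModel.nb] using hx0
        · simpa [starModel, LocalModel.nb] using hx1
      · rintro (_ | _ | _ | _ | _ | _ | i)
        exacts [ha, h2 _ ar0, h2 _ ar1, h2 _ ar2, h2 _ ar3, db0, db1]
      · have h1 : r0 ≠ b1 := fun h => by
          have := h2 _ ar0
          rw [h] at this
          omega
        have h2 : r1 ≠ b0 := fun h => by
          have := h2 _ ar1
          rw [h] at this
          omega
        simp [starModel, ar1.ne, hb0.symm, hb1.symm, hn.1.1, h1, h2, hb]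
      · simp only [starModel, List.mem_singleton, forall_eq]
        refine ⟨hb, fun h => ?_⟩
        have := hG b0 b1 h
        omega
      · simp [starModel, ar0.ne, ar1.ne, hn.1.1]
    exact h.componentColorable hG hL (r := 0) (D := [0, 4, 2, 3, 2, 3]) (c := -1)
      (by simp [starModel]) (by decide +kernel) (by decide) (by decide +kernel)

theorem componentColorable_of_nonCubic (hG : ∀ u v, G.Adj u v → G.degree u + G.degree v ≤ 6)
    (hL : ∀ e ∈ G.edgeSet, 10 ≤ (L e).card) (c : G.ConnectedComponent)
    (hc : ¬ ∀ v, G.connectedComponentMk v = c → G.degree v = 3) :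
    ∃ r, G.connectedComponentMk r = c ∧ ComponentColorable G L r := by
  by_cases h0 : ∃ v, G.connectedComponentMk v = c ∧ G.degree v = 0
  · obtain ⟨v, hv, h⟩ := h0
    exact ⟨v, hv, componentColorable_of_degree_zero h⟩
  by_cases h1 : ∃ v, G.connectedComponentMk v = c ∧ G.degree v = 1
  · obtain ⟨v, hv, h⟩ := h1
    exact ⟨v, hv, componentColorable_of_degree_one hG hL h⟩
  by_cases h2 : ∃ v b, G.connectedComponentMk v = c ∧ G.degree v = 2 ∧ G.Adj v b ∧ G.degree b ≤ 3
  · obtain ⟨v, b, hv, h, hvb, hb⟩ := h2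
    exact ⟨v, hv, componentColorable_of_degree_two hG hL h hvb hb⟩
  push Not at h0 h1 h2 hc
  have hadj : ∀ {v w}, G.connectedComponentMk v = c → G.Adj v w → G.connectedComponentMk w = c :=
    fun hv hvw => (SimpleGraph.ConnectedComponent.sound hvw.symm.reachable).trans hv
  have hge : ∀ v, G.connectedComponentMk v = c → 2 ≤ G.degree v := fun v hv => by
    have := h0 v hv
    have := h1 v hv
    omega
  have h24 : ∀ v w, G.connectedComponentMk v = c → G.degree v = 2 → G.Adj v w → G.degree w = 4 :=
    fun v w hv hd hvw => by
      have := h2 v w hv hd hvw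
      have := hG v w hvw
      omega
  have h42 : ∀ v w, G.connectedComponentMk v = c → G.degree v = 4 → G.Adj v w → G.degree w = 2 :=
    fun v w hv hd hvw => by
      have := hge w (hadj hv hvw)
      have := hG v w hvw
      omega
  obtain ⟨a, ha, hda⟩ : ∃ a, G.connectedComponentMk a = c ∧ G.degree a = 4 := by
    obtain ⟨v, hv, hd⟩ := hc
    have := hge v hv
    obtain ⟨w, hvw⟩ := exists_neighbor_of_degree_pos (G := G) (v := v) (by omega)
    by_cases hd2 : G.degree v = 2
    · exact ⟨w, hadj hv hvw, h24 v w hv hd2 hvw⟩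
    · have := hG v w hvw
      have := hge w (hadj hv hvw)
      exact ⟨v, hv, by omega⟩
  refine ⟨a, ha, componentColorable_of_star hG hL hda (fun x hx => h42 a x ha hda hx)
    (fun x y hx hy => h24 x y (hadj ha hx) (h42 a x ha hda hx) hy) fun x y z hx hy hz => ?_⟩
  exact h42 y z (hadj (hadj ha hx) hy) (h24 x y (hadj ha hx) (h42 a x ha hda hx) hy) hz

end NonCubic

section Cycle

theorem edgeConflict.exists_near {V : Type*} {G : SimpleGraph V} {e f : Sym2 V}
    (h : edgeConflict G e f) : ∃ x ∈ e, ∃ y ∈ f, x = y ∨ G.Adj x y := by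
  obtain ⟨-, ⟨v, h1, h2⟩ | ⟨g, hg, ⟨v, hv, hvg⟩, w, hwg, hw⟩⟩ := h
  · exact ⟨v, h1, v, h2, Or.inl rfl⟩
  · refine ⟨v, hv, w, hw, ?_⟩
    by_cases hvw : v = w
    · exact Or.inl hvw
    · rw [(Sym2.mem_and_mem_iff hvw).1 ⟨hvg, hwg⟩, SimpleGraph.mem_edgeSet] at hg
      exact Or.inr hg

theorem add_sub_one_mod {k j : ℕ} (h : j < k) :
    j = 0 ∧ (j + k - 1) % k = k - 1 ∨ 0 < j ∧ (j + k - 1) % k = j - 1 := by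
  rcases Nat.eq_zero_or_pos j with h0 | h0
  · subst h0
    refine Or.inl ⟨rfl, ?_⟩
    rw [Nat.mod_eq_of_lt] <;> omega
  · refine Or.inr ⟨h0, ?_⟩
    rw [show j + k - 1 = j - 1 + k by omega, Nat.add_mod_right, Nat.mod_eq_of_lt (by omega)]

theorem add_sub_two_mod {k j : ℕ} (h : j < k) (hk : 2 ≤ k) :
    j < 2 ∧ (j + k - 2) % k = j + k - 2 ∨ 2 ≤ j ∧ (j + k - 2) % k = j - 2 := by
  rcases Nat.lt_or_ge j 2 with h0 | h0
  · refine Or.inl ⟨h0, ?_⟩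
    rw [Nat.mod_eq_of_lt]
    omega
  · refine Or.inr ⟨h0, ?_⟩
    rw [show j + k - 2 = j - 2 + k by omega, Nat.add_mod_right, Nat.mod_eq_of_lt (by omega)]

theorem add_one_mod {k j : ℕ} (h : j < k) :
    j + 1 = k ∧ (j + 1) % k = 0 ∨ j + 1 < k ∧ (j + 1) % k = j + 1 := by
  rcases (Nat.succ_le_of_lt h).eq_or_lt with h0 | h0
  · exact Or.inl ⟨h0, by rw [← h0, Nat.mod_self]⟩
  · exact Or.inr ⟨h0, Nat.mod_eq_of_lt h0⟩

variable {V : Type*} [Fintype V] [DecidableEq V] {G : SimpleGraph V} [DecidableRel G.Adj]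

/-- `v 0, …, v (k - 1)` is an induced cycle of cubic vertices, and `w i` is the neighbour of `v i`
off the cycle. -/
structure IsPendantCycle (G : SimpleGraph V) [DecidableRel G.Adj] (k : ℕ) (v w : ℕ → V) :
    Prop where
  le : 4 ≤ k
  adj_iff : ∀ i < k, ∀ x, G.Adj (v i) x ↔ x = v ((i + k - 1) % k) ∨ x = v ((i + 1) % k) ∨ x = w i
  degree : ∀ i < k, G.degree (w i) = 3
  inj : ∀ i < k, ∀ j < k, v i = v j → i = j
  disj : ∀ i < k, ∀ j < k, v i ≠ w j
  inj' : ∀ i < k, ∀ j < k, w i = w j → i = j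

namespace IsPendantCycle

variable {k : ℕ} {v w : ℕ → V} (h : IsPendantCycle G k v w)

include h

omit [DecidableEq V] in
theorem near_left {i j : ℕ} (hi : i < k) (hj : j < k) (hn : v i = v j ∨ G.Adj (v i) (v j)) :
    i = j ∨ j = i + 1 ∨ i = j + 1 ∨ i = 0 ∧ j + 1 = k ∨ j = 0 ∧ i + 1 = k := by
  have hk : 0 < k := by omega
  rcases hn with hn | hn
  · exact Or.inl (h.inj i hi j hj hn)
  · have h1 := add_sub_one_mod hi
    have h2 := add_one_mod hi
    rcases (h.adj_iff i hi _).1 hn with hn | hn | hn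
    · have := h.inj _ hj _ (Nat.mod_lt _ hk) hn
      omega
    · have := h.inj _ hj _ (Nat.mod_lt _ hk) hn
      omega
    · exact absurd hn (h.disj j hj i hi)

omit [DecidableEq V] in
theorem near_mixed {i j : ℕ} (hi : i < k) (hj : j < k) (hn : v i = w j ∨ G.Adj (v i) (w j)) :
    i = j := by
  have hk : 0 < k := by omega
  rcases hn with hn | hn
  · exact absurd hn (h.disj i hi j hj)
  · rcases (h.adj_iff i hi _).1 hn with hn | hn | hn
    · exact absurd hn.symm (h.disj _ (Nat.mod_lt _ hk) j hj)
    · exact absurd hn.symm (h.disj _ (Nat.mod_lt _ hk) j hj)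
    · exact (h.inj' _ hj _ hi hn).symm

theorem card_sdiff_le {i : ℕ} (hi : i < k) :
    (G.neighborFinset (w i) \ (Finset.range k).image v).card ≤ 2 := by
  have hadj := ((h.adj_iff i hi (w i)).2 (Or.inr (Or.inr rfl))).symm
  have h1 : G.neighborFinset (w i) \ (Finset.range k).image v ⊆
      (G.neighborFinset (w i)).erase (v i) := by
    intro x hx
    rw [Finset.mem_sdiff] at hx
    refine Finset.mem_erase.2 ⟨fun hxv => hx.2 ?_, hx.1⟩
    exact Finset.mem_image.2 ⟨i, Finset.mem_range.2 hi, hxv.symm⟩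
  have h2 := Finset.card_le_card h1
  rw [Finset.card_erase_of_mem (by simpa using hadj), SimpleGraph.card_neighborFinset_eq_degree,
    h.degree i hi] at h2
  exact h2

theorem mem_root {i : ℕ} (hi : i < k) {y : V} (hy : G.Adj (v i) y) (hyw : y ≠ w i) :
    y ∈ (Finset.range k).image v := by
  have hk : 0 < k := by omega
  rcases (h.adj_iff i hi y).1 hy with rfl | rfl | rfl
  · exact Finset.mem_image_of_mem _ (Finset.mem_range.2 (Nat.mod_lt _ hk))
  · exact Finset.mem_image_of_mem _ (Finset.mem_range.2 (Nat.mod_lt _ hk))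
  · exact absurd rfl hyw

theorem outerCount_root_le {i : ℕ} (hi : i < k) (b : V) :
    outerCount G ((Finset.range k).image v) (v i) b ≤ 2 := by
  unfold outerCount
  refine (Finset.sum_le_sum_of_ne_zero (t := {w i}) fun y hy hne => ?_).trans ?_
  · rw [Finset.mem_singleton]
    by_contra hyw
    exact hne (if_pos (h.mem_root hi (by simpa using (Finset.mem_of_mem_erase hy)) hyw))
  · rw [Finset.sum_singleton]
    split_ifs
    · omega
    · exact h.card_sdiff_le hi

theorem outerCount_root_pendant {i : ℕ} (hi : i < k) :
    outerCount G ((Finset.range k).image v) (v i) (w i) = 0 := by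
  refine Finset.sum_eq_zero fun y hy => if_pos ?_
  rw [Finset.mem_erase, SimpleGraph.mem_neighborFinset] at hy
  exact h.mem_root hi hy.2 hy.1

theorem outerCount_pendant_le (hG : ∀ u v, G.Adj u v → G.degree u + G.degree v ≤ 6) {i : ℕ}
    (hi : i < k) : outerCount G ((Finset.range k).image v) (w i) (v i) ≤ 6 ∧
      ∀ j < k, G.Adj (w i) (w j) → outerCount G ((Finset.range k).image v) (w i) (v i) ≤ 5 := by
  have hadj := ((h.adj_iff i hi (w i)).2 (Or.inr (Or.inr rfl))).symm
  have hcard : ((G.neighborFinset (w i)).erase (v i)).card = 2 := by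
    rw [Finset.card_erase_of_mem (by simpa using hadj), SimpleGraph.card_neighborFinset_eq_degree,
      h.degree i hi]
  have hterm : ∀ y ∈ (G.neighborFinset (w i)).erase (v i),
      (if y ∈ (Finset.range k).image v then 0 else
        (G.neighborFinset y \ (Finset.range k).image v).card) ≤ 3 := by
    intro y hy
    have h1 := hG _ _ ((SimpleGraph.mem_neighborFinset G _ _).1 (Finset.mem_of_mem_erase hy))
    have h2 := Finset.card_le_card
      (Finset.sdiff_subset (s := G.neighborFinset y) (t := (Finset.range k).image v))
    rw [SimpleGraph.card_neighborFinset_eq_degree] at h2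
    rw [h.degree i hi] at h1
    split_ifs <;> omega
  unfold outerCount
  constructor
  · have := Finset.sum_le_card_nsmul _ _ _ hterm
    rw [hcard] at this
    exact this
  · intro j hj hij
    have hmem : w j ∈ (G.neighborFinset (w i)).erase (v i) :=
      Finset.mem_erase.2 ⟨(h.disj i hi j hj).symm, by simpa using hij⟩
    rw [← Finset.add_sum_erase _ _ hmem]
    have h1 := Finset.sum_le_card_nsmul (((G.neighborFinset (w i)).erase (v i)).erase (w j)) _ _
      fun y hy => hterm y (Finset.mem_of_mem_erase hy)
    rw [Finset.card_erase_of_mem hmem, hcard] at h1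
    have h2 := h.card_sdiff_le hj
    rw [smul_eq_mul] at h1
    split_ifs <;> omega

theorem componentColorable (hG : ∀ u v, G.Adj u v → G.degree u + G.degree v ≤ 6)
    {L : Sym2 V → Finset ℕ} (hL : ∀ e ∈ G.edgeSet, 10 ≤ (L e).card)
    (hcol : ∀ S : ℕ → Finset ℕ, (∀ j < k, 6 ≤ (S (2 * j)).card) →
      (∀ j < k, 4 ≤ (S (2 * j + 1)).card) →
      (∀ i < k, ∀ j < k, G.Adj (w i) (w j) → 5 ≤ (S (2 * i + 1)).card) →
      ∃ c : ℕ → ℕ, (∀ i < 2 * k, c i ∈ S i) ∧ (∀ j < k, ∀ e ∈ cycleBlock k j, c e.1 ≠ c e.2) ∧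
        ∀ i < k, ∀ j < k, G.Adj (w i) (w j) → c (2 * i + 1) ≠ c (2 * j + 1)) :
    ComponentColorable G L (v 0) := by
  have hk := h.le
  let es : ℕ → V × V := fun i =>
    if i % 2 = 0 then (v ((i / 2 + k - 1) % k), v (i / 2)) else (v (i / 2), w (i / 2))
  have es0 : ∀ j, es (2 * j) = (v ((j + k - 1) % k), v j) := fun j => by simp [es]
  have es1 : ∀ j, es (2 * j + 1) = (v j, w j) := fun j => by
    simp [es, Nat.add_mod, show (2 * j + 1) / 2 = j by omega]
  have hpred : ∀ j, (j + k - 1) % k < k := fun j => Nat.mod_lt _ (by omega)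
  have hadj0 : ∀ j < k, G.Adj (v ((j + k - 1) % k)) (v j) := fun j hj =>
    ((h.adj_iff j hj _).2 (Or.inl rfl)).symm
  have hadj1 : ∀ j < k, G.Adj (v j) (w j) := fun j hj =>
    (h.adj_iff j hj _).2 (Or.inr (Or.inr rfl))
  refine componentColorable_of_root hG hL (R := (Finset.range k).image v)
    (Finset.mem_image_of_mem _ (Finset.mem_range.2 (by omega))) (2 * k) es ?_ ?_ ?_
  · intro i hi
    obtain ⟨j, rfl | rfl⟩ := i.even_or_odd'
    · rw [es0]
      exact hadj0 j (by omega)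
    · rw [es1]
      exact hadj1 j (by omega)
  · intro a b hab ha
    obtain ⟨i, hi, rfl⟩ := Finset.mem_image.1 ha
    rw [Finset.mem_range] at hi
    rcases (h.adj_iff i hi b).1 hab with rfl | rfl | rfl
    · exact ⟨2 * i, by omega, by rw [es0, Sym2.eq_swap]⟩
    · have hs : (i + 1) % k < k := Nat.mod_lt _ (by omega)
      refine ⟨2 * ((i + 1) % k), by omega, ?_⟩
      rw [es0]
      have : ((i + 1) % k + k - 1) % k = i := by
        have := add_sub_one_mod hs
        have := add_one_mod hi
        omega
      rw [this]
    · exact ⟨2 * i + 1, by omega, by rw [es1]⟩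
  · intro S hS
    obtain ⟨c, hcS, hc, hcw⟩ := hcol S (by
      intro j hj
      have h1 := hS (2 * j) (by omega)
      rw [es0] at h1
      have h2 := h.outerCount_root_le (hpred j) (v j)
      have h3 := h.outerCount_root_le hj (v ((j + k - 1) % k))
      simp only at h1
      omega) (by
      intro j hj
      have h1 := hS (2 * j + 1) (by omega)
      rw [es1] at h1
      have h2 := h.outerCount_root_pendant hj
      have h3 := (h.outerCount_pendant_le hG hj).1
      simp only at h1
      omega) (by
      intro i hi j hj hij
      have h1 := hS (2 * i + 1) (by omega)
      rw [es1] at h1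
      have h2 := h.outerCount_root_pendant hi
      have h3 := (h.outerCount_pendant_le hG hi).2 j hj hij
      simp only at h1
      omega)
    refine ⟨c, hcS, ?_⟩
    have hp1 : ∀ j < k, _ := fun j hj => add_sub_one_mod (k := k) (j := j) hj
    have hp2 : ∀ j < k, _ := fun j hj => add_sub_two_mod (k := k) (j := j) hj (by omega)
    have hcc : ∀ i < k, ∀ j < k, i ≠ j →
        (∃ x ∈ s(v ((i + k - 1) % k), v i), ∃ y ∈ s(v ((j + k - 1) % k), v j),
          x = y ∨ G.Adj x y) → c (2 * i) ≠ c (2 * j) := by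
      rintro i hi j hj hij ⟨x, hx, y, hy, hxy⟩
      have key : j = (i + k - 1) % k ∨ i = (j + k - 1) % k ∨ j = (i + k - 2) % k ∨
          i = (j + k - 2) % k := by
        have := hp1 i hi
        have := hp1 j hj
        have := hp2 i hi
        have := hp2 j hj
        rw [Sym2.mem_iff] at hx hy
        rcases hx with rfl | rfl <;> rcases hy with rfl | rfl
        · have := h.near_left (hpred _) (hpred _) hxy
          omega
        · have := h.near_left (hpred _) hj hxy
          omega
        · have := h.near_left hi (hpred _) hxy
          omega
        · have := h.near_left hi hj hxy
          omega
      rcases key with hkey | hkey | hkey | hkey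
      · exact hc i hi (2 * i, 2 * j) (by simp [cycleBlock, ← hkey])
      · exact (hc j hj (2 * j, 2 * i) (by simp [cycleBlock, ← hkey])).symm
      · exact hc i hi (2 * i, 2 * j) (by simp [cycleBlock, ← hkey])
      · exact (hc j hj (2 * j, 2 * i) (by simp [cycleBlock, ← hkey])).symm
    have hcp : ∀ i < k, ∀ j < k,
        (∃ x ∈ s(v ((i + k - 1) % k), v i), ∃ y ∈ s(v j, w j),
          x = y ∨ G.Adj x y) → c (2 * i) ≠ c (2 * j + 1) := by
      rintro i hi j hj ⟨x, hx, y, hy, hxy⟩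
      have key : i = j ∨ j = (i + k - 1) % k ∨ i = (j + k - 1) % k ∨ j = (i + k - 2) % k := by
        have := hp1 i hi
        have := hp1 j hj
        have := hp2 i hi
        rw [Sym2.mem_iff] at hx hy
        rcases hx with rfl | rfl <;> rcases hy with rfl | rfl
        · have := h.near_left (hpred _) hj hxy
          omega
        · have := h.near_mixed (hpred _) hj hxy
          omega
        · have := h.near_left hi hj hxy
          omega
        · have := h.near_mixed hi hj hxy
          omega
      rcases key with rfl | hkey | hkey | hkey
      · exact hc i hi (2 * i, 2 * i + 1) (by simp [cycleBlock])
      · exact hc i hi (2 * i, 2 * j + 1) (by simp [cycleBlock, ← hkey])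
      · exact (hc j hj (2 * j + 1, 2 * i) (by simp [cycleBlock, ← hkey])).symm
      · exact hc i hi (2 * i, 2 * j + 1) (by simp [cycleBlock, ← hkey])
    have hpp : ∀ i < k, ∀ j < k, i ≠ j →
        (∃ x ∈ s(v i, w i), ∃ y ∈ s(v j, w j), x = y ∨ G.Adj x y) →
        c (2 * i + 1) ≠ c (2 * j + 1) := by
      rintro i hi j hj hij ⟨x, hx, y, hy, hxy⟩
      rw [Sym2.mem_iff] at hx hy
      rcases hx with rfl | rfl <;> rcases hy with rfl | rfl
      · have key : j = (i + k - 1) % k ∨ i = (j + k - 1) % k := by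
          have := hp1 i hi
          have := hp1 j hj
          have := h.near_left hi hj hxy
          omega
        rcases key with hkey | hkey
        · exact hc i hi (2 * i + 1, 2 * j + 1) (by simp [cycleBlock, ← hkey])
        · exact (hc j hj (2 * j + 1, 2 * i + 1) (by simp [cycleBlock, ← hkey])).symm
      · exact absurd (h.near_mixed hi hj hxy) hij
      · refine absurd (h.near_mixed hj hi ?_).symm hij
        exact hxy.imp Eq.symm SimpleGraph.Adj.symm
      · rcases hxy with hxy | hxy
        · exact absurd (h.inj' i hi j hj hxy) hij
        · exact hcw i hi j hj hxy
    intro i hi j hj hcon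
    have hnear := hcon.exists_near
    have hnear' := hcon.symm.exists_near
    have hij : i ≠ j := fun hij => hcon.1 (by rw [hij])
    obtain ⟨i, rfl | rfl⟩ := i.even_or_odd' <;> obtain ⟨j, rfl | rfl⟩ := j.even_or_odd' <;>
      simp only [es0, es1] at hnear hnear'
    · exact hcc i (by omega) j (by omega) (by omega) hnear
    · exact hcp i (by omega) j (by omega) hnear
    · exact (hcp j (by omega) i (by omega) hnear').symm
    · exact hpp i (by omega) j (by omega) (by omega) hnear

end IsPendantCycle

end Cycle

section CycleCertificates

variable {V : Type*} [Fintype V] [DecidableEq V] {G : SimpleGraph V} [DecidableRel G.Adj]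
  {L : Sym2 V → Finset ℕ} {v w : ℕ → V}

namespace IsPendantCycle

theorem componentColorable_of_expand {k : ℕ} (h : IsPendantCycle G k v w)
    (hG : ∀ u v, G.Adj u v → G.degree u + G.degree v ≤ 6)
    (hL : ∀ e ∈ G.edgeSet, 10 ≤ (L e).card) (E : List (ℕ × ℕ)) (D : List ℕ) (c : ℤ) (hc : c ≠ 0)
    (hE : E.all (fun e => e.1.blt (2 * k) && e.2.blt (2 * k)) = true)
    (hD : D.all (fun d => d.blt 16) = true) (hexp : expand [] E [(encode D, 1)] = [(0, c)])
    (hblk : ∀ j < k, ∀ e ∈ cycleBlock k j, e ∈ E ∨ e.swap ∈ E)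
    (hD0 : ∀ j < k, D.getD (2 * j) 0 ≤ 5)
    (hD1 : ∀ j < k, D.getD (2 * j + 1) 0 ≤ 3 ∨
      D.getD (2 * j + 1) 0 ≤ 4 ∧ ∃ i < k, G.Adj (w j) (w i))
    (hw : ∀ i < k, ∀ j < k, G.Adj (w i) (w j) →
      (2 * i + 1, 2 * j + 1) ∈ E ∨ (2 * j + 1, 2 * i + 1) ∈ E) :
    ComponentColorable G L (v 0) := by
  refine h.componentColorable hG hL fun S h6 h4 h5 => ?_
  obtain ⟨col, hcS, hcol⟩ := exists_listColoring_of_expand hE hD hc hexp S (by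
    intro i hi
    obtain ⟨j, rfl | rfl⟩ := i.even_or_odd'
    · have := h6 j (by omega)
      have := hD0 j (by omega)
      omega
    · have := h4 j (by omega)
      rcases hD1 j (by omega) with h1 | ⟨h1, i, hi, hji⟩
      · omega
      · have := h5 j (by omega) i hi hji
        omega)
  refine ⟨col, hcS, fun j hj e he => ?_, fun i hi j hj hij => ?_⟩
  · rcases hblk j hj e he with h | h
    · exact hcol e h
    · exact (hcol e.swap h).symm
  · rcases hw i hi j hj hij with h | h
    · exact hcol _ h
    · exact (hcol _ h).symm

theorem componentColorable_four (h : IsPendantCycle G 4 v w)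
    (hG : ∀ u v, G.Adj u v → G.degree u + G.degree v ≤ 6)
    (hL : ∀ e ∈ G.edgeSet, 10 ≤ (L e).card) (h02 : ¬ G.Adj (w 0) (w 2))
    (h13 : ¬ G.Adj (w 1) (w 3)) : ComponentColorable G L (v 0) := by
  refine h.componentColorable_of_expand hG hL
    [(5, 7), (0, 5), (0, 7), (5, 6), (6, 7), (0, 6), (2, 5), (2, 7), (0, 2), (2, 6), (4, 5), (4, 7),
      (0, 4), (4, 6), (2, 4), (1, 7), (0, 1), (1, 6), (1, 2), (1, 4), (3, 5), (0, 3), (3, 6),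
      (2, 3), (3, 4), (1, 3)]
    [3, 3, 2, 3, 5, 3, 4, 3] (-2) (by decide) (by decide +kernel) (by decide +kernel)
    (by decide +kernel) (by decide +kernel) (by decide +kernel) ?_ ?_
  · intro j hj
    left
    revert j
    decide
  · intro i hi j hj hij
    have h02' : ¬ G.Adj (w 2) (w 0) := fun h => h02 h.symm
    have h13' : ¬ G.Adj (w 3) (w 1) := fun h => h13 h.symm
    have := hij.ne
    interval_cases i <;> interval_cases j <;> simp_all

theorem componentColorable_five (h : IsPendantCycle G 5 v w)
    (hG : ∀ u v, G.Adj u v → G.degree u + G.degree v ≤ 6)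
    (hL : ∀ e ∈ G.edgeSet, 10 ≤ (L e).card)
    (hw : ∀ i < 5, ∀ j < 5, ¬ G.Adj (w i) (w j)) : ComponentColorable G L (v 0) := by
  refine h.componentColorable_of_expand hG hL
    [(2, 8), (1, 8), (1, 2), (0, 8), (0, 2), (0, 1), (8, 9), (2, 9), (1, 9), (0, 9), (6, 8), (2, 6),
      (0, 6), (6, 9), (7, 8), (0, 7), (7, 9), (6, 7), (5, 8), (2, 5), (5, 6), (5, 7), (2, 3),
      (1, 3), (0, 3), (3, 6), (3, 5), (4, 8), (2, 4), (1, 4), (0, 4), (4, 6), (4, 7), (4, 5),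
      (3, 4)]
    [4, 3, 5, 2, 5, 2, 4, 3, 4, 3] (-8) (by decide) (by decide +kernel) (by decide +kernel)
    (by decide +kernel) (by decide +kernel) (by decide +kernel) ?_ ?_
  · intro j hj
    left
    revert j
    decide
  · exact fun i hi j hj hij => absurd hij (hw i hi j hj)

theorem componentColorable_five_of_adj (h : IsPendantCycle G 5 v w)
    (hG : ∀ u v, G.Adj u v → G.degree u + G.degree v ≤ 6)
    (hL : ∀ e ∈ G.edgeSet, 10 ≤ (L e).card) (h02 : G.Adj (w 0) (w 2)) :
    ComponentColorable G L (v 0) := by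
  refine h.componentColorable_of_expand hG hL
    [(3, 7), (7, 9), (3, 9), (5, 7), (3, 5), (5, 9), (6, 7), (3, 6), (6, 9), (5, 6), (1, 7), (1, 3),
      (1, 9), (1, 5), (0, 7), (0, 3), (0, 9), (0, 6), (0, 1), (2, 3), (2, 9), (2, 5), (2, 6),
      (1, 2), (0, 2), (7, 8), (8, 9), (5, 8), (6, 8), (1, 8), (0, 8), (2, 8), (4, 7), (3, 4),
      (4, 5), (4, 6), (1, 4), (0, 4), (2, 4), (4, 8)]
    [4, 4, 5, 3, 5, 4, 5, 3, 4, 3] (-12) (by decide) (by decide +kernel) (by decide +kernel)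
    (by decide +kernel) (by decide +kernel) (by decide +kernel) ?_ ?_
  · intro j hj
    interval_cases j
    · exact Or.inr ⟨by decide, 2, by omega, h02⟩
    · exact Or.inl (by decide)
    · exact Or.inr ⟨by decide, 0, by omega, h02.symm⟩
    · exact Or.inl (by decide)
    · exact Or.inl (by decide)
  · intro i hi j hj hij
    have hne : i ≠ j := fun h => hij.ne (by rw [h])
    clear hij
    interval_cases i <;> interval_cases j <;> first | exact absurd rfl hne | decide

theorem componentColorable_six (h : IsPendantCycle G 6 v w)
    (hG : ∀ u v, G.Adj u v → G.degree u + G.degree v ≤ 6)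
    (hL : ∀ e ∈ G.edgeSet, 10 ≤ (L e).card)
    (hw : ∀ i < 6, ∀ j < 6, G.Adj (w i) (w j) → i = j + 3 ∨ j = i + 3) :
    ComponentColorable G L (v 0) := by
  refine h.componentColorable_of_expand hG hL
    [(7, 10), (7, 9), (9, 10), (7, 8), (8, 10), (8, 9), (0, 10), (0, 9), (0, 8), (6, 7), (6, 10),
      (6, 9), (6, 8), (10, 11), (9, 11), (8, 11), (0, 11), (1, 7), (1, 10), (0, 1), (1, 11), (5, 7),
      (5, 8), (5, 6), (5, 11), (3, 9), (0, 3), (3, 6), (1, 3), (3, 5), (2, 10), (0, 2), (2, 6),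
      (2, 11), (1, 2), (2, 5), (2, 3), (4, 7), (4, 8), (0, 4), (4, 6), (1, 4), (4, 5), (3, 4),
      (2, 4)]
    [5, 3, 5, 3, 5, 2, 5, 3, 4, 3, 4, 3] 7 (by decide) (by decide +kernel) (by decide +kernel)
    (by decide +kernel) (by decide +kernel) (by decide +kernel) ?_ ?_
  · intro j hj
    left
    revert j
    decide
  · intro i hi j hj hij
    rcases hw i hi j hj hij with rfl | rfl
    · replace hi : j < 3 := by omega
      clear hij hj
      interval_cases j <;> decide
    · replace hj : i < 3 := by omega
      clear hij hi
      interval_cases i <;> decide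

theorem componentColorable_of_seven_le {k : ℕ} (h : IsPendantCycle G k v w) (hk : 7 ≤ k)
    (hG : ∀ u v, G.Adj u v → G.degree u + G.degree v ≤ 6)
    (hL : ∀ e ∈ G.edgeSet, 10 ≤ (L e).card)
    (hw : ∀ i < k, ∀ j < k, ¬ G.Adj (w i) (w j)) : ComponentColorable G L (v 0) := by
  refine h.componentColorable hG hL fun S h6 h4 _ => ?_
  obtain ⟨c, hcS, hc⟩ := exists_cycleColoring hk S h6 h4
  exact ⟨c, hcS, hc, fun i hi j hj hij => absurd hij (hw i hi j hj)⟩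

end IsPendantCycle

end CycleCertificates

section ShortCycles

def triangleModel : LocalModel where
  nbrs := [[1, 2, 3], [0, 2, 4], [0, 1, 5]]
  deg := fun _ => 3
  root := [0, 1, 2]
  edges := [(0, 3), (1, 4), (2, 5), (0, 1), (0, 2), (1, 2)]
  ne := []
  far := []

/-- `K_{2,3}`, two of whose pendant edges share an end. -/
def thetaModel : LocalModel where
  nbrs := [[2, 3, 5], [2, 3, 5], [0, 1, 4], [0, 1, 4], [2, 3, 6], [0, 1, 7]]
  deg := fun _ => 3
  root := [0, 1, 2]
  edges := [(0, 2), (0, 3), (0, 5), (1, 2), (1, 3), (1, 5), (2, 4)]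
  ne := []
  far := []

/-- `K_{2,3}` with pendant edges at pairwise distance two. -/
def thetaModel' : LocalModel where
  nbrs := [[2, 3, 4], [2, 3, 4], [0, 1, 5], [0, 1, 6], [0, 1, 7]]
  deg := fun _ => 3
  root := [0, 1, 2, 3, 4]
  edges := [(0, 2), (0, 3), (0, 4), (1, 2), (1, 3), (1, 4), (2, 5), (3, 6), (4, 7)]
  ne := [(0, 3), (0, 4), (0, 5), (0, 6), (0, 7), (1, 3), (1, 4), (1, 5), (1, 6), (1, 7), (2, 3),
    (2, 4), (2, 6), (2, 7), (3, 4), (3, 5), (3, 7), (4, 5), (4, 6), (5, 6), (5, 7), (6, 7)]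
  far := [(5, 6), (5, 7), (6, 7)]

/-- `K_{2,3}`, two of whose pendant edges have adjacent ends. -/
def thetaModel'' : LocalModel where
  nbrs := [[3, 4, 5], [3, 4, 5], [3, 6, 7], [0, 1, 2], [0, 1, 6], [0, 1, 8], [4, 2, 9]]
  deg := fun _ => 3
  root := [0, 1, 2]
  edges := [(0, 3), (0, 4), (0, 5), (1, 3), (1, 4), (1, 5), (3, 2), (2, 6), (2, 7)]
  ne := [(0, 2), (0, 3), (0, 6), (0, 7), (1, 2), (1, 3), (1, 6), (1, 7), (2, 4), (2, 5), (2, 6),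
    (2, 8), (3, 6), (3, 7), (4, 6), (4, 7), (5, 6), (5, 7), (6, 7), (6, 8)]
  far := []

/-- Three faces of a cube. -/
def squaresModel : LocalModel where
  nbrs := [[3, 1, 6], [0, 4, 5], [3, 5, 6], [0, 4, 2], [1, 3, 7], [1, 2, 8], [0, 2, 9]]
  deg := fun _ => 3
  root := [0, 1, 2]
  edges := [(3, 0), (0, 1), (1, 4), (3, 2), (1, 5), (2, 5), (0, 6), (2, 6)]
  ne := [(0, 2), (0, 6), (1, 2), (1, 6), (2, 3), (2, 4), (2, 5), (2, 7), (3, 6), (4, 6), (5, 6),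
    (6, 7)]
  far := []

/-- A square and a pentagon sharing a path of length two. -/
def squaresModel' : LocalModel where
  nbrs := [[1, 5, 2], [0, 4, 6], [0, 3, 8], [2, 4, 9], [1, 5, 3], [0, 4, 7]]
  deg := fun _ => 3
  root := [0, 1, 2, 3]
  edges := [(0, 1), (1, 4), (5, 0), (0, 2), (4, 3), (2, 3), (1, 6), (2, 8), (3, 9)]
  ne := [(0, 2), (0, 3), (0, 6), (0, 8), (0, 9), (1, 2), (1, 3), (1, 4), (1, 8), (1, 9), (2, 3),
    (2, 4), (2, 5), (2, 6), (2, 9), (3, 5), (3, 6), (3, 8), (4, 5), (4, 6), (4, 8), (4, 9), (5, 8),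
    (5, 9), (6, 8), (6, 9), (7, 9)]
  far := []

theorem SimpleGraph.connectedComponentMk_eq_of_adj {V : Type*} {G : SimpleGraph V}
    {c : G.ConnectedComponent} {a b : V} (ha : G.connectedComponentMk a = c)
    (hab : G.Adj a b) : G.connectedComponentMk b = c :=
  (SimpleGraph.ConnectedComponent.sound hab.symm.reachable).trans ha

variable {V : Type*} [Fintype V] [DecidableEq V] {G : SimpleGraph V} [DecidableRel G.Adj]
  {L : Sym2 V → Finset ℕ} {c : G.ConnectedComponent}

variable (hG : ∀ u v, G.Adj u v → G.degree u + G.degree v ≤ 6)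
  (hL : ∀ e ∈ G.edgeSet, 10 ≤ (L e).card)
  (hc : ∀ v, G.connectedComponentMk v = c → G.degree v = 3)

include hG hL hc

theorem componentColorable_of_triangle {x y z : V} (hx : G.connectedComponentMk x = c)
    (hxy : G.Adj x y) (hyz : G.Adj y z) (hxz : G.Adj x z) : ComponentColorable G L x := by
  have K := fun {a b : V} => SimpleGraph.connectedComponentMk_eq_of_adj (G := G) (c := c)
    (a := a) (b := b)
  have hy := K hx hxy
  have hz := K hx hxz
  obtain ⟨x', -, -, nx⟩ := exists_third_neighbor (hc x hx) hxy hxz hyz.ne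
  obtain ⟨y', -, -, ny⟩ := exists_third_neighbor (hc y hy) hxy.symm hyz hxz.ne
  obtain ⟨z', -, -, nz⟩ := exists_third_neighbor (hc z hz) hxz.symm hyz.symm hxy.ne
  have hx' := K hx ((nx x').2 (by simp))
  have hy' := K hy ((ny y').2 (by simp))
  have hz' := K hz ((nz z').2 (by simp))
  have h : triangleModel.Realizes G (fun i => [x, y, z, x', y'].getD i z') := by
    constructor
    · intro i hi
      simp only [triangleModel, List.length_cons, List.length_nil] at hi
      interval_cases i
      · simpa [triangleModel, LocalModel.nb] using nx
      · simpa [triangleModel, LocalModel.nb] using ny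
      · simpa [triangleModel, LocalModel.nb] using nz
    · exact forall_getD (P := fun x => G.degree x = 3) (by simp [*]) (hc _ hz')
    · simp [triangleModel]
    · simp [triangleModel]
    · simp [triangleModel, hxy.ne, hyz.ne, hxz.ne]
  exact h.componentColorable hG hL (r := 0) (D := [0, 1, 2, 3, 4, 5]) (c := -1)
    (by simp [triangleModel]) (by decide +kernel) (by decide) (by decide +kernel)

section Theta

variable {v u x₁ x₂ x₃ y₁ y₂ y₃ : V} (hv : G.connectedComponentMk v = c)
  (nv : ∀ z, G.Adj v z ↔ z = x₁ ∨ z = x₂ ∨ z = x₃)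
  (nu : ∀ z, G.Adj u z ↔ z = x₁ ∨ z = x₂ ∨ z = x₃) (huv : u ≠ v)
  (h12 : x₁ ≠ x₂) (h13 : x₁ ≠ x₃) (h23 : x₂ ≠ x₃)
  (nx₁ : ∀ z, G.Adj x₁ z ↔ z = v ∨ z = u ∨ z = y₁)
  (nx₂ : ∀ z, G.Adj x₂ z ↔ z = v ∨ z = u ∨ z = y₂)
  (nx₃ : ∀ z, G.Adj x₃ z ↔ z = v ∨ z = u ∨ z = y₃)

include hv nv nu huv h12 h13 h23 nx₁ nx₂ nx₃

omit h13 h23 in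
theorem componentColorable_of_theta_of_eq (hy : y₁ = y₂) : ComponentColorable G L v := by
  have K := fun {a b : V} => SimpleGraph.connectedComponentMk_eq_of_adj (G := G) (c := c)
    (a := a) (b := b)
  subst hy
  have hx₁ := K hv ((nv x₁).2 (by simp))
  have hx₂ := K hv ((nv x₂).2 (by simp))
  have hx₃ := K hv ((nv x₃).2 (by simp))
  have hu := K hx₁ ((nx₁ u).2 (by simp))
  have hy₁ := K hx₁ ((nx₁ y₁).2 (by simp))
  have hy₃ := K hx₃ ((nx₃ y₃).2 (by simp))
  obtain ⟨q, -, -, ny⟩ := exists_third_neighbor (hc y₁ hy₁) ((nx₁ y₁).2 (by simp)).symm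
    ((nx₂ y₁).2 (by simp)).symm h12
  have hq := K hy₁ ((ny q).2 (by simp))
  have h : thetaModel.Realizes G (fun i => [v, u, x₁, x₂, y₁, x₃, q].getD i y₃) := by
    constructor
    · intro i hi
      simp only [thetaModel, List.length_cons, List.length_nil] at hi
      interval_cases i
      · simpa [thetaModel, LocalModel.nb] using nv
      · simpa [thetaModel, LocalModel.nb] using nu
      · simpa [thetaModel, LocalModel.nb] using nx₁
      · simpa [thetaModel, LocalModel.nb] using nx₂
      · simpa [thetaModel, LocalModel.nb] using ny
      · simpa [thetaModel, LocalModel.nb] using nx₃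
    · exact forall_getD (P := fun x => G.degree x = 3) (by simp [*]) (hc _ hy₃)
    · simp [thetaModel]
    · simp [thetaModel]
    · simp [thetaModel, huv.symm, ((nv x₁).2 (by simp)).ne, ((nu x₁).2 (by simp)).ne]
  exact h.componentColorable hG hL (r := 0) (D := [0, 6, 4, 1, 5, 2, 3]) (c := -1)
    (by simp [thetaModel]) (by decide +kernel) (by decide) (by decide +kernel)

variable (htri : ∀ a b d, G.connectedComponentMk a = c → G.Adj a b → G.Adj b d → ¬ G.Adj a d)
  (hy12 : y₁ ≠ y₂) (hy13 : y₁ ≠ y₃) (hy23 : y₂ ≠ y₃)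
  (hv₁ : y₁ ≠ v) (hv₂ : y₂ ≠ v) (hv₃ : y₃ ≠ v)
  (hu₁ : y₁ ≠ u) (hu₂ : y₂ ≠ u) (hu₃ : y₃ ≠ u)

include htri hy12 hy13 hy23 hv₁ hv₂ hv₃ hu₁ hu₂ hu₃

theorem componentColorable_of_theta_of_not_adj (h12' : ¬ G.Adj y₁ y₂) (h13' : ¬ G.Adj y₁ y₃)
    (h23' : ¬ G.Adj y₂ y₃) : ComponentColorable G L v := by
  have K := fun {a b : V} => SimpleGraph.connectedComponentMk_eq_of_adj (G := G) (c := c)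
    (a := a) (b := b)
  have vx₁ := (nv x₁).2 (by simp)
  have vx₂ := (nv x₂).2 (by simp)
  have vx₃ := (nv x₃).2 (by simp)
  have ux₁ := (nu x₁).2 (by simp)
  have ux₂ := (nu x₂).2 (by simp)
  have ux₃ := (nu x₃).2 (by simp)
  have hx₁ := K hv vx₁
  have hx₂ := K hv vx₂
  have hx₃ := K hv vx₃
  have hu := K hx₁ ux₁.symm
  have hy₁ := K hx₁ ((nx₁ y₁).2 (by simp))
  have hy₂ := K hx₂ ((nx₂ y₂).2 (by simp))
  have hy₃ := K hx₃ ((nx₃ y₃).2 (by simp))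
  have t12 := htri v x₁ x₂ hv vx₁
  have t13 := htri v x₁ x₃ hv vx₁
  have t23 := htri v x₂ x₃ hv vx₂
  have h : thetaModel'.Realizes G (fun i => [v, u, x₁, x₂, x₃, y₁, y₂].getD i y₃) := by
    constructor
    · intro i hi
      simp only [thetaModel', List.length_cons, List.length_nil] at hi
      interval_cases i
      · simpa [thetaModel', LocalModel.nb] using nv
      · simpa [thetaModel', LocalModel.nb] using nu
      · simpa [thetaModel', LocalModel.nb] using nx₁
      · simpa [thetaModel', LocalModel.nb] using nx₂
      · simpa [thetaModel', LocalModel.nb] using nx₃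
    · exact forall_getD (P := fun x => G.degree x = 3) (by simp [*]) (hc _ hy₃)
    · simp only [thetaModel', List.forall_mem_cons, List.getD_cons_zero, List.getD_cons_succ,
        List.getD_nil]
      and_intros <;> grind
    · simp [thetaModel', *]
    · simp [thetaModel', huv.symm, vx₁.ne, vx₂.ne, vx₃.ne, ux₁.ne, ux₂.ne, ux₃.ne, h12, h13, h23]
  exact h.componentColorable hG hL (r := 0) (D := [3, 7, 5, 6, 2, 4, 3, 1, 2]) (c := 1)
    (by simp [thetaModel']) (by decide +kernel) (by decide) (by decide +kernel)

omit h12 h13 h23 hv₃ hu₃ in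
theorem componentColorable_of_theta_of_adj (h12' : G.Adj y₁ y₂) : ComponentColorable G L v := by
  have K := fun {a b : V} => SimpleGraph.connectedComponentMk_eq_of_adj (G := G) (c := c)
    (a := a) (b := b)
  have vx₁ := (nv x₁).2 (by simp)
  have vx₂ := (nv x₂).2 (by simp)
  have vx₃ := (nv x₃).2 (by simp)
  have ux₁ := (nu x₁).2 (by simp)
  have hx₁ := K hv vx₁
  have hx₂ := K hv vx₂
  have hx₃ := K hv vx₃
  have hu := K hx₁ ux₁.symm
  have xy₁ := (nx₁ y₁).2 (by simp)
  have xy₂ := (nx₂ y₂).2 (by simp)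
  have xy₃ := (nx₃ y₃).2 (by simp)
  have hy₁ := K hx₁ xy₁
  have hy₂ := K hx₂ xy₂
  have hy₃ := K hx₃ xy₃
  have t12 := htri v x₁ x₂ hv vx₁
  have t13 := htri v x₁ x₃ hv vx₁
  have t23 := htri v x₂ x₃ hv vx₂
  obtain ⟨z₁, hz₁, hz₁', ny₁⟩ := exists_third_neighbor (hc y₁ hy₁) xy₁.symm h12' (by grind)
  obtain ⟨z₂, hz₂, hz₂', ny₂⟩ := exists_third_neighbor (hc y₂ hy₂) xy₂.symm h12'.symm (by grind)
  have hz := K hy₁ ((ny₁ z₁).2 (by simp))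
  have hz' := K hy₂ ((ny₂ z₂).2 (by simp))
  have yz := (ny₁ z₁).2 (by simp)
  have h : thetaModel''.Realizes G
      (fun i => [v, u, y₁, x₁, x₂, x₃, y₂, z₁, y₃].getD i z₂) := by
    constructor
    · intro i hi
      simp only [thetaModel'', List.length_cons, List.length_nil] at hi
      interval_cases i
      · simpa [thetaModel'', LocalModel.nb] using nv
      · simpa [thetaModel'', LocalModel.nb] using nu
      · simpa [thetaModel'', LocalModel.nb] using ny₁
      · simpa [thetaModel'', LocalModel.nb] using nx₁
      · simpa [thetaModel'', LocalModel.nb] using nx₂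
      · simpa [thetaModel'', LocalModel.nb] using nx₃
      · simpa [thetaModel'', LocalModel.nb] using ny₂
    · exact forall_getD (P := fun x => G.degree x = 3) (by simp [*]) (hc _ hz')
    · simp only [thetaModel'', List.forall_mem_cons, List.getD_cons_zero, List.getD_cons_succ]
      have yz' := yz.symm
      have xy₁' := xy₁.symm
      have xy₂' := xy₂.symm
      have xy₃' := xy₃.symm
      and_intros <;> grind
    · simp [thetaModel'']
    · simp [thetaModel'', huv.symm, hv₁.symm, hu₁.symm]
  exact h.componentColorable hG hL (r := 0) (D := [5, 1, 2, 6, 5, 5, 4, 3, 1]) (c := -1)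
    (by simp [thetaModel'']) (by decide +kernel) (by decide) (by decide +kernel)

end Theta

end ShortCycles

section Square

variable {V : Type*} [Fintype V] [DecidableEq V] {G : SimpleGraph V} [DecidableRel G.Adj]
  {L : Sym2 V → Finset ℕ} {c : G.ConnectedComponent}
  (hG : ∀ u v, G.Adj u v → G.degree u + G.degree v ≤ 6)
  (hL : ∀ e ∈ G.edgeSet, 10 ≤ (L e).card)
  (hc : ∀ v, G.connectedComponentMk v = c → G.degree v = 3)
  (htri : ∀ a b d, G.connectedComponentMk a = c → G.Adj a b → G.Adj b d → ¬ G.Adj a d)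

include hG hL hc htri

theorem componentColorable_of_theta {v u x₁ x₂ x₃ : V} (hv : G.connectedComponentMk v = c)
    (nv : ∀ z, G.Adj v z ↔ z = x₁ ∨ z = x₂ ∨ z = x₃)
    (nu : ∀ z, G.Adj u z ↔ z = x₁ ∨ z = x₂ ∨ z = x₃) (huv : u ≠ v)
    (h12 : x₁ ≠ x₂) (h13 : x₁ ≠ x₃) (h23 : x₂ ≠ x₃) : ComponentColorable G L v := by
  have hx : ∀ x, G.Adj v x → G.Adj u x →
      ∃ y, y ≠ v ∧ y ≠ u ∧ ∀ z, G.Adj x z ↔ z = v ∨ z = u ∨ z = y := fun x hvx hux =>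
    exists_third_neighbor (hc x (SimpleGraph.connectedComponentMk_eq_of_adj hv hvx))
      hvx.symm hux.symm huv.symm
  obtain ⟨y₁, hv₁, hu₁, nx₁⟩ := hx x₁ (by simp [nv]) (by simp [nu])
  obtain ⟨y₂, hv₂, hu₂, nx₂⟩ := hx x₂ (by simp [nv]) (by simp [nu])
  obtain ⟨y₃, hv₃, hu₃, nx₃⟩ := hx x₃ (by simp [nv]) (by simp [nu])
  have nv' : ∀ z, G.Adj v z ↔ z = x₁ ∨ z = x₃ ∨ z = x₂ := fun z => by rw [nv]; tauto
  have nu' : ∀ z, G.Adj u z ↔ z = x₁ ∨ z = x₃ ∨ z = x₂ := fun z => by rw [nu]; tauto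
  have nv'' : ∀ z, G.Adj v z ↔ z = x₂ ∨ z = x₃ ∨ z = x₁ := fun z => by rw [nv]; tauto
  have nu'' : ∀ z, G.Adj u z ↔ z = x₂ ∨ z = x₃ ∨ z = x₁ := fun z => by rw [nu]; tauto
  by_cases e12 : y₁ = y₂
  · exact componentColorable_of_theta_of_eq hG hL hc hv nv nu huv h12 nx₁ nx₂ nx₃ e12
  by_cases e13 : y₁ = y₃
  · exact componentColorable_of_theta_of_eq hG hL hc hv nv' nu' huv h13 nx₁ nx₃ nx₂ e13
  by_cases e23 : y₂ = y₃
  · exact componentColorable_of_theta_of_eq hG hL hc hv nv'' nu'' huv h23 nx₂ nx₃ nx₁ e23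
  by_cases a12 : G.Adj y₁ y₂
  · exact componentColorable_of_theta_of_adj hG hL hc hv nv nu huv nx₁ nx₂ nx₃ htri
      e12 e13 e23 hv₁ hv₂ hu₁ hu₂ a12
  by_cases a13 : G.Adj y₁ y₃
  · exact componentColorable_of_theta_of_adj hG hL hc hv nv' nu' huv nx₁ nx₃ nx₂
      htri e13 e12 (Ne.symm e23) hv₁ hv₃ hu₁ hu₃ a13
  by_cases a23 : G.Adj y₂ y₃
  · exact componentColorable_of_theta_of_adj hG hL hc hv nv'' nu'' huv nx₂ nx₃
      nx₁ htri e23 (Ne.symm e12) (Ne.symm e13) hv₂ hv₃ hu₂ hu₃ a23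
  exact componentColorable_of_theta_of_not_adj hG hL hc hv nv nu huv h12 h13 h23 nx₁ nx₂ nx₃ htri
    e12 e13 e23 hv₁ hv₂ hv₃ hu₁ hu₂ hu₃ a12 a13 a23

section Adjacent

variable {v₁ v₂ v₃ v₄ w₁ w₂ w₃ w₄ x₁ x₃ : V} (hv₁ : G.connectedComponentMk v₁ = c)
  (h13 : v₁ ≠ v₃) (h24 : v₂ ≠ v₄)
  (n₁ : ∀ z, G.Adj v₁ z ↔ z = v₂ ∨ z = v₄ ∨ z = w₁)
  (n₂ : ∀ z, G.Adj v₂ z ↔ z = v₁ ∨ z = v₃ ∨ z = w₂)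
  (n₃ : ∀ z, G.Adj v₃ z ↔ z = v₂ ∨ z = v₄ ∨ z = w₃)
  (n₄ : ∀ z, G.Adj v₄ z ↔ z = v₁ ∨ z = v₃ ∨ z = w₄)
  (hw₁ : w₁ ≠ v₂) (hw₁' : w₁ ≠ v₄) (hw₂ : w₂ ≠ v₁) (hw₂' : w₂ ≠ v₃)
  (hw₃ : w₃ ≠ v₂) (hw₃' : w₃ ≠ v₄) (hw₄ : w₄ ≠ v₁) (hw₄' : w₄ ≠ v₃)
  (hw24 : w₂ ≠ w₄)
  (nw₁ : ∀ z, G.Adj w₁ z ↔ z = v₁ ∨ z = w₃ ∨ z = x₁)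
  (nw₃ : ∀ z, G.Adj w₃ z ↔ z = v₃ ∨ z = w₁ ∨ z = x₃)
  (hx₁ : x₁ ≠ v₁) (hx₁' : x₁ ≠ w₃) (hx₃ : x₃ ≠ v₃) (hx₃' : x₃ ≠ w₁)

include hv₁ h13 h24 n₁ n₂ n₃ n₄ hw₁ hw₁' hw₂ hw₂' hw₃ hw₃' hw₄ hw₄' hw24 nw₁ nw₃ hx₁ hx₁' hx₃ hx₃'

omit h13 h24 hw₃ hw₃' hw₄ hw₄' hx₃ hx₃' in
theorem componentColorable_of_squares_of_eq (hx : w₂ = x₁) :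
    ComponentColorable G L v₂ := by
  have K := fun {a b : V} => SimpleGraph.connectedComponentMk_eq_of_adj (G := G) (c := c)
    (a := a) (b := b)
  subst hx
  have a12 := (n₁ v₂).2 (by simp)
  have a14 := (n₁ v₄).2 (by simp)
  have a23 := (n₂ v₃).2 (by simp)
  have a34 := (n₃ v₄).2 (by simp)
  have b₁ := (n₁ w₁).2 (by simp)
  have b₂ := (n₂ w₂).2 (by simp)
  have b₃ := (n₃ w₃).2 (by simp)
  have b₄ := (n₄ w₄).2 (by simp)
  have hv₂ := K hv₁ a12
  have hv₃ := K hv₂ a23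
  have hv₄ := K hv₁ a14
  have hw₁ := K hv₁ b₁
  have hw₂ := K hv₂ b₂
  have hw₃ := K hv₃ b₃
  have hw₄ := K hv₄ b₄
  have b13 := (nw₁ w₃).2 (by simp)
  have b12 := (nw₁ w₂).2 (by simp)
  have t₁ := htri v₁ v₂ w₁ hv₁ a12
  have t₂ := htri v₁ v₂ v₃ hv₁ a12 a23
  have t₃ := htri v₁ v₄ w₁ hv₁ a14
  have t₄ := htri v₂ v₃ w₂ hv₂ a23
  have t₅ := htri w₁ w₃ w₂ hw₁ b13
  have c₃ := K hw₃ ((nw₃ x₃).2 (by simp))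
  obtain ⟨z, -, -, nw₂⟩ := exists_third_neighbor (hc w₂ hw₂) b₂.symm b12.symm (by grind)
  have hz := K hw₂ ((nw₂ z).2 (by simp))
  have h : squaresModel.Realizes G
      (fun i => [v₂, v₃, w₁, v₁, v₄, w₃, w₂, w₄, x₃].getD i z) := by
    constructor
    · intro i hi
      simp only [squaresModel, List.length_cons, List.length_nil] at hi
      interval_cases i
      · simpa [squaresModel, LocalModel.nb] using n₂
      · simpa [squaresModel, LocalModel.nb] using n₃
      · simpa [squaresModel, LocalModel.nb] using nw₁
      · simpa [squaresModel, LocalModel.nb] using n₁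
      · simpa [squaresModel, LocalModel.nb, or_left_comm] using n₄
      · simpa [squaresModel, LocalModel.nb] using nw₃
      · simpa [squaresModel, LocalModel.nb] using nw₂
    · exact forall_getD (P := fun x => G.degree x = 3) (by simp [*]) (hc _ hz)
    · simp only [squaresModel, List.forall_mem_cons, List.getD_cons_zero, List.getD_cons_succ]
      and_intros <;> grind
    · simp [squaresModel]
    · simp [squaresModel]
      grind
  exact h.componentColorable hG hL (r := 0) (D := [6, 2, 3, 5, 3, 1, 4, 3]) (c := -1)
    (by simp [squaresModel]) (by decide +kernel) (by decide) (by decide +kernel)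

omit h13 h24 hw₄ hw₄' hw24 in
theorem componentColorable_of_squares_of_ne (h₂₁ : w₂ ≠ x₁) (h₂₃ : w₂ ≠ x₃) (h₄₃ : w₄ ≠ x₃) :
    ComponentColorable G L v₁ := by
  have K := fun {a b : V} => SimpleGraph.connectedComponentMk_eq_of_adj (G := G) (c := c)
    (a := a) (b := b)
  have a12 := (n₁ v₂).2 (by simp)
  have a14 := (n₁ v₄).2 (by simp)
  have a23 := (n₂ v₃).2 (by simp)
  have a34 := (n₃ v₄).2 (by simp)
  have b₁ := (n₁ w₁).2 (by simp)
  have b₂ := (n₂ w₂).2 (by simp)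
  have b₃ := (n₃ w₃).2 (by simp)
  have b₄ := (n₄ w₄).2 (by simp)
  have hv₂ := K hv₁ a12
  have hv₃ := K hv₂ a23
  have hv₄ := K hv₁ a14
  have hw₁ := K hv₁ b₁
  have hw₂ := K hv₂ b₂
  have hw₃ := K hv₃ b₃
  have hw₄ := K hv₄ b₄
  have b13 := (nw₁ w₃).2 (by simp)
  have d₁ := (nw₁ x₁).2 (by simp)
  have d₃ := (nw₃ x₃).2 (by simp)
  have c₁ := K hw₁ d₁
  have c₃ := K hw₃ d₃
  have t₁ := htri v₁ v₂ w₁ hv₁ a12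
  have t₂ := htri v₁ v₂ v₃ hv₁ a12 a23
  have t₃ := htri v₁ v₄ w₁ hv₁ a14
  have t₄ := htri v₂ v₃ w₂ hv₂ a23
  have t₅ := htri v₃ v₄ w₃ hv₃ a34
  have t₆ := htri w₁ w₃ x₁ hw₁ b13
  have s₁ := d₁.symm
  have s₃ := d₃.symm
  have h : squaresModel'.Realizes G
      (fun i => [v₁, v₂, w₁, w₃, v₃, v₄, w₂, w₄, x₁].getD i x₃) := by
    constructor
    · intro i hi
      simp only [squaresModel', List.length_cons, List.length_nil] at hi
      interval_cases i
      · simpa [squaresModel', LocalModel.nb] using n₁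
      · simpa [squaresModel', LocalModel.nb] using n₂
      · simpa [squaresModel', LocalModel.nb] using nw₁
      · simpa [squaresModel', LocalModel.nb, or_left_comm] using nw₃
      · simpa [squaresModel', LocalModel.nb] using n₃
      · simpa [squaresModel', LocalModel.nb] using n₄
    · exact forall_getD (P := fun x => G.degree x = 3) (by simp [*]) (hc _ c₃)
    · simp only [squaresModel', List.forall_mem_cons, List.getD_cons_zero, List.getD_cons_succ,
        List.getD_nil]
      and_intros <;> grind
    · simp [squaresModel']
    · simp [squaresModel']
      grind
  exact h.componentColorable hG hL (r := 0) (D := [3, 5, 5, 5, 3, 4, 2, 3, 2]) (c := 2)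
    (by simp [squaresModel']) (by decide +kernel) (by decide) (by decide +kernel)

end Adjacent

theorem exists_componentColorable_of_squares {v₁ v₂ v₃ v₄ w₁ w₂ w₃ w₄ : V}
    (hv₁ : G.connectedComponentMk v₁ = c)
    (n₁ : ∀ z, G.Adj v₁ z ↔ z = v₂ ∨ z = v₄ ∨ z = w₁)
    (n₂ : ∀ z, G.Adj v₂ z ↔ z = v₁ ∨ z = v₃ ∨ z = w₂)
    (n₃ : ∀ z, G.Adj v₃ z ↔ z = v₂ ∨ z = v₄ ∨ z = w₃)
    (n₄ : ∀ z, G.Adj v₄ z ↔ z = v₁ ∨ z = v₃ ∨ z = w₄)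
    (hw₁ : w₁ ≠ v₂) (hw₁' : w₁ ≠ v₄) (hw₂ : w₂ ≠ v₁) (hw₂' : w₂ ≠ v₃)
    (hw₃ : w₃ ≠ v₂) (hw₃' : w₃ ≠ v₄) (hw₄ : w₄ ≠ v₁) (hw₄' : w₄ ≠ v₃)
    (hw24 : w₂ ≠ w₄) (hw13 : G.Adj w₁ w₃) :
    ∃ r, G.connectedComponentMk r = c ∧ ComponentColorable G L r := by
  have K := fun {a b : V} => SimpleGraph.connectedComponentMk_eq_of_adj (G := G) (c := c)
    (a := a) (b := b)
  have hv₂ := K hv₁ ((n₁ v₂).2 (by simp))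
  have hv₃ := K hv₂ ((n₂ v₃).2 (by simp))
  have hv₄ := K hv₁ ((n₁ v₄).2 (by simp))
  have b₁ := (n₁ w₁).2 (by simp)
  have b₃ := (n₃ w₃).2 (by simp)
  have e₁ : v₁ ≠ w₃ := by grind
  have e₃ : v₃ ≠ w₁ := by grind
  obtain ⟨x₁, hx₁, hx₁', nw₁⟩ := exists_third_neighbor (hc w₁ (K hv₁ b₁)) b₁.symm hw13 e₁
  obtain ⟨x₃, hx₃, hx₃', nw₃⟩ := exists_third_neighbor (hc w₃ (K hv₃ b₃)) b₃.symm hw13.symm e₃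
  have n₁' : ∀ z, G.Adj v₁ z ↔ z = v₄ ∨ z = v₂ ∨ z = w₁ := fun z => by rw [n₁]; tauto
  have n₂' : ∀ z, G.Adj v₂ z ↔ z = v₃ ∨ z = v₁ ∨ z = w₂ := fun z => by rw [n₂]; tauto
  have n₃' : ∀ z, G.Adj v₃ z ↔ z = v₄ ∨ z = v₂ ∨ z = w₃ := fun z => by rw [n₃]; tauto
  have n₄' : ∀ z, G.Adj v₄ z ↔ z = v₃ ∨ z = v₁ ∨ z = w₄ := fun z => by rw [n₄]; tauto
  by_cases h₂₁ : w₂ = x₁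
  · exact ⟨v₂, hv₂, componentColorable_of_squares_of_eq hG hL hc htri hv₁ n₁ n₂ n₃ n₄ hw₁ hw₁' hw₂
      hw₂' hw24 nw₁ nw₃ hx₁ hx₁' h₂₁⟩
  by_cases h₂₃ : w₂ = x₃
  · exact ⟨v₂, hv₂, componentColorable_of_squares_of_eq hG hL hc htri hv₃ n₃ n₂' n₁ n₄' hw₃ hw₃'
      hw₂' hw₂ hw24 nw₃ nw₁ hx₃ hx₃' h₂₃⟩
  by_cases h₄₃ : w₄ = x₃
  · exact ⟨v₄, hv₄, componentColorable_of_squares_of_eq hG hL hc htri hv₃ n₃' n₄' n₁' n₂' hw₃' hw₃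
      hw₄' hw₄ hw24.symm nw₃ nw₁ hx₃ hx₃' h₄₃⟩
  exact ⟨v₁, hv₁, componentColorable_of_squares_of_ne hG hL hc htri hv₁ n₁ n₂ n₃ n₄ hw₁ hw₁' hw₂
    hw₂' hw₃ hw₃' nw₁ nw₃ hx₁ hx₁' hx₃ hx₃' h₂₁ h₂₃ h₄₃⟩

theorem exists_componentColorable_of_square {v₁ v₂ v₃ v₄ : V}
    (hv₁ : G.connectedComponentMk v₁ = c) (h13 : v₁ ≠ v₃) (h24 : v₂ ≠ v₄) (a12 : G.Adj v₁ v₂)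
    (a23 : G.Adj v₂ v₃) (a34 : G.Adj v₃ v₄) (a41 : G.Adj v₄ v₁) :
    ∃ r, G.connectedComponentMk r = c ∧ ComponentColorable G L r := by
  have K := fun {a b : V} => SimpleGraph.connectedComponentMk_eq_of_adj (G := G) (c := c)
    (a := a) (b := b)
  have hv₂ := K hv₁ a12
  have hv₃ := K hv₂ a23
  have hv₄ := K hv₃ a34
  obtain ⟨w₁, hw₁, hw₁', n₁⟩ := exists_third_neighbor (hc v₁ hv₁) a12 a41.symm h24
  obtain ⟨w₂, hw₂, hw₂', n₂⟩ := exists_third_neighbor (hc v₂ hv₂) a12.symm a23 h13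
  obtain ⟨w₃, hw₃, hw₃', n₃⟩ := exists_third_neighbor (hc v₃ hv₃) a23.symm a34 h24
  obtain ⟨w₄, hw₄, hw₄', n₄⟩ := exists_third_neighbor (hc v₄ hv₄) a41 a34.symm h13
  by_cases e13 : w₁ = w₃
  · subst e13
    exact ⟨v₁, hv₁, componentColorable_of_theta hG hL hc htri hv₁ n₁ n₃ h13.symm h24 hw₁.symm
      hw₁'.symm⟩
  by_cases e24 : w₂ = w₄
  · subst e24
    exact ⟨v₂, hv₂, componentColorable_of_theta hG hL hc htri hv₂ n₂ n₄ h24.symm h13 hw₂.symm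
      hw₂'.symm⟩
  by_cases b13 : G.Adj w₁ w₃
  · exact exists_componentColorable_of_squares hG hL hc htri hv₁ n₁ n₂ n₃ n₄ hw₁
      hw₁' hw₂ hw₂' hw₃ hw₃' hw₄ hw₄' e24 b13
  have n₁' : ∀ z, G.Adj v₁ z ↔ z = v₄ ∨ z = v₂ ∨ z = w₁ := fun z => by rw [n₁]; tauto
  have n₄' : ∀ z, G.Adj v₄ z ↔ z = v₃ ∨ z = v₁ ∨ z = w₄ := fun z => by rw [n₄]; tauto
  by_cases b24 : G.Adj w₂ w₄
  · exact exists_componentColorable_of_squares hG hL hc htri hv₂ n₂ n₁ n₄ n₃ hw₂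
      hw₂' hw₁ hw₁' hw₄ hw₄' hw₃ hw₃' e13 b24
  have t₁ := htri v₁ v₂ w₁ hv₁ a12
  have t₂ := htri v₂ v₃ w₂ hv₂ a23
  have t₃ := htri v₃ v₄ w₃ hv₃ a34
  have t₄ := htri v₄ v₁ w₄ hv₄ a41
  have h : IsPendantCycle G 4 (fun i => [v₁, v₂, v₃].getD i v₄)
      (fun i => [w₁, w₂, w₃].getD i w₄) := by
    constructor
    · exact le_rfl
    · intro i hi
      interval_cases i
      exacts [n₁', n₂, n₃, n₄']
    · exact fun i _ => forall_getD (P := fun x => G.degree x = 3)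
        (by simp [hc _ (K hv₁ ((n₁ w₁).2 (by simp))), hc _ (K hv₂ ((n₂ w₂).2 (by simp))),
          hc _ (K hv₃ ((n₃ w₃).2 (by simp)))]) (hc _ (K hv₄ ((n₄ w₄).2 (by simp)))) i
    · intro i hi j hj
      have := a12.ne
      have := a23.ne
      have := a34.ne
      have := a41.ne
      interval_cases i <;> interval_cases j <;> simp <;> grind
    · intro i hi j hj
      interval_cases i <;> interval_cases j <;> simp <;> grind
    · intro i hi j hj
      interval_cases i <;> interval_cases j <;> simp <;> grind
  exact ⟨v₁, hv₁, h.componentColorable_four hG hL b13 b24⟩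

end Square

section Girth

variable {V : Type*} {G : SimpleGraph V}

/-- `u 0, …, u m` is a walk that never reverses direction. -/
structure IsNonbacktracking (G : SimpleGraph V) (m : ℕ) (u : ℕ → V) : Prop where
  adj : ∀ i < m, G.Adj (u i) (u (i + 1))
  ne : ∀ i, i + 1 < m → u i ≠ u (i + 2)

namespace IsNonbacktracking

variable {m : ℕ} {u : ℕ → V} (h : IsNonbacktracking G m u)

include h

theorem shift {i n : ℕ} (hi : i + n ≤ m) : IsNonbacktracking G n (fun t => u (i + t)) :=
  ⟨fun t ht => h.adj (i + t) (by omega), fun t ht => h.ne (i + t) (by omega)⟩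

theorem cons {x : V} (hx : G.Adj x (u 0)) (hne : 0 < m → x ≠ u 1) :
    IsNonbacktracking G (m + 1) (fun t => t.casesOn x u) := by
  constructor
  · rintro (_ | i) hi
    · exact hx
    · exact h.adj i (by omega)
  · rintro (_ | i) hi
    · exact hne (by omega)
    · exact h.ne i (by omega)

theorem snoc {x : V} (hx : G.Adj (u m) x) (hne : ∀ i, i + 1 = m → u i ≠ x) :
    IsNonbacktracking G (m + 1) (fun t => if t ≤ m then u t else x) := by
  constructor
  · intro i hi
    rcases (Nat.le_of_lt_succ hi).eq_or_lt with rfl | hi'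
    · simpa using hx
    · simpa [hi'.le, Nat.succ_le_of_lt hi'] using h.adj i hi'
  · intro i hi
    rcases (Nat.le_of_lt_succ hi).eq_or_lt with rfl | hi'
    · simpa using hne i rfl
    · simpa [show i ≤ m by omega, show i + 2 ≤ m by omega] using h.ne i hi'

end IsNonbacktracking

/-- `v` runs around a cycle of length `k` in `c`, there is no shorter cycle, and `w i` is a
neighbour of `v i` off the cycle. -/
structure IsGirthCycle (G : SimpleGraph V) (c : G.ConnectedComponent) (k : ℕ) (v w : ℕ → V) :
    Prop where
  adj : ∀ i, G.Adj (v i) (v (i + 1))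
  ne : ∀ i, v i ≠ v (i + 2)
  add_left : ∀ i, v (i + k) = v i
  mem : ∀ i, G.connectedComponentMk (v i) = c
  adj' : ∀ i, G.Adj (v i) (w i)
  ne_next : ∀ i, w i ≠ v (i + 1)
  ne_prev : ∀ i, v i ≠ w (i + 1)
  add_left' : ∀ i, w (i + k) = w i
  min : ∀ m u, IsNonbacktracking G m u → G.connectedComponentMk (u 0) = c → 0 < m → m < k →
    u 0 ≠ u m

namespace IsGirthCycle

variable {c : G.ConnectedComponent} {k : ℕ} {v w : ℕ → V} (h : IsGirthCycle G c k v w)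

include h

theorem shift (s : ℕ) : IsGirthCycle G c k (fun i => v (i + s)) (fun i => w (i + s)) where
  adj i := by simpa [Nat.add_right_comm] using h.adj (i + s)
  ne i := by simpa [Nat.add_right_comm] using h.ne (i + s)
  add_left i := by simpa [Nat.add_right_comm] using h.add_left (i + s)
  mem i := h.mem _
  adj' i := h.adj' _
  ne_next i := by simpa [Nat.add_right_comm] using h.ne_next (i + s)
  ne_prev i := by simpa [Nat.add_right_comm] using h.ne_prev (i + s)
  add_left' i := by simpa [Nat.add_right_comm] using h.add_left' (i + s)
  min := h.min

theorem isNonbacktracking (i m : ℕ) : IsNonbacktracking G m (fun t => v (i + t)) :=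
  ⟨fun t _ => h.adj (i + t), fun t _ => h.ne (i + t)⟩

theorem isNonbacktracking_cons (i m : ℕ) :
    IsNonbacktracking G (m + 1) (fun t => t.casesOn (w i) fun t => v (i + t)) :=
  (h.isNonbacktracking i m).cons (h.adj' i).symm fun _ => h.ne_next i

theorem ne_of_isNonbacktracking_of_adj {m : ℕ} {u : ℕ → V} (hu : IsNonbacktracking G m u)
    (h0 : G.connectedComponentMk (u 0) = c) (hm : 2 ≤ m) (hmk : m + 1 < k) :
    ¬ G.Adj (u m) (u 0) := by
  intro hadj
  refine h.min _ _ (hu.snoc hadj fun i hi => ?_) (by simpa using h0) (by omega) hmk (by simp)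
  simpa using (h.min _ _ (hu.shift (i := 0) (n := i) (by omega)) h0 (by omega) (by omega)).symm

theorem apply_ne {i m : ℕ} (hm : 0 < m) (hmk : m < k) : v i ≠ v (i + m) :=
  h.min _ _ (h.isNonbacktracking i m) (h.mem _) hm hmk

theorem apply_ne_left {i m : ℕ} (hmk : m + 1 < k) : w i ≠ v (i + m) :=
  h.min _ _ (h.isNonbacktracking_cons i m)
    (SimpleGraph.connectedComponentMk_eq_of_adj (h.mem i) (h.adj' i)) (by omega) hmk

theorem apply_ne_right {i m : ℕ} (hmk : m + 1 < k) : v i ≠ w (i + m) := by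
  have := (h.isNonbacktracking i m).snoc (h.adj' _) fun t ht => by
    subst ht
    exact h.ne_prev (i + t)
  simpa using h.min _ _ this (h.mem _) (by omega) hmk

theorem isNonbacktracking_cons_snoc (i : ℕ) {m : ℕ} (hm : 0 < m) :
    IsNonbacktracking G (m + 2) (fun t => if t ≤ m + 1 then
      t.casesOn (w i) fun t => v (i + t) else w (i + m)) := by
  refine (h.isNonbacktracking_cons i m).snoc (h.adj' _) ?_
  rintro (_ | t) ht
  · omega
  · obtain rfl : t + 1 = m := by omega
    exact h.ne_prev (i + t)

theorem pendant_ne {i m : ℕ} (hm : 0 < m) (hmk : m + 2 < k) : w i ≠ w (i + m) := by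
  simpa using h.min _ _ (h.isNonbacktracking_cons_snoc i hm)
    (SimpleGraph.connectedComponentMk_eq_of_adj (h.mem i) (h.adj' i)) (by omega) hmk

theorem not_pendant_adj {i m : ℕ} (hm : 0 < m) (hmk : m + 3 < k) : ¬ G.Adj (w i) (w (i + m)) := by
  intro hadj
  refine h.ne_of_isNonbacktracking_of_adj (h.isNonbacktracking_cons_snoc i hm)
    (SimpleGraph.connectedComponentMk_eq_of_adj (h.mem i) (h.adj' i)) (by omega) hmk ?_
  simpa using hadj.symm

theorem apply_ne_of_lt {i j : ℕ} (hij : i < j) (hj : j < k) : v i ≠ v j := by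
  obtain ⟨m, rfl⟩ := Nat.exists_eq_add_of_le hij.le
  exact h.apply_ne (by omega) (by omega)

theorem apply_ne_pendant (hk : 4 ≤ k) {i j : ℕ} (hi : i < k) (hj : j < k) : v i ≠ w j := by
  rcases lt_trichotomy i j with hij | rfl | hij
  · obtain ⟨m, rfl⟩ := Nat.exists_eq_add_of_le hij.le
    by_cases hm : m + 1 < k
    · exact h.apply_ne_right hm
    · have := h.apply_ne_left (i := i + m) (m := k - m) (by omega)
      rw [show i + m + (k - m) = i + k by omega, h.add_left] at this
      exact this.symm
  · exact (h.adj' i).ne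
  · obtain ⟨m, rfl⟩ := Nat.exists_eq_add_of_le hij.le
    by_cases hm : m + 1 < k
    · exact (h.apply_ne_left hm).symm
    · have := h.apply_ne_right (i := j + m) (m := k - m) (by omega)
      rwa [show j + m + (k - m) = j + k by omega, h.add_left'] at this

theorem pendant_ne_of_lt (hk : 5 ≤ k) {i j : ℕ} (hij : i < j) (hj : j < k) : w i ≠ w j := by
  obtain ⟨m, rfl⟩ := Nat.exists_eq_add_of_le hij.le
  by_cases hm : m + 2 < k
  · exact h.pendant_ne (by omega) hm
  · have := h.pendant_ne (i := i + m) (m := k - m) (by omega) (by omega)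
    rw [show i + m + (k - m) = i + k by omega, h.add_left'] at this
    exact this.symm

theorem not_pendant_adj_of_lt {i j : ℕ} (hij : i < j) (hj : j < k) (h' : j + 3 < i + k ∨ i + 3 < j) :
    ¬ G.Adj (w i) (w j) := by
  obtain ⟨m, rfl⟩ := Nat.exists_eq_add_of_le hij.le
  rcases h' with h' | h'
  · exact h.not_pendant_adj (by omega) (by omega)
  · have := h.not_pendant_adj (i := i + m) (m := k - m) (by omega) (by omega)
    rw [show i + m + (k - m) = i + k by omega, h.add_left'] at this
    exact fun hadj => this hadj.symm

end IsGirthCycle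

end Girth

section Cubic

variable {V : Type*} [Fintype V] [DecidableEq V] {G : SimpleGraph V} [DecidableRel G.Adj]
  {L : Sym2 V → Finset ℕ} {c : G.ConnectedComponent}

theorem exists_closed_nonbacktracking (hc : ∀ v, G.connectedComponentMk v = c → G.degree v = 3) :
    ∃ m u, 0 < m ∧ IsNonbacktracking G m u ∧ G.connectedComponentMk (u 0) = c ∧ u 0 = u m := by
  obtain ⟨r, hr⟩ := c.exists_rep
  have K := fun {a b : V} => SimpleGraph.connectedComponentMk_eq_of_adj (G := G) (c := c)
    (a := a) (b := b)
  have hnext : ∀ d : {d : G.Dart // G.connectedComponentMk d.fst = c},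
      ∃ e : {d : G.Dart // G.connectedComponentMk d.fst = c},
        e.1.fst = d.1.snd ∧ e.1.snd ≠ d.1.fst := by
    rintro ⟨⟨⟨a, b⟩, hab⟩, ha⟩
    have hb := K ha hab
    obtain ⟨m, hm, hn, hx⟩ := exists_neighbors_append (G := G) (v := b) (l := [a]) (k := 2)
      (by simp) (by simpa using hab.symm) (hc b hb)
    obtain ⟨x, y, rfl⟩ := List.length_eq_two.1 hm
    have hbx : G.Adj b x := (hx x).2 (by simp)
    simp only [List.cons_append, List.nil_append, List.nodup_cons, List.mem_cons,
      List.not_mem_nil, or_false, not_or] at hn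
    exact ⟨⟨⟨⟨b, x⟩, hbx⟩, hb⟩, rfl, Ne.symm hn.1.1⟩
  choose next hfst hsnd using hnext
  obtain ⟨a, ha⟩ := exists_neighbor_of_degree_pos (G := G) (v := r) (by rw [hc r hr]; omega)
  set D : ℕ → {d : G.Dart // G.connectedComponentMk d.fst = c} :=
    fun n => next^[n] ⟨⟨⟨r, a⟩, ha⟩, hr⟩ with hD
  have hstep : ∀ n, D (n + 1) = next (D n) := fun n => Function.iterate_succ_apply' _ _ _
  have hnb : ∀ m, IsNonbacktracking G m (fun n => (D n).1.fst) := fun m => by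
    constructor
    · intro i _
      simp only [hstep, hfst]
      exact (D i).1.adj
    · intro i _
      simp only [hstep, hfst]
      exact (hsnd _).symm
  obtain ⟨i, j, hij, heq⟩ := Finite.exists_ne_map_eq_of_infinite fun n => (D n).1.fst
  wlog hlt : i < j generalizing i j
  · exact this j i hij.symm heq.symm (by omega)
  obtain ⟨m, rfl⟩ := Nat.exists_eq_add_of_le hlt.le
  exact ⟨m, _, by omega, (hnb (i + m)).shift le_rfl, (D _).2, heq⟩

theorem exists_isGirthCycle (hc : ∀ v, G.connectedComponentMk v = c → G.degree v = 3) :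
    ∃ k v w, 3 ≤ k ∧ IsGirthCycle G c k v w := by
  classical
  have hex := exists_closed_nonbacktracking hc
  obtain ⟨u, hk0, hu, hu0, huk⟩ := Nat.find_spec hex
  have hmin : ∀ m u, IsNonbacktracking G m u → G.connectedComponentMk (u 0) = c → 0 < m →
      m < Nat.find hex → u 0 ≠ u m :=
    fun m u h1 h2 h3 h4 h5 => Nat.find_min hex h4 ⟨u, h3, h1, h2, h5⟩
  generalize Nat.find hex = k at *
  have hk1 : k ≠ 1 := by
    rintro rfl
    exact (hu.adj 0 (by omega)).ne huk
  have hk2 : k ≠ 2 := by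
    rintro rfl
    exact hu.ne 0 (by omega) huk
  have hcorner : u (k - 1) ≠ u 1 := fun h => by
    refine hmin (k - 2) _ (hu.shift (i := 1) (by omega))
      (SimpleGraph.connectedComponentMk_eq_of_adj hu0 (hu.adj 0 hk0)) (by omega) (by omega) ?_
    simp only [Nat.add_zero]
    rw [← h]
    congr 1
    omega
  have hadj : ∀ i, G.Adj (u (i % k)) (u ((i + 1) % k)) := fun i => by
    have hi := Nat.mod_lt i hk0
    have := hu.adj _ hi
    rw [← Nat.mod_add_mod]
    rcases add_one_mod hi with ⟨h1, h2⟩ | ⟨h1, h2⟩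
    · rw [h2, huk, ← h1]
      rwa [h1] at this ⊢
    · rwa [h2]
  have hne : ∀ i, u (i % k) ≠ u ((i + 2) % k) := fun i => by
    have hi := Nat.mod_lt i hk0
    rw [← Nat.mod_add_mod]
    generalize i % k = j at hi
    rcases lt_trichotomy (j + 2) k with h | h | h
    · rw [Nat.mod_eq_of_lt h]
      exact hu.ne j (by omega)
    · rw [h, Nat.mod_self, huk, ← h]
      exact hu.ne j (by omega)
    · obtain rfl : j = k - 1 := by omega
      rwa [show k - 1 + 2 = 1 + k by omega, Nat.add_mod_right, Nat.mod_eq_of_lt (by omega)]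
  have hmem : ∀ i, G.connectedComponentMk (u (i % k)) = c := fun i => by
    induction i with
    | zero => simpa using hu0
    | succ i ih => exact SimpleGraph.connectedComponentMk_eq_of_adj ih (hadj i)
  have hw : ∀ i, ∃ w, w ≠ u ((i + (k - 1)) % k) ∧ w ≠ u ((i + 1) % k) ∧ G.Adj (u (i % k)) w := by
    intro i
    have h1 := hadj (i + (k - 1))
    have h2 := hne (i + (k - 1))
    rw [show i + (k - 1) + 1 = i + k by omega, Nat.add_mod_right] at h1
    rw [show i + (k - 1) + 2 = i + 1 + k by omega, Nat.add_mod_right] at h2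
    obtain ⟨w, hw, hw', hx⟩ := exists_third_neighbor (hc _ (hmem i)) h1.symm (hadj i) h2
    exact ⟨w, hw, hw', (hx w).2 (by simp)⟩
  choose w hw1 hw2 hw3 using hw
  refine ⟨k, fun i => u (i % k), fun i => w (i % k), by omega, hadj, hne, by simp, hmem, fun i => ?_,
    fun i => ?_, fun i => ?_, by simp, hmin⟩
  · simpa using hw3 (i % k)
  · simpa using hw2 (i % k)
  · have := hw1 ((i + 1) % k)
    rw [Nat.mod_add_mod, show i + 1 + (k - 1) = i + k by omega, Nat.add_mod_right] at this
    exact this.symm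

theorem IsGirthCycle.isPendantCycle {k : ℕ} {v w : ℕ → V} (h : IsGirthCycle G c k v w)
    (hc : ∀ v, G.connectedComponentMk v = c → G.degree v = 3) (hk : 5 ≤ k) :
    IsPendantCycle G k v w where
  le := by omega
  adj_iff := by
    have hper : ∀ n, v (n % k) = v n := fun n => by
      conv_rhs => rw [← Nat.mod_add_div n k]
      generalize n / k = q
      induction q with
      | zero => rfl
      | succ q ih => rw [Nat.mul_succ, ← Nat.add_assoc, h.add_left, ih]
    intro i _ x
    rw [hper, hper]
    have h1 := h.adj (i + k - 1)
    have h2 := h.ne (i + k - 1)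
    have h3 := h.ne_prev (i + k - 1)
    rw [show i + k - 1 + 1 = i + k by omega] at h1 h3
    rw [show i + k - 1 + 2 = i + 1 + k by omega, h.add_left] at h2
    rw [h.add_left] at h1
    rw [h.add_left'] at h3
    obtain ⟨y, hy, hy', hx⟩ := exists_third_neighbor (hc _ (h.mem i)) h1.symm (h.adj i) h2
    obtain rfl : w i = y := by
      rcases (hx (w i)).1 (h.adj' i) with h4 | h4 | h4
      · exact absurd h4.symm h3
      · exact absurd h4 (h.ne_next i)
      · exact h4
    exact hx x
  degree i _ := hc _ (SimpleGraph.connectedComponentMk_eq_of_adj (h.mem i) (h.adj' i))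
  inj i hi j hj hij := by
    rcases lt_trichotomy i j with hlt | hlt | hlt
    · exact absurd hij (h.apply_ne_of_lt hlt hj)
    · exact hlt
    · exact absurd hij.symm (h.apply_ne_of_lt hlt hi)
  disj i hi j hj := h.apply_ne_pendant (by omega) hi hj
  inj' i hi j hj hij := by
    rcases lt_trichotomy i j with hlt | hlt | hlt
    · exact absurd hij (h.pendant_ne_of_lt hk hlt hj)
    · exact hlt
    · exact absurd hij.symm (h.pendant_ne_of_lt hk hlt hi)

theorem exists_componentColorable_of_cubic (hG : ∀ u v, G.Adj u v → G.degree u + G.degree v ≤ 6)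
    (hL : ∀ e ∈ G.edgeSet, 10 ≤ (L e).card)
    (hc : ∀ v, G.connectedComponentMk v = c → G.degree v = 3) :
    ∃ r, G.connectedComponentMk r = c ∧ ComponentColorable G L r := by
  by_cases htri : ∀ a b d, G.connectedComponentMk a = c → G.Adj a b → G.Adj b d → ¬ G.Adj a d
  swap
  · push Not at htri
    obtain ⟨a, b, d, ha, hab, hbd, had⟩ := htri
    exact ⟨a, ha, componentColorable_of_triangle hG hL hc ha hab hbd had⟩
  obtain ⟨k, v, w, hk, h⟩ := exists_isGirthCycle hc
  obtain rfl | rfl | hk5 : k = 3 ∨ k = 4 ∨ 5 ≤ k := by omega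
  · have h3 := h.add_left 0
    have := h.adj 2
    simp only [Nat.zero_add] at h3
    rw [h3] at this
    exact absurd this.symm (htri _ _ _ (h.mem 0) (h.adj 0) (h.adj 1))
  · have h4 := h.add_left 0
    have := h.adj 3
    simp only [Nat.zero_add] at h4
    rw [h4] at this
    exact exists_componentColorable_of_square hG hL hc htri (h.mem 0) (h.ne 0) (h.ne 1) (h.adj 0)
      (h.adj 1) (h.adj 2) this
  have hp := h.isPendantCycle hc hk5
  have hadj : ∀ i < k, ∀ j < k, G.Adj (w i) (w j) →
      i < j ∧ i + k ≤ j + 3 ∧ j ≤ i + 3 ∨ j < i ∧ j + k ≤ i + 3 ∧ i ≤ j + 3 := by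
    intro i hi j hj hij
    rcases lt_trichotomy i j with hlt | rfl | hlt
    · by_contra hcon
      exact h.not_pendant_adj_of_lt hlt hj (by omega) hij
    · exact absurd hij (G.irrefl)
    · by_contra hcon
      exact h.not_pendant_adj_of_lt hlt hi (by omega) hij.symm
  obtain rfl | rfl | hk7 : k = 5 ∨ k = 6 ∨ 7 ≤ k := by omega
  · by_cases hw : ∀ i < 5, ∀ j < 5, ¬ G.Adj (w i) (w j)
    · exact ⟨_, h.mem 0, hp.componentColorable_five hG hL hw⟩
    · push Not at hw
      obtain ⟨s, hs⟩ : ∃ s, G.Adj (w s) (w (s + 2)) := by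
        obtain ⟨i, hi, j, hj, hij⟩ := hw
        wlog hlt : i < j generalizing i j
        · refine this j hj i hi hij.symm ?_
          have := hadj i hi j hj hij
          omega
        have := hadj i hi j hj hij
        obtain rfl | rfl : j = i + 2 ∨ j = i + 3 := by omega
        · exact ⟨i, hij⟩
        · refine ⟨i + 3, ?_⟩
          rw [show i + 3 + 2 = i + 5 by omega, h.add_left']
          exact hij.symm
      refine ⟨_, (h.shift s).mem 0, ((h.shift s).isPendantCycle hc hk5).componentColorable_five_of_adj
        hG hL ?_⟩
      simpa [Nat.add_comm] using hs
  · refine ⟨_, h.mem 0, hp.componentColorable_six hG hL fun i hi j hj hij => ?_⟩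
    have := hadj i hi j hj hij
    omega
  · refine ⟨_, h.mem 0, hp.componentColorable_of_seven_le hk7 hG hL fun i hi j hj hij => ?_⟩
    have := hadj i hi j hj hij
    omega

end Cubic

/-- Every graph with edge weight at most 6 (i.e. `d(u)+d(v) ≤ 6` for every edge `uv`)
is strongly 10-edge choosable. -/
theorem edgeWeight_le_six_strongly_10_choosable {V : Type*} [Fintype V] [DecidableEq V]
    (G : SimpleGraph V) [DecidableRel G.Adj]
    (hG : ∀ u v, G.Adj u v → G.degree u + G.degree v ≤ 6) :
    StronglyEdgeChoosable G 10 := by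
  refine stronglyEdgeChoosable_of_component fun L hL c => ?_
  by_cases hc : ∀ v, G.connectedComponentMk v = c → G.degree v = 3
  · exact exists_componentColorable_of_cubic hG hL hc
  · exact componentColorable_of_nonCubic hG hL c hc
end

section
/- Every (2,Δ)-bipartite graph with Δ ≥ 4 has strong list-chromatic index at most 3Δ − 3. -/
open Finset in
theorem exists_injOn_choice {ι : Type*} [DecidableEq ι] (I : Finset ι) (M : ι → Finset ℕ)
    (h : ∀ s ⊆ I, s.Nonempty → ∃ a ∈ s, s.card ≤ (M a).card) :
    ∃ f : ι → ℕ, (∀ a ∈ I, f a ∈ M a) ∧ Set.InjOn f I := by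
  have hall : ∀ s : Finset I, s.card ≤ (s.biUnion fun a => M a).card := by
    intro s
    rcases s.eq_empty_or_nonempty with rfl | hs
    · simp
    obtain ⟨a, ha, hcard⟩ := h (s.map (Function.Embedding.subtype _))
      (fun x hx => by obtain ⟨y, -, rfl⟩ := mem_map.1 hx; exact y.2) (hs.map)
    obtain ⟨y, hy, rfl⟩ := mem_map.1 ha
    rw [card_map] at hcard
    exact hcard.trans (card_le_card (subset_biUnion_of_mem (fun a : I => M a) hy))
  obtain ⟨f, hf, hmem⟩ := (all_card_le_biUnion_card_iff_exists_injective fun a : I => M a).1 hall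
  refine ⟨fun a => if ha : a ∈ I then f ⟨a, ha⟩ else 0, fun a ha => ?_, fun a ha b hb hab => ?_⟩
  · simpa [ha] using hmem ⟨a, ha⟩
  · have ha' : a ∈ I := ha
    have hb' : b ∈ I := hb
    simp only [ha', hb', dif_pos] at hab
    exact congrArg Subtype.val (hf hab)

theorem exists_injOn_choice_of_two_large {ι : Type*} [DecidableEq ι] {I : Finset ι}
    {M : ι → Finset ℕ} {n : ℕ} (hI : I.card ≤ n) (hM : ∀ a ∈ I, n ≤ (M a).card + 2) {p q : ι}
    (hp : p ∈ I) (hq : q ∈ I) (hpq : p ≠ q) (hMp : n ≤ (M p).card) (hMq : n ≤ (M q).card + 1) :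
    ∃ f : ι → ℕ, (∀ a ∈ I, f a ∈ M a) ∧ Set.InjOn f I := by
  refine exists_injOn_choice I M fun s hs hne => ?_
  have hsI := Finset.card_le_card hs
  by_cases hps : p ∈ s
  · exact ⟨p, hps, by lia⟩
  have hsp : s.card ≤ (I.erase p).card :=
    Finset.card_le_card fun x hx => Finset.mem_erase.2 ⟨fun h => hps (h ▸ hx), hs hx⟩
  rw [Finset.card_erase_of_mem hp] at hsp
  by_cases hqs : q ∈ s
  · exact ⟨q, hqs, by lia⟩
  have hspq : s.card ≤ ((I.erase p).erase q).card :=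
    Finset.card_le_card fun x hx => Finset.mem_erase.2 ⟨fun h => hqs (h ▸ hx),
      Finset.mem_erase.2 ⟨fun h => hps (h ▸ hx), hs hx⟩⟩
  rw [Finset.card_erase_of_mem (Finset.mem_erase.2 ⟨hpq.symm, hq⟩),
    Finset.card_erase_of_mem hp] at hspq
  obtain ⟨a, ha⟩ := hne
  exact ⟨a, ha, by have := hM a (hs ha); lia⟩

theorem card_image_inter_add_one_le {ι : Type*} [DecidableEq ι] {I : Finset ι} {o : ι → ℕ}
    (Q : Finset ℕ) {i : ι} (hi : i ∈ I) (h : o i ∉ Q ∨ ∃ k ∈ I, k ≠ i ∧ o k = o i) :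
    (I.image o ∩ Q).card + 1 ≤ I.card := by
  have hsub : I.image o ∩ Q ⊆ (I.erase i).image o := by
    intro x hx
    simp only [Finset.mem_inter, Finset.mem_image] at hx
    obtain ⟨⟨a, ha, rfl⟩, hxQ⟩ := hx
    rw [Finset.mem_image]
    by_cases hai : a = i
    · subst hai
      rcases h with h | ⟨k, hk, hne, hko⟩
      · exact absurd hxQ h
      · exact ⟨k, Finset.mem_erase.2 ⟨hne, hk⟩, hko⟩
    · exact ⟨a, Finset.mem_erase.2 ⟨hai, ha⟩, rfl⟩
  have h1 := (Finset.card_le_card hsub).trans Finset.card_image_le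
  rw [Finset.card_erase_of_mem hi] at h1
  have := Finset.card_pos.2 ⟨i, hi⟩
  lia

theorem card_image_inter_add_two_le {ι : Type*} [DecidableEq ι] {I : Finset ι} {o : ι → ℕ}
    (P : Finset ℕ) {i j : ι} (hi : i ∈ I) (hj : j ∈ I) (hij : i ≠ j)
    (h : o i ∉ P ∨ ∃ k ∈ I, k ≠ i ∧ k ≠ j ∧ o k = o i)
    (h' : o j ∉ P ∨ ∃ k ∈ I, k ≠ i ∧ k ≠ j ∧ o k = o j) :
    (I.image o ∩ P).card + 2 ≤ I.card := by
  have hsub : I.image o ∩ P ⊆ (I.erase i).image o ∩ P := by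
    intro x hx
    simp only [Finset.mem_inter, Finset.mem_image] at hx ⊢
    obtain ⟨⟨a, ha, rfl⟩, hxP⟩ := hx
    refine ⟨?_, hxP⟩
    by_cases hai : a = i
    · subst hai
      rcases h with h | ⟨k, hk, hne, -, hko⟩
      · exact absurd hxP h
      · exact ⟨k, Finset.mem_erase.2 ⟨hne, hk⟩, hko⟩
    · exact ⟨a, Finset.mem_erase.2 ⟨hai, ha⟩, rfl⟩
  have h1 := Finset.card_le_card hsub
  have h2 := card_image_inter_add_one_le (I := I.erase i) (o := o) P
    (Finset.mem_erase.2 ⟨hij.symm, hj⟩)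
    (h'.imp_right fun ⟨k, hk, hki, hkj, hko⟩ => ⟨k, Finset.mem_erase.2 ⟨hki, hk⟩, hkj, hko⟩)
  rw [Finset.card_erase_of_mem hi] at h2
  lia

theorem exists_mem_inter_of_card_lt {P S T : Finset ℕ} (hS : S ⊆ P) (hT : T ⊆ P)
    (h : P.card < S.card + T.card) : ∃ x, x ∈ S ∧ x ∈ T := by
  by_contra! hne
  have := Finset.card_union_of_disjoint (Finset.disjoint_left.2 hne)
  have := Finset.card_le_card (Finset.union_subset hS hT)
  lia

/-- Three sets of size at least `m` inside a set of size at most `2 m` are not disjoint. -/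
theorem exists_two_inter_of_three {P S T U : Finset ℕ} {m : ℕ} (hm : 0 < m) (hP : P.card ≤ 2 * m)
    (hS : S ⊆ P) (hT : T ⊆ P) (hU : U ⊆ P) (hSc : m ≤ S.card) (hTc : m ≤ T.card)
    (hUc : m ≤ U.card) :
    (∃ x, x ∈ S ∧ x ∈ T) ∨ (∃ x, x ∈ S ∧ x ∈ U) ∨ (∃ x, x ∈ T ∧ x ∈ U) := by
  by_cases h : ∃ x, x ∈ S ∧ x ∈ T
  · exact Or.inl h
  right
  push Not at h
  have hc := Finset.card_union_of_disjoint (Finset.disjoint_left.2 h)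
  obtain ⟨x, hx, hxU⟩ := exists_mem_inter_of_card_lt (Finset.union_subset hS hT) hU (by lia)
  rcases Finset.mem_union.1 hx with hx | hx
  · exact Or.inl ⟨x, hx, hxU⟩
  · exact Or.inr ⟨x, hx, hxU⟩

/-- A family of `n ≥ 4` sets of size at least `n - 1` contained in a common set of size at most
`2 n - 2` admits a choice function with at most `n - 2` values. -/
theorem exists_choice_card_image_add_two_le {ι : Type*} [DecidableEq ι] {I : Finset ι} {n : ℕ}
    (hn : 4 ≤ n) (hI : I.card = n) {O : ι → Finset ℕ} (hO : ∀ a ∈ I, n ≤ (O a).card + 1)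
    {P : Finset ℕ} (hP : P.card + 2 ≤ 2 * n) (hOP : ∀ a ∈ I, O a ⊆ P) :
    ∃ o : ι → ℕ, (∀ a ∈ I, o a ∈ O a) ∧ ∀ Q, (I.image o ∩ Q).card + 2 ≤ n := by
  have hne : ∀ a, ∃ x, a ∈ I → x ∈ O a := by
    intro a
    by_cases ha : a ∈ I
    · obtain ⟨x, hx⟩ := Finset.card_pos.1 (show 0 < (O a).card by have := hO a ha; lia)
      exact ⟨x, fun _ => hx⟩
    · exact ⟨0, fun h => absurd h ha⟩
  choose o₀ ho₀ using hne
  have triple : ∀ a ∈ I, ∀ b ∈ I, ∀ c ∈ I, a ≠ b → a ≠ c → b ≠ c → ∀ x, x ∈ O a → x ∈ O b →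
      x ∈ O c → ∃ o : ι → ℕ, (∀ a ∈ I, o a ∈ O a) ∧ ∀ Q, (I.image o ∩ Q).card + 2 ≤ n := by
    intro a ha b hb c hc hab hac hbc x hxa hxb hxc
    refine ⟨fun t => if t = a ∨ t = b ∨ t = c then x else o₀ t, fun t ht => ?_, fun Q => ?_⟩
    · have := ho₀ t ht
      grind
    · rw [← hI]
      exact card_image_inter_add_two_le Q hb hc hbc (Or.inr ⟨a, ha, hab, hac, by simp⟩)
        (Or.inr ⟨a, ha, hab, hac, by simp⟩)
  have double : ∀ a ∈ I, ∀ b ∈ I, a ≠ b → ∀ x, x ∈ O a → x ∈ O b →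
      ∃ o : ι → ℕ, (∀ a ∈ I, o a ∈ O a) ∧ ∀ Q, (I.image o ∩ Q).card + 2 ≤ n := by
    intro a ha b hb hab x hxa hxb
    obtain ⟨c, hc, d, hd, hcd⟩ : ∃ c ∈ (I.erase a).erase b, ∃ d ∈ (I.erase a).erase b, c ≠ d := by
      refine Finset.one_lt_card.1 ?_
      rw [Finset.card_erase_of_mem (Finset.mem_erase.2 ⟨hab.symm, hb⟩),
        Finset.card_erase_of_mem ha]
      lia
    simp only [Finset.mem_erase] at hc hd
    obtain ⟨hcb, hca, hc⟩ := hc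
    obtain ⟨hdb, hda, hd⟩ := hd
    by_cases hcd' : ∃ y, y ∈ O c ∧ y ∈ O d
    · obtain ⟨y, hyc, hyd⟩ := hcd'
      refine ⟨fun t => if t = a ∨ t = b then x else if t = c ∨ t = d then y else o₀ t,
        fun t ht => ?_, fun Q => ?_⟩
      · have := ho₀ t ht
        grind
      · rw [← hI]
        exact card_image_inter_add_two_le Q hb hd hdb.symm
          (Or.inr ⟨a, ha, hab, hda.symm, by simp⟩)
          (Or.inr ⟨c, hc, hcb, hcd, by simp [hca, hcb, hda, hdb]⟩)
    · push Not at hcd'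
      have hu := Finset.card_union_of_disjoint (Finset.disjoint_left.2 hcd')
      have h1 := hO c hc
      have h2 := hO d hd
      have hPeq : O c ∪ O d = P :=
        Finset.eq_of_subset_of_card_le (Finset.union_subset (hOP c hc) (hOP d hd)) (by lia)
      have hxP : x ∈ O c ∪ O d := hPeq ▸ hOP a ha hxa
      rcases Finset.mem_union.1 hxP with hx | hx
      · exact triple a ha b hb c hc hab hca.symm hcb.symm x hxa hxb hx
      · exact triple a ha b hb d hd hab hda.symm hdb.symm x hxa hxb hx
  obtain ⟨a, ha, b, hb, c, hc, hab, hac, hbc⟩ := Finset.two_lt_card.1 (show 2 < I.card by lia)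
  have h1 := hO a ha
  have h2 := hO b hb
  have h3 := hO c hc
  rcases exists_two_inter_of_three (m := n - 1) (by lia) (by lia) (hOP a ha) (hOP b hb) (hOP c hc)
    (by lia) (by lia) (by lia) with ⟨x, hx, hx'⟩ | ⟨x, hx, hx'⟩ | ⟨x, hx, hx'⟩
  · exact double a ha b hb hab x hx hx'
  · exact double a ha c hc hac x hx hx'
  · exact double b hb c hc hbc x hx hx'

theorem exists_choice_card_inter {ι : Type*} [DecidableEq ι] {I : Finset ι} {n : ℕ}
    (hn : 4 ≤ n) (hI : I.card = n) {O : ι → Finset ℕ} (hO : ∀ a ∈ I, n ≤ (O a).card + 1)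
    {P Q : Finset ℕ} (hP : P.card + 2 ≤ 2 * n) (hQ : Q.card + 2 ≤ 2 * n) :
    ∃ o : ι → ℕ, (∀ a ∈ I, o a ∈ O a) ∧ (I.image o ∩ P).card + 2 ≤ n ∧
      (I.image o ∩ Q).card + 1 ≤ n := by
  by_cases hOQ : ∀ a ∈ I, O a ⊆ Q
  · obtain ⟨o, ho, h⟩ := exists_choice_card_image_add_two_le hn hI hO hQ hOQ
    exact ⟨o, ho, h P, by have := h Q; lia⟩
  by_cases hOP : ∀ a ∈ I, O a ⊆ P
  · obtain ⟨o, ho, h⟩ := exists_choice_card_image_add_two_le hn hI hO hP hOP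
    exact ⟨o, ho, h P, by have := h Q; lia⟩
  have hne : ∀ a, ∃ x, a ∈ I → x ∈ O a := by
    intro a
    by_cases ha : a ∈ I
    · obtain ⟨x, hx⟩ := Finset.card_pos.1 (show 0 < (O a).card by have := hO a ha; lia)
      exact ⟨x, fun _ => hx⟩
    · exact ⟨0, fun h => absurd h ha⟩
  choose o₀ ho₀ using hne
  push Not at hOQ hOP
  obtain ⟨i, hi, hiP⟩ := hOP
  obtain ⟨z, hz, hzP⟩ := Finset.not_subset.1 hiP
  -- two indices avoiding `P` and an index avoiding `Q`
  have avoid : ∀ j ∈ I, ∀ k ∈ I, j ≠ k → ∀ l ∈ I, ∀ x y u, x ∈ O j → x ∉ P → y ∈ O k → y ∉ P →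
      u ∈ O l → u ∉ Q → (l = j → u = x) → (l = k → u = y) → ∃ o : ι → ℕ, (∀ a ∈ I, o a ∈ O a) ∧
        (I.image o ∩ P).card + 2 ≤ n ∧ (I.image o ∩ Q).card + 1 ≤ n := by
    intro j hj k hk hjk l hl x y u hx hxP hy hyP hu huQ hlj hlk
    refine ⟨fun t => if t = l then u else if t = j then x else if t = k then y else o₀ t,
      fun t ht => ?_, ?_, ?_⟩
    · have := ho₀ t ht
      grind
    · rw [← hI]
      exact card_image_inter_add_two_le P hj hk hjk (Or.inl (by grind)) (Or.inl (by grind))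
    · rw [← hI]
      exact card_image_inter_add_one_le Q hl (Or.inl (by grind))
  -- one index avoiding `P` and a collision elsewhere
  have collide : ∀ j ∈ I, ∀ a ∈ I, ∀ b ∈ I, a ≠ b → j ≠ a → j ≠ b → ∀ x y, x ∈ O j → x ∉ P →
      y ∈ O a → y ∈ O b → ∃ o : ι → ℕ, (∀ a ∈ I, o a ∈ O a) ∧
        (I.image o ∩ P).card + 2 ≤ n ∧ (I.image o ∩ Q).card + 1 ≤ n := by
    intro j hj a ha b hb hab hja hjb x y hx hxP hya hyb
    refine ⟨fun t => if t = j then x else if t = a ∨ t = b then y else o₀ t,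
      fun t ht => ?_, ?_, ?_⟩
    · have := ho₀ t ht
      grind
    · rw [← hI]
      exact card_image_inter_add_two_le P hj hb hjb (Or.inl (by grind))
        (Or.inr ⟨a, ha, hja.symm, hab, by grind⟩)
    · rw [← hI]
      exact card_image_inter_add_one_le Q hb (Or.inr ⟨a, ha, hab, by grind⟩)
  obtain ⟨l, hl, hlQ⟩ := hOQ
  obtain ⟨u, hu, huQ⟩ := Finset.not_subset.1 hlQ
  by_cases h2 : ∃ j ∈ I, j ≠ i ∧ ¬ O j ⊆ P
  swap
  · push Not at h2
    have hcard : 2 < (I.erase i).card := by rw [Finset.card_erase_of_mem hi]; lia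
    obtain ⟨a, ha, b, hb, c, hc, hab, hac, hbc⟩ := Finset.two_lt_card.1 hcard
    simp only [Finset.mem_erase] at ha hb hc
    have e1 := hO a ha.2
    have e2 := hO b hb.2
    have e3 := hO c hc.2
    rcases exists_two_inter_of_three (m := n - 1) (by lia) (by lia) (h2 a ha.2 ha.1)
      (h2 b hb.2 hb.1) (h2 c hc.2 hc.1) (by lia) (by lia) (by lia) with
      ⟨x, hx, hx'⟩ | ⟨x, hx, hx'⟩ | ⟨x, hx, hx'⟩
    · exact collide i hi a ha.2 b hb.2 hab ha.1.symm hb.1.symm z x hz hzP hx hx'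
    · exact collide i hi a ha.2 c hc.2 hac ha.1.symm hc.1.symm z x hz hzP hx hx'
    · exact collide i hi b hb.2 c hc.2 hbc hb.1.symm hc.1.symm z x hz hzP hx hx'
  obtain ⟨j, hj, hji, hjP⟩ := h2
  obtain ⟨y, hy, hyP⟩ := Finset.not_subset.1 hjP
  by_cases hlij : l ≠ i ∧ l ≠ j
  · exact avoid i hi j hj hji.symm l hl z y u hz hzP hy hyP hu huQ
      (fun h => absurd h hlij.1) (fun h => absurd h hlij.2)
  by_cases hk : ∃ k ∈ I, k ≠ i ∧ k ≠ j ∧ ¬ O k ⊆ P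
  · obtain ⟨k, hk, hki, hkj, hkP⟩ := hk
    obtain ⟨v, hv, hvP⟩ := Finset.not_subset.1 hkP
    by_cases hli : l = i
    · exact avoid j hj k hk hkj.symm l hl y v u hy hyP hv hvP hu huQ
        (fun h => absurd (h.symm.trans hli) hji) (fun h => absurd (h.symm.trans hli) hki)
    · have hlj : l = j := by tauto
      exact avoid i hi k hk hki.symm l hl z v u hz hzP hv hvP hu huQ
        (fun h => absurd h hli) (fun h => absurd (h.symm.trans hlj) hkj)
  push Not at hk
  by_cases hkQ : ∃ k ∈ I, k ≠ i ∧ k ≠ j ∧ ¬ O k ⊆ Q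
  · obtain ⟨k, hk, hki, hkj, hkQ⟩ := hkQ
    obtain ⟨v, hv, hvQ⟩ := Finset.not_subset.1 hkQ
    exact avoid i hi j hj hji.symm k hk z y v hz hzP hy hyP hv hvQ
      (fun h => absurd h hki) (fun h => absurd h hkj)
  push Not at hkQ
  by_cases hzQ : z ∈ Q
  swap
  · exact avoid i hi j hj hji.symm i hi z y z hz hzP hy hyP hz hzQ (fun _ => rfl)
      (fun h => absurd h hji.symm)
  obtain ⟨a, ha, b, hb, hab⟩ : ∃ a ∈ (I.erase i).erase j, ∃ b ∈ (I.erase i).erase j, a ≠ b := by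
    refine Finset.one_lt_card.1 ?_
    rw [Finset.card_erase_of_mem (Finset.mem_erase.2 ⟨hji, hj⟩), Finset.card_erase_of_mem hi]
    lia
  simp only [Finset.mem_erase] at ha hb
  obtain ⟨haj, hai, ha⟩ := ha
  obtain ⟨hbj, hbi, hb⟩ := hb
  have e1 := hO a ha
  have e2 := hO b hb
  have e3 := Finset.card_erase_of_mem hzQ
  have hQpos := Finset.card_pos.2 ⟨z, hzQ⟩
  obtain ⟨x, hxa, hxb⟩ := exists_mem_inter_of_card_lt (P := Q.erase z)
    (fun t ht => Finset.mem_erase.2 ⟨fun h => hzP (h ▸ hk a ha hai haj ht), hkQ a ha hai haj ht⟩)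
    (fun t ht => Finset.mem_erase.2 ⟨fun h => hzP (h ▸ hk b hb hbi hbj ht), hkQ b hb hbi hbj ht⟩)
    (show _ < (O a).card + (O b).card by lia)
  exact collide i hi a ha b hb hab hai.symm hbi.symm z x hz hzP hxa hxb

/-- A partial choice function that is injective on the fibres of `w` extends to all of `I`. -/
theorem exists_extension_injOn_fibres {ι κ : Type*} [DecidableEq ι] [DecidableEq κ] {I : Finset ι}
    {w : ι → κ} {O : ι → Finset ℕ}
    (hO : ∀ a ∈ I, (I.filter fun b => w b = w a).card ≤ (O a).card)
    {J : Finset ι} {g : ι → ℕ} (hJ : J ⊆ I) (hg : ∀ a ∈ J, g a ∈ O a)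
    (hgw : ∀ a ∈ J, ∀ b ∈ J, a ≠ b → w a = w b → g a ≠ g b) :
    ∃ o : ι → ℕ, (∀ a ∈ J, o a = g a) ∧ (∀ a ∈ I, o a ∈ O a) ∧
      ∀ a ∈ I, ∀ b ∈ I, a ≠ b → w a = w b → o a ≠ o b := by
  suffices h : ∀ K ⊆ I, ∃ o : ι → ℕ, (∀ a ∈ J, o a = g a) ∧ (∀ a ∈ J ∪ K, o a ∈ O a) ∧
      ∀ a ∈ J ∪ K, ∀ b ∈ J ∪ K, a ≠ b → w a = w b → o a ≠ o b by
    simpa [Finset.union_eq_right.2 hJ] using h I subset_rfl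
  intro K
  induction K using Finset.induction_on with
  | empty => exact fun _ => ⟨g, fun _ _ => rfl, by simpa using hg, by simpa using hgw⟩
  | insert a K haK ih =>
    intro hK
    obtain ⟨o, hoJ, hoO, how⟩ := ih ((Finset.subset_insert _ _).trans hK)
    by_cases haJ : a ∈ J
    · have : J ∪ insert a K = J ∪ K := by grind
      rw [this]
      exact ⟨o, hoJ, hoO, how⟩
    have haI : a ∈ I := hK (Finset.mem_insert_self _ _)
    have hlt : (((I.filter fun b => w b = w a).erase a).image o).card < (O a).card := by
      have hmem : a ∈ I.filter fun b => w b = w a := by simp [haI]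
      have := hO a haI
      have := Finset.card_pos.2 ⟨a, hmem⟩
      have := Finset.card_erase_of_mem hmem
      exact Finset.card_image_le.trans_lt (by lia)
    obtain ⟨x, hx, hxn⟩ := Finset.exists_mem_notMem_of_card_lt_card hlt
    have hxne : ∀ b ∈ J ∪ K, b ≠ a → w b = w a → x ≠ o b := by
      intro b hb hba hw h
      have hbI : b ∈ I := (Finset.union_subset hJ ((Finset.subset_insert _ _).trans hK)) hb
      exact hxn (Finset.mem_image.2 ⟨b, by simp [hba, hbI, hw], h.symm⟩)
    refine ⟨Function.update o a x, ?_, ?_, ?_⟩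
    · grind
    · grind
    · intro b hb c hc hbc hw
      by_cases hba : b = a
      · subst hba
        have := hxne c (by grind) hbc.symm hw.symm
        grind
      by_cases hca : c = a
      · subst hca
        have := hxne b (by grind) hbc hw
        grind
      have := how b (by grind) c (by grind) hbc hw
      grind

theorem exists_star_choice {ι κ : Type*} [DecidableEq ι] [DecidableEq κ] {I : Finset ι} {n : ℕ}
    (hn : 4 ≤ n) (hI : I.card ≤ n) {w : ι → κ} {L O : ι → Finset ℕ}
    (hL : ∀ a ∈ I, 2 * n + (I.filter fun b => w b = w a).card ≤ (L a).card + 3)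
    (hO : ∀ a ∈ I, n + 2 * (I.filter fun b => w b = w a).card ≤ (O a).card + 3) :
    ∃ i o : ι → ℕ, (∀ a ∈ I, i a ∈ L a) ∧ Set.InjOn i I ∧ (∀ a ∈ I, o a ∈ O a) ∧
      (∀ a ∈ I, ∀ b ∈ I, a ≠ b → w a = w b → o a ≠ o b) ∧ ∀ a ∈ I, ∀ b ∈ I, i a ≠ o b := by
  set μ : ι → ℕ := fun a => (I.filter fun b => w b = w a).card with hμ
  have hμpos : ∀ a ∈ I, 1 ≤ μ a := fun a ha => Finset.card_pos.2 ⟨a, by simp [ha]⟩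
  have hOμ : ∀ a ∈ I, (I.filter fun b => w b = w a).card ≤ (O a).card := by
    intro a ha
    have := hO a ha
    lia
  -- it is enough to choose the outer colours so that the inner ones can be completed
  suffices h : ∃ o : ι → ℕ, (∀ a ∈ I, o a ∈ O a) ∧
      (∀ a ∈ I, ∀ b ∈ I, a ≠ b → w a = w b → o a ≠ o b) ∧
      ∃ i : ι → ℕ, (∀ a ∈ I, i a ∈ L a \ I.image o) ∧ Set.InjOn i I by
    obtain ⟨o, ho, how, i, hi, hinj⟩ := h
    refine ⟨i, o, fun a ha => (Finset.mem_sdiff.1 (hi a ha)).1, hinj, ho, how,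
      fun a ha b hb hab => ?_⟩
    exact (Finset.mem_sdiff.1 (hi a ha)).2 (Finset.mem_image.2 ⟨b, hb, hab.symm⟩)
  have hsd : ∀ (o : ι → ℕ) (a : ι), (L a \ I.image o).card + (I.image o ∩ L a).card = (L a).card :=
    fun o a => by rw [Finset.inter_comm]; exact Finset.card_sdiff_add_card_inter _ _
  have hX : ∀ (o : ι → ℕ) (a : ι), (I.image o ∩ L a).card ≤ I.card := fun o a =>
    (Finset.card_le_card Finset.inter_subset_left).trans Finset.card_image_le
  have hlow : ∀ (o : ι → ℕ), ∀ a ∈ I, n ≤ (L a \ I.image o).card + 2 := by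
    intro o a ha
    have := hsd o a
    have := hX o a
    have := hL a ha
    have := hμpos a ha
    lia
  obtain ⟨o₀, -, ho₀, ho₀w⟩ := exists_extension_injOn_fibres hOμ (J := ∅) (g := fun _ => 0)
    (by simp) (by simp) (by simp)
  rcases hI.lt_or_eq with hlt | hIn
  · refine ⟨o₀, ho₀, ho₀w, exists_injOn_choice _ _ fun s hs ⟨a, ha⟩ => ⟨a, ha, ?_⟩⟩
    have := hsd o₀ a
    have := hX o₀ a
    have := hL a (hs ha)
    have := hμpos a (hs ha)
    have := Finset.card_le_card hs
    lia
  by_cases h1 : ∀ a ∈ I, μ a = 1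
  · have hw : ∀ a ∈ I, ∀ b ∈ I, a ≠ b → w a ≠ w b := by
      intro a ha b hb hab hw
      have : 1 < μ b := Finset.one_lt_card.2 ⟨a, by simp [ha, hw], b, by simp [hb], hab⟩
      have := h1 b hb
      lia
    obtain ⟨p, hp, q, hq, hpq⟩ := Finset.one_lt_card.1 (show 1 < I.card by lia)
    have hLp := hL p hp
    have hLq := hL q hq
    have := hμpos p hp
    have := hμpos q hq
    obtain ⟨P, hPL, hP⟩ := Finset.exists_subset_card_eq (show 2 * n - 2 ≤ (L p).card by lia)
    obtain ⟨Q, hQL, hQ⟩ := Finset.exists_subset_card_eq (show 2 * n - 2 ≤ (L q).card by lia)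
    obtain ⟨o, ho, hoP, hoQ⟩ := exists_choice_card_inter hn hIn (O := O)
      (fun a ha => by have := hO a ha; have := hμpos a ha; lia)
      (show P.card + 2 ≤ 2 * n by lia) (show Q.card + 2 ≤ 2 * n by lia)
    refine ⟨o, ho, fun a ha b hb hab h => absurd h (hw a ha b hb hab),
      exists_injOn_choice_of_two_large hI (hlow o) hp hq hpq ?_ ?_⟩
    · have h2 := Finset.card_sdiff_add_card_inter P (I.image o)
      rw [Finset.inter_comm] at h2
      have := Finset.card_le_card (Finset.sdiff_subset_sdiff hPL (subset_refl (I.image o)))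
      lia
    · have h2 := Finset.card_sdiff_add_card_inter Q (I.image o)
      rw [Finset.inter_comm] at h2
      have := Finset.card_le_card (Finset.sdiff_subset_sdiff hQL (subset_refl (I.image o)))
      lia
  push Not at h1
  obtain ⟨p, hp, hμp⟩ := h1
  have hμp2 : 2 ≤ μ p := by have := hμpos p hp; lia
  obtain ⟨q, hq, hqp⟩ := Finset.exists_mem_ne (show 1 < (I.filter fun b => w b = w p).card from hμp2) p
  rw [Finset.mem_filter] at hq
  have hLp := hL p hp
  have hLq := hL q hq.1
  rw [hq.2] at hLq
  -- the two parallel indices `p`, `q` suffice once a single colour is saved at `p`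
  have finish : ∀ o : ι → ℕ, n + (I.image o ∩ L p).card ≤ (L p).card →
      ∃ i : ι → ℕ, (∀ a ∈ I, i a ∈ L a \ I.image o) ∧ Set.InjOn i I := by
    intro o ho
    have := hsd o p
    have := hsd o q
    have := hX o q
    exact exists_injOn_choice_of_two_large hI (hlow o) hp hq.1 hqp.symm (by lia) (by lia)
  by_cases hbig : 2 * n ≤ (L p).card
  · exact ⟨o₀, ho₀, ho₀w, finish o₀ (by have := hX o₀ p; lia)⟩
  by_cases hout : ∃ j ∈ I, ¬ O j ⊆ L p
  · obtain ⟨j, hj, hjL⟩ := hout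
    obtain ⟨z, hz, hzL⟩ := Finset.not_subset.1 hjL
    obtain ⟨o, hoJ, ho, how⟩ := exists_extension_injOn_fibres hOμ (J := {j}) (g := fun _ => z)
      (by simpa using hj) (by simpa using hz) (by grind)
    refine ⟨o, ho, how, finish o ?_⟩
    have hoj : o j = z := hoJ j (by simp)
    have := card_image_inter_add_one_le (L p) hj (o := o) (Or.inl (hoj ▸ hzL))
    lia
  push Not at hout
  obtain ⟨c, hc, hcw⟩ : ∃ c ∈ I, w c ≠ w p := by
    by_contra! hall
    have : (I.filter fun b => w b = w p).card = I.card := by rw [Finset.filter_true_of_mem hall]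
    lia
  have hOp := hO p hp
  have hOc := hO c hc
  have := hμpos c hc
  obtain ⟨x, hxp, hxc⟩ := exists_mem_inter_of_card_lt (hout p hp) (hout c hc) (by lia)
  obtain ⟨o, hoJ, ho, how⟩ := exists_extension_injOn_fibres hOμ (J := {p, c}) (g := fun _ => x)
    (by grind) (by grind) (by grind)
  refine ⟨o, ho, how, finish o ?_⟩
  have hpc : p ≠ c := fun h => hcw (h ▸ rfl)
  have := card_image_inter_add_one_le (L p) hc (o := o)
    (Or.inr ⟨p, hp, hpc, (hoJ p (by simp)).trans (hoJ c (by simp)).symm⟩)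
  lia

/-- The half-edge form of the theorem: `c a b` is the color of the edge joining `a ∈ A` to `b`, and
only the edges at vertices of `R` are colored. -/
theorem exists_halfEdge_coloring {V : Type*} [Fintype V] [DecidableEq V] (G : SimpleGraph V)
    [DecidableRel G.Adj] {n : ℕ} (hn : 4 ≤ n) {A B : Set V} (hdisj : Disjoint A B)
    (hpart : ∀ a ∈ A, ∀ b, G.Adj a b → b ∈ B)
    (hA : ∀ v ∈ A, G.degree v ≤ 2) (hB : ∀ v ∈ B, G.degree v ≤ n)
    {L : V → V → Finset ℕ} (hL : ∀ a b, 3 * n ≤ (L a b).card + 3) (R : Finset V) (hR : ↑R ⊆ A) :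
    ∃ c : V → V → ℕ, (∀ a ∈ R, ∀ b, G.Adj a b → c a b ∈ L a b) ∧
      ∀ a ∈ R, ∀ b, G.Adj a b → ∀ a' ∈ R, ∀ b', G.Adj a' b' → (a ≠ a' ∨ b ≠ b') →
        G.Adj a b' → c a b ≠ c a' b' := by
  induction R using Finset.strongInduction with
  | H R ih =>
  by_cases hE : ∃ a ∈ R, ∃ v, G.Adj a v
  swap
  · push Not at hE
    exact ⟨fun _ _ => 0, fun a ha b hab => absurd hab (hE a ha b),
      fun a ha b hab => absurd hab (hE a ha b)⟩
  obtain ⟨a₀, ha₀, v, hav⟩ := hE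
  have hvB : v ∈ B := hpart a₀ (hR ha₀) v hav
  set I := R.filter fun a => G.Adj a v with hIdef
  set S := R.filter fun a => ¬ G.Adj a v with hSdef
  have hSR : S ⊂ R := Finset.filter_ssubset.2 ⟨a₀, ha₀, not_not.2 hav⟩
  obtain ⟨c, hcL, hc⟩ := ih S hSR (fun x hx => hR (hSR.1 hx))
  have hAB : ∀ a ∈ R, ∀ a' ∈ R, ¬ G.Adj a a' := fun a ha a' ha' h =>
    Set.disjoint_left.1 hdisj (hR ha') (hpart a (hR ha) a' h)
  -- the neighbor of `a` other than `v`, or `a` itself if there is none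
  have hpartner : ∀ a, ∃ u, a ∈ I → u ≠ v ∧ (u = a ∨ G.Adj a u) ∧
      ∀ b, G.Adj a b → b = v ∨ b = u := by
    intro a
    by_cases ha : a ∈ I
    swap
    · exact ⟨a, fun h => absurd h ha⟩
    obtain ⟨haR, hadj⟩ := Finset.mem_filter.1 ha
    by_cases hu : ∃ u, u ≠ v ∧ G.Adj a u
    · obtain ⟨u, huv, hau⟩ := hu
      refine ⟨u, fun _ => ⟨huv, Or.inr hau, fun b hab => ?_⟩⟩
      by_contra! hb
      have : 2 < (G.neighborFinset a).card := Finset.two_lt_card.2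
        ⟨v, by simpa, u, by simpa, b, by simpa, huv.symm, hb.1.symm, hb.2.symm⟩
      have := hA a (hR haR)
      rw [← SimpleGraph.card_neighborFinset_eq_degree] at this
      lia
    · push Not at hu
      exact ⟨a, fun _ => ⟨hadj.ne, Or.inl rfl, fun b hab =>
        Or.inl (by_contra fun h => hu b h hab)⟩⟩
  choose w hw using hpartner
  set N : V → Finset V := fun a => S.filter fun f => G.Adj f (w a) with hN
  have hcount : ∀ a ∈ I, (N a).card + (I.filter fun b => w b = w a).card ≤ n := by
    intro a ha
    obtain ⟨haR, hadj⟩ := Finset.mem_filter.1 ha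
    obtain ⟨-, hwa | hwa, -⟩ := hw a ha
    · have h1 : N a = ∅ := by
        rw [hN]
        refine Finset.filter_eq_empty_iff.2 fun f hf h => ?_
        rw [hwa] at h
        exact hAB f (hSR.1 hf) a haR h
      have h2 : (I.filter fun b => w b = w a) ⊆ {a} := by
        intro b hb
        obtain ⟨hbI, hbw⟩ := Finset.mem_filter.1 hb
        rw [hwa] at hbw
        obtain ⟨-, h | h, -⟩ := hw b hbI
        · exact Finset.mem_singleton.2 (h.symm.trans hbw)
        · rw [hbw] at h
          exact absurd h (hAB b (Finset.mem_filter.1 hbI).1 a haR)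
      have := Finset.card_le_card h2
      rw [Finset.card_singleton] at this
      rw [h1, Finset.card_empty]
      lia
    · have hd : Disjoint (N a) (I.filter fun b => w b = w a) := by
        rw [Finset.disjoint_left]
        intro x hx hx'
        have hxS := (Finset.mem_filter.1 hx).1
        have hxI := (Finset.mem_filter.1 hx').1
        exact (Finset.mem_filter.1 hxS).2 (Finset.mem_filter.1 hxI).2
      have hsub : N a ∪ (I.filter fun b => w b = w a) ⊆ G.neighborFinset (w a) := by
        intro x hx
        rw [SimpleGraph.mem_neighborFinset]
        rcases Finset.mem_union.1 hx with hx | hx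
        · exact (Finset.mem_filter.1 hx).2.symm
        · obtain ⟨hxI, hxw⟩ := Finset.mem_filter.1 hx
          obtain ⟨-, h | h, -⟩ := hw x hxI
          · rw [← hxw, h] at hwa
            exact absurd hwa (hAB a haR x (Finset.mem_filter.1 hxI).1)
          · rw [← hxw]
            exact h.symm
      have := Finset.card_le_card hsub
      rw [Finset.card_union_of_disjoint hd, SimpleGraph.card_neighborFinset_eq_degree] at this
      exact this.trans (hB _ (hpart a (hR haR) _ hwa))
  have hI : I.card ≤ n := by
    refine le_trans (Finset.card_le_card fun x hx => ?_)
      ((SimpleGraph.card_neighborFinset_eq_degree G v).trans_le (hB v hvB))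
    rw [SimpleGraph.mem_neighborFinset]
    exact (Finset.mem_filter.1 hx).2.symm
  set X : V → Finset ℕ := fun a => (N a).image fun f => c f (w a) with hX
  set Y : V → Finset ℕ := fun a => (N a).biUnion fun f => (G.neighborFinset f).image (c f) with hY
  obtain ⟨i, o, hi, hinj, ho, how, hio⟩ := exists_star_choice hn hI (w := w)
    (L := fun a => L a v \ X a) (O := fun a => L a (w a) \ Y a)
    (fun a ha => by
      have h1 := hcount a ha
      have h2 : (X a).card ≤ (N a).card := Finset.card_image_le
      have h3 := Finset.le_card_sdiff (X a) (L a v)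
      have h4 := hL a v
      lia)
    (fun a ha => by
      have h1 := hcount a ha
      have h2 : (Y a).card ≤ (N a).card * 2 := Finset.card_biUnion_le_card_mul _ _ _ fun f hf =>
        Finset.card_image_le.trans <| (SimpleGraph.card_neighborFinset_eq_degree G f).trans_le <|
          hA f (hR (hSR.1 (Finset.mem_filter.1 hf).1))
      have h3 := Finset.le_card_sdiff (Y a) (L a (w a))
      have h4 := hL a (w a)
      lia)
  have hsplit : ∀ a ∈ R, a ∈ I ∨ a ∉ I ∧ a ∈ S := by
    intro a ha
    by_cases h : G.Adj a v <;> simp [hIdef, hSdef, ha, h]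
  have hSv : ∀ a ∈ S, ¬ G.Adj a v := fun a ha => (Finset.mem_filter.1 ha).2
  -- colors on the star avoid the conflicting colors outside it
  have hX' : ∀ a ∈ I, ∀ f ∈ S, G.Adj f (w a) → i a ≠ c f (w a) := fun a ha f hf hfw h =>
    (Finset.mem_sdiff.1 (hi a ha)).2
      (Finset.mem_image.2 ⟨f, Finset.mem_filter.2 ⟨hf, hfw⟩, h.symm⟩)
  have hY' : ∀ a ∈ I, ∀ f ∈ S, G.Adj f (w a) → ∀ b, G.Adj f b → o a ≠ c f b :=
    fun a ha f hf hfw b hfb h => (Finset.mem_sdiff.1 (ho a ha)).2 <| Finset.mem_biUnion.2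
      ⟨f, Finset.mem_filter.2 ⟨hf, hfw⟩, Finset.mem_image.2 ⟨b, by simpa using hfb, h.symm⟩⟩
  refine ⟨fun a b => if a ∈ I then if b = v then i a else o a else c a b, ?_, ?_⟩
  · intro a ha b hab
    rcases hsplit a ha with haI | ⟨haI, haS⟩
    · by_cases hbv : b = v
      · subst hbv
        simpa [haI] using (Finset.mem_sdiff.1 (hi a haI)).1
      · obtain rfl : b = w a := ((hw a haI).2.2 b hab).resolve_left hbv
        simpa [haI, hbv] using (Finset.mem_sdiff.1 (ho a haI)).1
    · simpa [haI] using hcL a haS b hab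
  · intro a ha b hab a' ha' b' hab' hne hconf
    rcases hsplit a ha with haI | ⟨haI, haS⟩ <;> rcases hsplit a' ha' with haI' | ⟨haI', haS'⟩
    · have hb := (hw a haI).2.2 b hab
      have hb' := (hw a' haI').2.2 b' hab'
      have hconf' := (hw a haI).2.2 b' hconf
      by_cases hbv : b = v <;> by_cases hbv' : b' = v
      · simp only [haI, haI', hbv, hbv', if_true]
        exact fun h => (hne.resolve_right (by simp [hbv, hbv'])) (hinj haI haI' h)
      · simpa only [haI, haI', hbv, hbv', if_true, if_false] using hio a haI a' haI'
      · simpa only [haI, haI', hbv, hbv', if_true, if_false] using (hio a' haI' a haI).symm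
      · simp only [haI, haI', hbv, hbv', if_true, if_false]
        have e1 := hb.resolve_left hbv
        have e2 := hb'.resolve_left hbv'
        have e3 := hconf'.resolve_left hbv'
        refine how a haI a' haI' ?_ (e3.symm.trans e2)
        exact hne.resolve_right (not_not.2 (e1.trans e3.symm))
    · have hbv' : b' ≠ v := fun h => hSv a' haS' (h ▸ hab')
      obtain rfl := ((hw a haI).2.2 b' hconf).resolve_left hbv'
      by_cases hbv : b = v
      · simpa only [haI, haI', hbv, if_true, if_false] using hX' a haI a' haS' hab'
      · simpa only [haI, haI', hbv, if_true, if_false] using hY' a haI a' haS' hab' _ hab'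
    · have hbv' : b' ≠ v := fun h => hSv a haS (h ▸ hconf)
      obtain rfl := ((hw a' haI').2.2 b' hab').resolve_left hbv'
      simpa only [haI, haI', hbv', if_true, if_false] using (hY' a' haI' a haS hconf b hab).symm
    · simpa only [haI, haI', if_false] using hc a haS b hab a' haS' b' hab' hne hconf

/-- Every `(2,Δ)`-bipartite graph with `Δ ≥ 4` is strongly `(3Δ-3)`-edge choosable. -/
theorem two_delta_bipartite_strongly_choosable {V : Type*} [Fintype V] [DecidableEq V]
    (G : SimpleGraph V) [DecidableRel G.Adj] (Δ : ℕ) (hΔ : 4 ≤ Δ)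
    (A B : Set V) (hdisj : Disjoint A B) (hcover : A ∪ B = Set.univ)
    (hpart : ∀ u v, G.Adj u v → (u ∈ A ∧ v ∈ B) ∨ (u ∈ B ∧ v ∈ A))
    (hA : ∀ v ∈ A, G.degree v ≤ 2) (hB : ∀ v ∈ B, G.degree v ≤ Δ) :
    StronglyEdgeChoosable G (3 * Δ - 3) := by
  classical
  intro L hL
  have hnot : ∀ x ∈ A, x ∉ B := fun x hx => Set.disjoint_left.1 hdisj hx
  obtain ⟨c, hcL, hc⟩ := exists_halfEdge_coloring G hΔ hdisj
    (fun a ha b hab => ((hpart a b hab).resolve_right fun h => hnot a ha h.1).2) hA hB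
    (L := fun a b => if G.Adj a b then L s(a, b) else Finset.range (3 * Δ - 3))
    (fun a b => by
      by_cases h : G.Adj a b
      · have := hL s(a, b) h
        simp only [h, if_true]
        lia
      · simp only [h, if_false, Finset.card_range]
        lia)
    (Finset.univ.filter (· ∈ A)) (by intro x; simp)
  simp only [Finset.mem_filter, Finset.mem_univ, true_and] at hcL hc
  have hrep : ∀ e, ∃ a b, e ∈ G.edgeSet → a ∈ A ∧ G.Adj a b ∧ e = s(a, b) := by
    intro e
    induction e using Sym2.ind with
    | _ x y =>
      by_cases hx : x ∈ A
      · exact ⟨x, y, fun h => ⟨hx, h, rfl⟩⟩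
      · exact ⟨y, x, fun h => ⟨((hpart x y h).resolve_left fun h' => hx h'.1).2,
          SimpleGraph.Adj.symm h, Sym2.eq_swap⟩⟩
  have hBmem : ∀ a b, a ∈ A → G.Adj a b → b ∉ A := fun a b ha hab hb =>
    hnot b hb ((hpart a b hab).resolve_right fun h => hnot a ha h.1).2
  choose p q hpq' using hrep
  have hpA := fun e he => (hpq' e he).1
  have hpq := fun e he => (hpq' e he).2.1
  have heq := fun e he => (hpq' e he).2.2
  refine ⟨fun e => c (p e) (q e), ?_, ?_⟩
  · have key : ∀ e ∈ G.edgeSet, ∀ f ∈ G.edgeSet, e ≠ f → G.Adj (p e) (q f) →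
        c (p e) (q e) ≠ c (p f) (q f) := by
      intro e he f hf hne hadj
      refine hc _ (hpA e he) _ (hpq e he) _ (hpA f hf) _ (hpq f hf) ?_ hadj
      by_contra! h
      exact hne ((heq e he).trans ((congrArg₂ (fun x y => s(x, y)) h.1 h.2).trans (heq f hf).symm))
    rintro e he f hf ⟨hne, hconf⟩
    suffices h : G.Adj (p e) (q f) ∨ G.Adj (p f) (q e) from
      h.elim (key e he f hf hne) fun h => (key f hf e he hne.symm h).symm
    have hmem : ∀ e ∈ G.edgeSet, ∀ x, x ∈ e → x = p e ∨ x = q e := by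
      intro e he x hx
      rw [heq e he] at hx
      exact Sym2.mem_iff.1 hx
    have hadje := hpq e he
    have hadjf := hpq f hf
    have hqe := hBmem _ _ (hpA e he) hadje
    have hqf := hBmem _ _ (hpA f hf) hadjf
    rcases hconf with ⟨x, hxe, hxf⟩ | ⟨g, hg, ⟨x, hxe, hxg⟩, ⟨y, hyg, hyf⟩⟩
    · have h1 := hmem e he x hxe
      have h2 := hmem f hf x hxf
      have := hpA e he
      have := hpA f hf
      grind
    · have h1 := hmem e he x hxe
      have h2 := hmem f hf y hyf
      have h3 := hmem g hg x hxg
      have h4 := hmem g hg y hyg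
      have h5 := hpq g hg
      have h6 := hBmem _ _ (hpA g hg) h5
      have := hpA e he
      have := hpA f hf
      have := hpA g hg
      grind
  · intro e he
    have := hcL _ (hpA e he) _ (hpq e he)
    simp only [hpq e he, if_true] at this
    rwa [← heq e he] at this
end
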